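/- Let Λ = M·ℤ² with M ∈ SL(2,ℝ) be a unimodular lattice in ℝ² containing no nonzero vector of the form (0,v)ᵀ. Then the set of slopes {v/u : (u,v)ᵀ ∈ Λ, 0 < u ≤ 1, v > 0} is an infinite discrete subset of (0,∞); enumerating it increasingly as s₁ < s₂ < ⋯, for every 0 ≤ a < b < ∞ one has lim_{N→∞} (1/N)·#{1 ≤ n ≤ N : s_{n+1} − s_n ∈ (a,b)} = 2·Leb₂(A_{a,b}), where Leb₂ is two-dimensional Lebesgue measure. -/

import Mathlib

open Matrix MeasureTheory Filter Topology

noncomputable section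

/-- The lattice `M·ℤ² ⊆ ℝ²`. -/
def lattOf (M : Matrix (Fin 2) (Fin 2) ℝ) : Set (Fin 2 → ℝ) :=
  {w | ∃ m n : ℤ, w = M *ᵥ ![(m : ℝ), (n : ℝ)]}

/-- The set of slopes `v/u` of vectors `(u,v)ᵀ` of `L` with `0 < u ≤ 1` and `v > 0`. -/
def slopeSet (L : Set (Fin 2 → ℝ)) : Set ℝ :=
  {t | ∃ w ∈ L, 0 < w 0 ∧ w 0 ≤ 1 ∧ 0 < w 1 ∧ t = w 1 / w 0}

/-- The region `Ω = {(u,v) ∈ [0,1]² : u + v > 1}`. -/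
def regOmega : Set (ℝ × ℝ) :=
  {p | p.1 ∈ Set.Icc (0 : ℝ) 1 ∧ p.2 ∈ Set.Icc (0 : ℝ) 1 ∧ 1 < p.1 + p.2}

/-- The region `A_{α,β} = {(u,v) ∈ Ω : 1/β < uv < 1/α}` (for `α = 0` the upper
condition is vacuous). -/
def Aset (α β : ℝ) : Set (ℝ × ℝ) :=
  {p | p ∈ regOmega ∧ 1 < β * (p.1 * p.2) ∧ α * (p.1 * p.2) < 1}

section Kloosterman

variable {p : ℕ} [Fact p.Prime]

/-- The standard additive character of `ZMod p`. -/
local notation "ψ" => (ZMod.stdAddChar (N := p) : AddChar (ZMod p) ℂ)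

lemma norm_stdAddChar (x : ZMod p) : ‖ψ x‖ = 1 := AddChar.norm_apply _ _

lemma sum_stdAddChar_mul (b : ZMod p) :
    ∑ a : ZMod p, ψ (a * b) = if b = 0 then (p : ℂ) else 0 := by
  have h := AddChar.sum_mulShift b (ZMod.isPrimitive_stdAddChar p)
  simpa [ZMod.card] using h

lemma normSq_sum_stdAddChar {ι : Type*} (s : Finset ι) (f : ι → ZMod p) :
    ((‖∑ i ∈ s, ψ (f i)‖ ^ 2 : ℝ) : ℂ) = ∑ i ∈ s, ∑ j ∈ s, ψ (f i - f j) := by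
  rw [← Complex.normSq_eq_norm_sq, ← Complex.mul_conj, map_sum, Finset.sum_mul_sum]
  refine Finset.sum_congr rfl fun i _ => Finset.sum_congr rfl fun j _ => ?_
  rw [sub_eq_add_neg, AddChar.map_add_eq_mul, AddChar.map_neg_eq_conj]

lemma sum_normSq_sum_stdAddChar (s : Finset (ZMod p)) :
    ∑ a : ZMod p, ‖∑ i ∈ s, ψ (a * i)‖ ^ 2 = p * (s.card : ℝ) := by
  apply Complex.ofReal_injective
  push_cast
  have h : ∀ a : ZMod p, ((‖∑ i ∈ s, ψ (a * i)‖ : ℝ) : ℂ) ^ 2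
      = ∑ i ∈ s, ∑ j ∈ s, ψ (a * (i - j)) := by
    intro a
    rw [← Complex.ofReal_pow, normSq_sum_stdAddChar]
    simp only [mul_sub]
  rw [Finset.sum_congr rfl fun a _ => h a, Finset.sum_comm]
  have : ∀ i ∈ s, ∑ a : ZMod p, ∑ j ∈ s, ψ (a * (i - j)) = p := by
    intro i hi
    rw [Finset.sum_comm]
    simp only [sum_stdAddChar_mul, sub_eq_zero]
    simp [hi]
  rw [Finset.sum_congr rfl this]
  simp [mul_comm]

lemma sum_sum_normSq_sum_stdAddChar {ι : Type*} [Fintype ι] (f g : ι → ZMod p) :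
    ∑ a : ZMod p, ∑ b : ZMod p, ‖∑ i, ψ (a * f i + b * g i)‖ ^ 2
      = p ^ 2 * ((Finset.univ.filter fun q : ι × ι => f q.1 = f q.2 ∧ g q.1 = g q.2).card : ℝ) := by
  apply Complex.ofReal_injective
  push_cast
  have h : ∀ a b : ZMod p, ((‖∑ i, ψ (a * f i + b * g i)‖ : ℝ) : ℂ) ^ 2
      = ∑ q : ι × ι, ψ (a * (f q.1 - f q.2)) * ψ (b * (g q.1 - g q.2)) := by
    intro a b
    rw [← Complex.ofReal_pow, normSq_sum_stdAddChar, Fintype.sum_prod_type]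
    refine Finset.sum_congr rfl fun i _ => Finset.sum_congr rfl fun j _ => ?_
    rw [← AddChar.map_add_eq_mul]
    congr 1
    ring
  simp only [h]
  have h2 : ∀ a : ZMod p, ∑ b : ZMod p, ∑ q : ι × ι,
      ψ (a * (f q.1 - f q.2)) * ψ (b * (g q.1 - g q.2))
      = ∑ q : ι × ι, ψ (a * (f q.1 - f q.2)) * if g q.1 = g q.2 then (p : ℂ) else 0 := by
    intro a
    rw [Finset.sum_comm]
    simp only [← Finset.mul_sum, sum_stdAddChar_mul, sub_eq_zero]
  simp only [h2]
  rw [Finset.sum_comm]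
  simp only [← Finset.sum_mul, sum_stdAddChar_mul, sub_eq_zero]
  rw [Finset.card_filter, Nat.cast_sum, Finset.mul_sum]
  refine Finset.sum_congr rfl fun q _ => ?_
  by_cases h1 : f q.1 = f q.2 <;> by_cases h2 : g q.1 = g q.2 <;> simp [h1, h2, sq]

variable (p) in
/-- The Kloosterman sum modulo a prime. -/
def kloosterman (a b : ZMod p) : ℂ :=
  ∑ x : (ZMod p)ˣ, ψ (a * x + b * (x⁻¹ : (ZMod p)ˣ))

lemma kloosterman_smul (a b : ZMod p) (t : (ZMod p)ˣ) :
    kloosterman p (a * t) (b * (t⁻¹ : (ZMod p)ˣ)) = kloosterman p a b := by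
  unfold kloosterman
  refine Fintype.sum_equiv (Equiv.mulLeft t) _ _ fun x => ?_
  simp only [Equiv.coe_mulLeft, Units.val_mul, _root_.mul_inv_rev]
  congr 1
  ring

lemma card_kloosterman_solutions :
    ((Finset.univ.filter fun q : ((ZMod p)ˣ × (ZMod p)ˣ) × ((ZMod p)ˣ × (ZMod p)ˣ) =>
      ((q.1.1 : ZMod p) + q.1.2 = q.2.1 + q.2.2 ∧
      ((q.1.1⁻¹ : (ZMod p)ˣ) : ZMod p) + (q.1.2⁻¹ : (ZMod p)ˣ)
        = (q.2.1⁻¹ : (ZMod p)ˣ) + (q.2.2⁻¹ : (ZMod p)ˣ))).card : ℝ) ≤ 3 * (p - 1 : ℝ) ^ 2 := by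
  classical
  let U := (ZMod p)ˣ
  let f : Fin 3 × (U × U) → (U × U) × (U × U) := fun r =>
    match r.1 with
    | 0 => (r.2, r.2)
    | 1 => (r.2, (r.2.2, r.2.1))
    | 2 => ((r.2.1, -r.2.1), (r.2.2, -r.2.2))
  have hsub : (Finset.univ.filter fun q : ((ZMod p)ˣ × (ZMod p)ˣ) × ((ZMod p)ˣ × (ZMod p)ˣ) =>
      ((q.1.1 : ZMod p) + q.1.2 = q.2.1 + q.2.2 ∧
      ((q.1.1⁻¹ : (ZMod p)ˣ) : ZMod p) + (q.1.2⁻¹ : (ZMod p)ˣ)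
        = (q.2.1⁻¹ : (ZMod p)ˣ) + (q.2.2⁻¹ : (ZMod p)ˣ))) ⊆ Finset.univ.image f := by
    rintro ⟨⟨x, y⟩, ⟨z, w⟩⟩ hq
    simp only [Finset.mem_filter, Finset.mem_univ, true_and, Units.val_inv_eq_inv_val] at hq
    obtain ⟨h1, h2⟩ := hq
    have hx := x.ne_zero
    have hy := y.ne_zero
    have hz := z.ne_zero
    have hw := w.ne_zero
    simp only [Finset.mem_image, Finset.mem_univ, true_and, Prod.exists]
    field_simp at h2
    have h3 : ((x : ZMod p) + y) * ((z : ZMod p) * w - x * y) = 0 := by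
      have : ((x : ZMod p) + y) * (z * w) = ((z : ZMod p) + w) * (x * y) := by
        linear_combination h2
      rw [← h1] at this
      linear_combination this
    rcases mul_eq_zero.1 h3 with h4 | h4
    · refine ⟨2, x, z, ?_⟩
      have e1 : y = -x := Units.ext (by push_cast; linear_combination h4)
      have e2 : w = -z := Units.ext (by push_cast; linear_combination h4 - h1)
      simp [f, e1, e2]
    · have h5 : ((x : ZMod p) - z) * ((x : ZMod p) - w) = 0 := by
        linear_combination h4 + (x : ZMod p) * h1
      rcases mul_eq_zero.1 h5 with h6 | h6
      · have e1 : x = z := Units.ext (by linear_combination h6)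
        have e2 : y = w := Units.ext (by linear_combination h1 - h6)
        exact ⟨0, x, y, by simp [f, e1, e2]⟩
      · have e1 : x = w := Units.ext (by linear_combination h6)
        have e2 : y = z := Units.ext (by linear_combination h1 - h6)
        exact ⟨1, x, y, by simp [f, e1, e2]⟩
  have hcard := (Finset.card_le_card hsub).trans Finset.card_image_le
  have hp : 1 ≤ p := (Fact.out : p.Prime).one_lt.le
  have h2 : Finset.card (Finset.univ : Finset (Fin 3 × (U × U))) = 3 * (p - 1) ^ 2 := by
    simp [U, Finset.card_univ, ZMod.card_units_eq_totient, Nat.totient_prime (Fact.out : p.Prime),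
      sq]
  rw [h2] at hcard
  have := (Nat.cast_le (α := ℝ)).2 hcard
  rw [Nat.cast_mul, Nat.cast_pow, Nat.cast_sub hp] at this
  exact_mod_cast this

lemma norm_kloosterman_pow_four_le (a b : ZMod p) (hab : a ≠ 0 ∨ b ≠ 0) :
    ‖kloosterman p a b‖ ^ 4 ≤ 3 * (p : ℝ) ^ 3 := by
  classical
  have hp : (1 : ℝ) < p := by exact_mod_cast (Fact.out : p.Prime).one_lt
  have hsq : ∀ a b : ZMod p, ‖kloosterman p a b‖ ^ 4
      = ‖∑ q : (ZMod p)ˣ × (ZMod p)ˣ, ψ (a * (q.1 + q.2)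
        + b * ((q.1⁻¹ : (ZMod p)ˣ) + (q.2⁻¹ : (ZMod p)ˣ)))‖ ^ 2 := by
    intro a b
    rw [show ‖kloosterman p a b‖ ^ 4 = ‖kloosterman p a b * kloosterman p a b‖ ^ 2 by
      rw [norm_mul]; ring]
    congr 2
    rw [kloosterman, Finset.sum_mul_sum, Fintype.sum_prod_type]
    refine Finset.sum_congr rfl fun i _ => Finset.sum_congr rfl fun j _ => ?_
    rw [← AddChar.map_add_eq_mul]
    congr 1
    ring
  have htot : ∑ a : ZMod p, ∑ b : ZMod p, ‖kloosterman p a b‖ ^ 4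
      ≤ p ^ 2 * (3 * (p - 1 : ℝ) ^ 2) := by
    simp only [hsq]
    rw [sum_sum_normSq_sum_stdAddChar (ι := (ZMod p)ˣ × (ZMod p)ˣ)
      (fun q => (q.1 : ZMod p) + (q.2 : ZMod p))
      (fun q => ((q.1⁻¹ : (ZMod p)ˣ) : ZMod p) + (q.2⁻¹ : (ZMod p)ˣ))]
    gcongr
    exact card_kloosterman_solutions
  have hinj : Function.Injective
      (fun t : (ZMod p)ˣ => (a * (t : ZMod p), b * ((t⁻¹ : (ZMod p)ˣ) : ZMod p))) := by
    intro t t' h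
    simp only [Prod.mk.injEq] at h
    rcases hab with ha | hb
    · exact Units.ext (mul_left_cancel₀ ha h.1)
    · exact inv_injective (Units.ext (mul_left_cancel₀ hb h.2))
  have hle : ∑ t : (ZMod p)ˣ, ‖kloosterman p a b‖ ^ 4
      ≤ ∑ a : ZMod p, ∑ b : ZMod p, ‖kloosterman p a b‖ ^ 4 := by
    rw [← Fintype.sum_prod_type (f := fun q : ZMod p × ZMod p => ‖kloosterman p q.1 q.2‖ ^ 4)]
    calc ∑ t : (ZMod p)ˣ, ‖kloosterman p a b‖ ^ 4
        = ∑ q ∈ Finset.univ.image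
          (fun t : (ZMod p)ˣ => (a * (t : ZMod p), b * ((t⁻¹ : (ZMod p)ˣ) : ZMod p))),
          ‖kloosterman p q.1 q.2‖ ^ 4 := by
          rw [Finset.sum_image fun x _ y _ h => hinj h]
          simp only [kloosterman_smul]
      _ ≤ _ := Finset.sum_le_sum_of_subset_of_nonneg (Finset.subset_univ _)
          fun _ _ _ => by positivity
  have hcard : ((Fintype.card (ZMod p)ˣ : ℕ) : ℝ) = p - 1 := by
    rw [ZMod.card_units, Nat.cast_sub (by exact_mod_cast hp.le)]
    simp
  rw [Finset.sum_const, Finset.card_univ, nsmul_eq_mul, hcard] at hle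
  have h1 : (p - 1 : ℝ) * ‖kloosterman p a b‖ ^ 4 ≤ (p - 1) * (p ^ 2 * (3 * (p - 1))) := by
    calc _ ≤ _ := hle
      _ ≤ _ := htot
      _ = _ := by ring
  have h2 := le_of_mul_le_mul_left h1 (by linarith)
  nlinarith [sq_nonneg (p : ℝ)]

/-- The function `x ↦ e(a x⁻¹ / p)`, extended by zero at `x = 0`. -/
def invPhase (a x : ZMod p) : ℂ := if x = 0 then 0 else ψ (a * x⁻¹)

lemma norm_invPhase_le (a x : ZMod p) : ‖invPhase a x‖ ≤ 1 := by
  unfold invPhase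
  split_ifs
  · simp
  · rw [norm_stdAddChar]

lemma sum_invPhase_mul (a j : ZMod p) :
    ∑ y : ZMod p, invPhase a y * ψ (j * y) = kloosterman p j a := by
  classical
  rw [← Finset.sum_filter_add_sum_filter_not Finset.univ (fun y : ZMod p => y = 0)]
  have h0 : ∑ y ∈ Finset.univ.filter (fun y : ZMod p => y = 0), invPhase a y * ψ (j * y) = 0 :=
    Finset.sum_eq_zero fun y hy => by simp [invPhase, (Finset.mem_filter.1 hy).2]
  rw [h0, zero_add, kloosterman]
  symm
  refine Finset.sum_bij (fun (x : (ZMod p)ˣ) _ => (x : ZMod p)) ?_ ?_ ?_ ?_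
  · intro x _
    simp
  · intro x _ y _ h
    exact Units.ext h
  · intro y hy
    exact ⟨Units.mk0 y (Finset.mem_filter.1 hy).2, Finset.mem_univ _, rfl⟩
  · intro x _
    rw [invPhase, if_neg x.ne_zero, ← AddChar.map_add_eq_mul, Units.val_inv_eq_inv_val, add_comm]

lemma invPhase_eq_sum (a x : ZMod p) :
    invPhase a x = (p : ℂ)⁻¹ * ∑ j : ZMod p, ψ (j * x) * kloosterman p (-j) a := by
  classical
  have hp : (p : ℂ) ≠ 0 := by exact_mod_cast (Fact.out : p.Prime).ne_zero
  simp only [← sum_invPhase_mul, Finset.mul_sum]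
  rw [Finset.sum_comm]
  have : ∀ y : ZMod p, ∑ j : ZMod p, (p : ℂ)⁻¹ * (ψ (j * x) * (invPhase a y * ψ (-j * y)))
      = if y = x then invPhase a y else 0 := by
    intro y
    have h1 : ∀ j : ZMod p, (p : ℂ)⁻¹ * (ψ (j * x) * (invPhase a y * ψ (-j * y)))
        = (p : ℂ)⁻¹ * invPhase a y * ψ (j * (x - y)) := by
      intro j
      rw [show j * (x - y) = j * x + (-j * y) by ring, AddChar.map_add_eq_mul]
      ring
    rw [Finset.sum_congr rfl fun j _ => h1 j, ← Finset.mul_sum, sum_stdAddChar_mul]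
    by_cases hxy : y = x
    · simp [hxy]
      field_simp
    · simp [hxy, sub_eq_zero, Ne.symm hxy]
  simp_rw [this]
  simp

lemma norm_sum_sum_invPhase_le (a : ZMod p) (ha : a ≠ 0) (s t : Finset (ZMod p)) :
    ‖∑ x ∈ s, ∑ y ∈ t, invPhase a (x + y)‖ ^ 4
      ≤ 3 * (p : ℝ) ^ 3 * ((s.card : ℝ) * t.card) ^ 2 := by
  have hp : (0 : ℝ) < p := by exact_mod_cast (Fact.out : p.Prime).pos
  set B : ℝ := (3 * (p : ℝ) ^ 3) ^ ((1 : ℝ) / 4) with hB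
  have hB0 : 0 ≤ B := by positivity
  have hB4 : B ^ 4 = 3 * (p : ℝ) ^ 3 := by
    rw [hB, ← Real.rpow_natCast, ← Real.rpow_mul (by positivity)]
    norm_num
  have hK : ∀ j, ‖kloosterman p j a‖ ≤ B := by
    intro j
    have := norm_kloosterman_pow_four_le j a (Or.inr ha)
    rw [← hB4] at this
    exact le_of_pow_le_pow_left₀ (by norm_num) hB0 this
  have hrew : ∑ x ∈ s, ∑ y ∈ t, invPhase a (x + y)
      = (p : ℂ)⁻¹ * ∑ j : ZMod p, kloosterman p (-j) a *
        ((∑ x ∈ s, ψ (j * x)) * ∑ y ∈ t, ψ (j * y)) := by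
    simp only [invPhase_eq_sum, ← Finset.mul_sum]
    congr 1
    have : ∀ x ∈ s, ∑ y ∈ t, ∑ j : ZMod p, ψ (j * (x + y)) * kloosterman p (-j) a
        = ∑ j : ZMod p, ∑ y ∈ t, ψ (j * (x + y)) * kloosterman p (-j) a :=
      fun x _ => Finset.sum_comm
    rw [Finset.sum_congr rfl this, Finset.sum_comm]
    refine Finset.sum_congr rfl fun j _ => ?_
    rw [Finset.sum_mul_sum, Finset.mul_sum]
    refine Finset.sum_congr rfl fun x _ => ?_
    rw [Finset.mul_sum]
    refine Finset.sum_congr rfl fun y _ => ?_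
    rw [mul_add, AddChar.map_add_eq_mul]
    ring
  have hCS : (∑ j : ZMod p, ‖∑ x ∈ s, ψ (j * x)‖ * ‖∑ y ∈ t, ψ (j * y)‖) ^ 2
      ≤ (p * (s.card : ℝ)) * (p * t.card) := by
    rw [← sum_normSq_sum_stdAddChar, ← sum_normSq_sum_stdAddChar]
    exact Finset.sum_mul_sq_le_sq_mul_sq _ _ _
  set Q := ∑ j : ZMod p, ‖∑ x ∈ s, ψ (j * x)‖ * ‖∑ y ∈ t, ψ (j * y)‖ with hQ
  have hQ0 : 0 ≤ Q := Finset.sum_nonneg fun _ _ => by positivity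
  have h1 : ‖∑ x ∈ s, ∑ y ∈ t, invPhase a (x + y)‖ ≤ (p : ℝ)⁻¹ * (B * Q) := by
    rw [hrew, norm_mul, norm_inv, Complex.norm_natCast]
    gcongr
    refine (norm_sum_le _ _).trans ?_
    rw [hQ, Finset.mul_sum]
    refine Finset.sum_le_sum fun j _ => ?_
    rw [norm_mul, norm_mul]
    gcongr
    exact hK _
  calc _ ≤ ((p : ℝ)⁻¹ * (B * Q)) ^ 4 := by gcongr
    _ = (p : ℝ)⁻¹ ^ 4 * (B ^ 4 * (Q ^ 2) ^ 2) := by ring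
    _ ≤ (p : ℝ)⁻¹ ^ 4 * (B ^ 4 * ((p * (s.card : ℝ)) * (p * t.card)) ^ 2) := by gcongr
    _ = _ := by
      rw [hB4]
      field_simp

end Kloosterman

section IncompleteSums

lemma norm_sum_range_sub_shift_le (f : ℕ → ℂ) (hf : ∀ n, ‖f n‖ ≤ 1) (L h : ℕ) :
    ‖∑ t ∈ Finset.range L, f t - ∑ t ∈ Finset.range L, f (h + t)‖ ≤ 2 * h := by
  have h1 := Finset.sum_range_add f h L
  have h2 := Finset.sum_range_add f L h
  rw [add_comm h L] at h1
  have h3 : ∑ t ∈ Finset.range L, f t - ∑ t ∈ Finset.range L, f (h + t)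
      = ∑ t ∈ Finset.range h, f t - ∑ t ∈ Finset.range h, f (L + t) := by
    linear_combination h1 - h2
  have hb : ∀ g : ℕ → ℂ, (∀ n, ‖g n‖ ≤ 1) → ‖∑ t ∈ Finset.range h, g t‖ ≤ h := by
    intro g hg
    refine (norm_sum_le_of_le _ fun t _ => hg t).trans (by simp)
  rw [h3]
  refine (norm_sub_le _ _).trans ?_
  linarith [hb f hf, hb (fun t => f (L + t)) fun _ => hf _]

lemma norm_sum_range_invPhase_le_of_le {p : ℕ} [Fact p.Prime] (a : ZMod p) (ha : a ≠ 0)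
    (c : ZMod p) {L H : ℕ} (hL : L ≤ p) (hH : H ≤ p) {δ : ℝ} (hδ : 0 ≤ δ)
    (hpH : 3 * (p : ℝ) ≤ δ ^ 4 * H ^ 2) (hH0 : 0 < H) :
    ‖∑ t ∈ Finset.range L, invPhase a (c + t)‖ ≤ δ * p + 2 * H := by
  classical
  have hp : (0 : ℝ) < p := by exact_mod_cast (Fact.out : p.Prime).pos
  have hinj : ∀ M : ℕ, M ≤ p → ∀ d : ZMod p,
      Set.InjOn (fun t : ℕ => d + (t : ZMod p)) (Finset.range M) := by
    intro M hM d x hx y hy hxy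
    simp only [add_right_inj] at hxy
    have := (ZMod.natCast_eq_natCast_iff' _ _ _).1 hxy
    rw [Nat.mod_eq_of_lt, Nat.mod_eq_of_lt] at this
    · exact this
    · exact (Finset.mem_range.1 hy).trans_le hM
    · exact (Finset.mem_range.1 hx).trans_le hM
  set D : ℂ := ∑ t ∈ Finset.range L, ∑ h ∈ Finset.range H, invPhase a (c + t + h) with hD
  have hD4 : ‖D‖ ^ 4 ≤ 3 * (p : ℝ) ^ 3 * ((L : ℝ) * H) ^ 2 := by
    have := norm_sum_sum_invPhase_le a ha ((Finset.range L).image fun t : ℕ => c + (t : ZMod p))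
      ((Finset.range H).image fun t : ℕ => (0 : ZMod p) + (t : ZMod p))
    rw [Finset.sum_image (hinj L hL c), Finset.card_image_of_injOn (hinj L hL c),
      Finset.card_image_of_injOn (hinj H hH 0), Finset.card_range, Finset.card_range] at this
    rw [Finset.sum_congr rfl fun x _ => Finset.sum_image (hinj H hH 0)] at this
    simpa only [zero_add] using this
  have hDle : ‖D‖ ≤ δ * p * H := by
    refine le_of_pow_le_pow_left₀ (n := 4) (by norm_num) (by positivity) (hD4.trans ?_)
    have hL' : (L : ℝ) ≤ p := by exact_mod_cast hL
    calc 3 * (p : ℝ) ^ 3 * ((L : ℝ) * H) ^ 2 ≤ 3 * (p : ℝ) ^ 3 * ((p : ℝ) * H) ^ 2 := by gcongr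
      _ = (3 * (p : ℝ)) * ((p : ℝ) ^ 4 * (H : ℝ) ^ 2) := by ring
      _ ≤ (δ ^ 4 * (H : ℝ) ^ 2) * ((p : ℝ) ^ 4 * (H : ℝ) ^ 2) := by gcongr
      _ = _ := by ring
  have hkey : (H : ℝ) * ‖∑ t ∈ Finset.range L, invPhase a (c + t)‖ ≤ ‖D‖ + 2 * H * H := by
    have h1 : (H : ℂ) * ∑ t ∈ Finset.range L, invPhase a (c + t)
        = D + ∑ h ∈ Finset.range H, (∑ t ∈ Finset.range L, invPhase a (c + t)
          - ∑ t ∈ Finset.range L, invPhase a (c + t + h)) := by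
      rw [Finset.sum_sub_distrib, hD, Finset.sum_comm]
      simp
    have h2 : ‖(H : ℂ) * ∑ t ∈ Finset.range L, invPhase a (c + t)‖
        = (H : ℝ) * ‖∑ t ∈ Finset.range L, invPhase a (c + t)‖ := by
      rw [norm_mul, Complex.norm_natCast]
    rw [← h2, h1]
    refine (norm_add_le _ _).trans ?_
    gcongr
    refine (norm_sum_le_of_le (f := fun h : ℕ => (∑ t ∈ Finset.range L, invPhase a (c + t)
          - ∑ t ∈ Finset.range L, invPhase a (c + t + h))) _ (n := fun _ => 2 * (H : ℝ)) ?_).trans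
          (by simp; linarith)
    intro h hh
    have h3 := norm_sum_range_sub_shift_le (fun t : ℕ => invPhase a (c + t))
      (fun _ => norm_invPhase_le _ _) L h
    have h4 : ∑ t ∈ Finset.range L, invPhase a (c + t + h)
        = ∑ t ∈ Finset.range L, invPhase a (c + ((h + t : ℕ) : ZMod p)) :=
      Finset.sum_congr rfl fun t _ => by push_cast; ring_nf
    rw [h4]
    refine h3.trans ?_
    have : (h : ℝ) ≤ H := by exact_mod_cast (Finset.mem_range.1 hh).le
    linarith
  have hH' : (0 : ℝ) < H := by exact_mod_cast hH0
  refine le_of_mul_le_mul_left ?_ hH'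
  nlinarith

lemma exists_norm_sum_range_invPhase_le {ε : ℝ} (hε : 0 < ε) :
    ∃ p₀ : ℕ, ∀ (p : ℕ) [Fact p.Prime], p₀ ≤ p → ∀ (a : ZMod p), a ≠ 0 → ∀ (c : ZMod p) (L : ℕ),
      ‖∑ t ∈ Finset.range L, invPhase a (c + t)‖ ≤ ε * (L + p) := by
  wlog hε1 : ε ≤ 1 generalizing ε
  · obtain ⟨p₀, h⟩ := this one_pos le_rfl
    refine ⟨p₀, fun p _ hp a ha c L => (h p hp a ha c L).trans ?_⟩
    have : (0 : ℝ) ≤ (L : ℝ) + p := by positivity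
    nlinarith
  obtain ⟨p₀, hp₀⟩ := exists_nat_ge (max (8 / ε) (3072 / ε ^ 6))
  refine ⟨p₀, fun p _ hp a ha => ?_⟩
  have hpR : max (8 / ε) (3072 / ε ^ 6) ≤ (p : ℝ) := hp₀.trans (by exact_mod_cast hp)
  have h8 : 8 ≤ ε * p := by
    have := (le_max_left _ _).trans hpR
    rw [div_le_iff₀ hε] at this
    linarith
  have h3072 : 3072 ≤ ε ^ 6 * p := by
    have := (le_max_right _ _).trans hpR
    rw [div_le_iff₀ (by positivity)] at this
    linarith
  have hp0 : (0 : ℝ) < p := by exact_mod_cast (Fact.out : p.Prime).pos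
  set H := ⌊ε * p / 4⌋₊ with hHdef
  have hH1 : (H : ℝ) ≤ ε * p / 4 := Nat.floor_le (by positivity)
  have hH2 : ε * p / 8 ≤ H := by
    have := Nat.lt_floor_add_one (ε * p / 4)
    rw [← hHdef] at this
    linarith
  have hHpos : 0 < H := by
    have : (0 : ℝ) < H := by linarith
    exact_mod_cast this
  have hHp : H ≤ p := by
    have : (H : ℝ) ≤ p := by nlinarith
    exact_mod_cast this
  have hcond : 3 * (p : ℝ) ≤ (ε / 2) ^ 4 * H ^ 2 := by
    have : (ε * p / 8) ^ 2 ≤ (H : ℝ) ^ 2 := by gcongr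
    calc 3 * (p : ℝ) = 3072 * p / 1024 := by ring
      _ ≤ (ε ^ 6 * p) * p / 1024 := by gcongr
      _ = (ε / 2) ^ 4 * (ε * p / 8) ^ 2 := by ring
      _ ≤ _ := by gcongr
  have hshort : ∀ (c : ZMod p) (L : ℕ), L ≤ p →
      ‖∑ t ∈ Finset.range L, invPhase a (c + t)‖ ≤ ε * p := by
    intro c L hL
    have := norm_sum_range_invPhase_le_of_le a ha c hL hHp (by positivity) hcond hHpos
    linarith
  intro c L
  induction L using Nat.strong_induction_on with
  | _ L ih =>
    rcases le_total L p with hL | hL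
    · refine (hshort c L hL).trans ?_
      have : (0 : ℝ) ≤ L := by positivity
      nlinarith
    · obtain ⟨M, rfl⟩ := Nat.exists_eq_add_of_le' hL
      have hM := ih M (by have := (Fact.out : p.Prime).pos; omega)
      rw [Finset.sum_range_add]
      refine (norm_add_le _ _).trans ?_
      have := hshort (c + M) p le_rfl
      have h2 : ∑ x ∈ Finset.range p, invPhase a (c + ((M + x : ℕ) : ZMod p))
          = ∑ x ∈ Finset.range p, invPhase a (c + M + x) :=
        Finset.sum_congr rfl fun x _ => by push_cast; ring_nf
      rw [h2]
      push_cast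
      linarith

end IncompleteSums

section KloostermanFractions

/-- For coprime `m`, `n` and `m * n' - n * m' = 1` this is `e(k m' / m)`. -/
def kloPhase (k m n : ℤ) : ℂ :=
  if Int.gcd m n = 1 then Complex.exp (2 * Real.pi * Complex.I * (k * (-(Int.gcdB m n) : ℤ)) / m)
  else 0

lemma norm_exp_two_pi_I_mul_real (x : ℝ) : ‖Complex.exp (2 * Real.pi * Complex.I * x)‖ = 1 := by
  rw [show (2 * Real.pi * Complex.I * x : ℂ) = ((2 * Real.pi * x : ℝ) : ℂ) * Complex.I by
    push_cast; ring]
  exact Complex.norm_exp_ofReal_mul_I _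

lemma norm_kloPhase_le (k m n : ℤ) : ‖kloPhase k m n‖ ≤ 1 := by
  unfold kloPhase
  split_ifs
  · have := norm_exp_two_pi_I_mul_real ((k * (-(Int.gcdB m n) : ℤ)) / m)
    push_cast at this ⊢
    rw [mul_div_assoc, this]
  · simp

lemma kloPhase_of_gcd_ne {k m n : ℤ} (h : Int.gcd m n ≠ 1) : kloPhase k m n = 0 := if_neg h

lemma exp_two_pi_I_div_eq_of_dvd {m a b : ℤ} (hm : m ≠ 0) (h : m ∣ a - b) :
    Complex.exp (2 * Real.pi * Complex.I * a / m)
      = Complex.exp (2 * Real.pi * Complex.I * b / m) := by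
  obtain ⟨t, ht⟩ := h
  have ha : (a : ℂ) = b + m * t := by
    have : a = b + m * t := by linarith
    exact_mod_cast this
  have hm' : (m : ℂ) ≠ 0 := by exact_mod_cast hm
  rw [Complex.exp_eq_exp_iff_exists_int]
  refine ⟨t, ?_⟩
  rw [ha]
  field_simp

lemma kloPhase_eq {k m n m' n' : ℤ} (hm : m ≠ 0) (h : m * n' - n * m' = 1) :
    kloPhase k m n = Complex.exp (2 * Real.pi * Complex.I * (k * m' : ℤ) / m) := by
  have hg : Int.gcd m n = 1 := by
    rw [← Int.isCoprime_iff_gcd_eq_one]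
    exact ⟨n', -m', by linarith⟩
  rw [kloPhase, if_pos hg]
  have hb := Int.gcd_eq_gcd_ab m n
  rw [hg] at hb
  push_cast at hb
  have hd : m ∣ n * (-(Int.gcdB m n) - m') := ⟨Int.gcdA m n - n', by linarith⟩
  have hd2 : m ∣ -(Int.gcdB m n) - m' :=
    (Int.isCoprime_iff_gcd_eq_one.2 hg).dvd_of_dvd_mul_left hd
  have := exp_two_pi_I_div_eq_of_dvd (a := k * -(Int.gcdB m n)) (b := k * m') hm
    (by rw [← mul_sub]; exact hd2.mul_left k)
  push_cast at this ⊢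
  exact this

lemma exists_bezout {m n : ℤ} (h : Int.gcd m n = 1) : ∃ m' n' : ℤ, m * n' - n * m' = 1 := by
  obtain ⟨a, b, hab⟩ := Int.isCoprime_iff_gcd_eq_one.2 h
  exact ⟨-b, a, by linarith⟩

lemma kloPhase_neg_left (k m n : ℤ) : kloPhase k (-m) n = kloPhase (-k) m n := by
  rcases eq_or_ne m 0 with rfl | hm
  · simp [kloPhase]
  by_cases hg : Int.gcd m n = 1
  · obtain ⟨m', n', h⟩ := exists_bezout hg
    rw [kloPhase_eq (m' := m') (n' := -n') (neg_ne_zero.2 hm) (by linarith), kloPhase_eq hm h]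
    congr 1
    push_cast
    have : (m : ℂ) ≠ 0 := by exact_mod_cast hm
    field_simp
  · rw [kloPhase_of_gcd_ne hg, kloPhase_of_gcd_ne (by rwa [Int.neg_gcd])]

lemma exists_kloPhase_eq_mul_invPhase {p : ℕ} [Fact p.Prime] {m₁ : ℕ} (hm₁ : 0 < m₁)
    (hpm : ¬ p ∣ m₁) {k : ℤ} (hk : ¬ (p : ℤ) ∣ k) (r : ℤ) (hr : Int.gcd m₁ r = 1) :
    ∃ (C : ℂ) (a c : ZMod p), ‖C‖ ≤ 1 ∧ a ≠ 0 ∧ ∀ t : ℕ,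
      kloPhase k ((p * m₁ : ℕ) : ℤ) (r + m₁ * t) = C * invPhase a (c + t) := by
  have hp : p.Prime := Fact.out
  have hcop : Int.gcd (p : ℤ) m₁ = 1 := by
    simpa using (Nat.Prime.coprime_iff_not_dvd hp).2 hpm
  obtain ⟨P, Q, hPQ⟩ := Int.isCoprime_iff_gcd_eq_one.2 hcop
  obtain ⟨R, S, hRS⟩ := exists_bezout hr
  have hm1Z : (m₁ : ZMod p) ≠ 0 := by rwa [Ne, ZMod.natCast_eq_zero_iff]
  have hkZ : (k : ZMod p) ≠ 0 := by rwa [Ne, ZMod.intCast_zmod_eq_zero_iff_dvd]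
  have hQm : (Q : ZMod p) * m₁ = 1 := by
    have := congrArg (Int.cast : ℤ → ZMod p) hPQ
    push_cast at this
    simpa using this
  have hQZ : (Q : ZMod p) ≠ 0 := left_ne_zero_of_mul_eq_one hQm
  have hpC : (p : ℂ) ≠ 0 := by exact_mod_cast hp.ne_zero
  have hm1C : (m₁ : ℂ) ≠ 0 := by exact_mod_cast hm₁.ne'
  refine ⟨Complex.exp (2 * Real.pi * Complex.I * (k * R * P : ℤ) / (m₁ : ℤ)),
    -(k * Q) * (m₁ : ZMod p)⁻¹, r * (m₁ : ZMod p)⁻¹, ?_, ?_, ?_⟩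
  · have := norm_exp_two_pi_I_mul_real ((k * R * P : ℤ) / (m₁ : ℤ))
    push_cast at this ⊢
    rw [mul_div_assoc, this]
  · exact mul_ne_zero (neg_ne_zero.2 (mul_ne_zero hkZ hQZ)) (inv_ne_zero hm1Z)
  · intro t
    have hx : (r : ZMod p) * (m₁ : ZMod p)⁻¹ + t
        = (m₁ : ZMod p)⁻¹ * ((r + m₁ * t : ℤ) : ZMod p) := by
      push_cast
      field_simp
    set n : ℤ := r + m₁ * t with hn
    by_cases hpn : ((n : ℤ) : ZMod p) = 0
    · rw [invPhase, if_pos (by rw [hx, hpn, mul_zero]), mul_zero]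
      apply kloPhase_of_gcd_ne
      intro hg
      rw [ZMod.intCast_zmod_eq_zero_iff_dvd] at hpn
      have h1 : (p : ℤ) ∣ Int.gcd ((p * m₁ : ℕ) : ℤ) n :=
        Int.dvd_coe_gcd (by push_cast; exact dvd_mul_right _ _) hpn
      rw [hg] at h1
      exact hp.one_lt.ne' (by exact_mod_cast Int.eq_one_of_dvd_one (by positivity) h1)
    · have hg : Int.gcd ((p * m₁ : ℕ) : ℤ) n = 1 := by
        rw [← Int.isCoprime_iff_gcd_eq_one]
        push_cast
        refine IsCoprime.mul_left ?_ ?_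
        · rw [ZMod.intCast_zmod_eq_zero_iff_dvd] at hpn
          exact ((Nat.prime_iff_prime_int.1 hp).coprime_iff_not_dvd).2 hpn
        · rw [hn]
          exact (Int.isCoprime_iff_gcd_eq_one.2 hr).add_mul_left_right _
      obtain ⟨m', n', h⟩ := exists_bezout hg
      have hpm0 : ((p * m₁ : ℕ) : ℤ) ≠ 0 := by exact_mod_cast (Nat.mul_pos hp.pos hm₁).ne'
      rw [kloPhase_eq hpm0 h, invPhase, if_neg (by
        rw [hx]; exact mul_ne_zero (inv_ne_zero hm1Z) hpn), hx]
      have hm'Z : (m' : ZMod p) = -(n : ZMod p)⁻¹ := by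
        have := congrArg (Int.cast : ℤ → ZMod p) h
        push_cast at this
        simp only [CharP.cast_eq_zero, zero_mul, zero_sub] at this
        field_simp
        linear_combination -this
      have harg : -((k : ZMod p) * Q) * (m₁ : ZMod p)⁻¹ * ((m₁ : ZMod p)⁻¹ * (n : ZMod p))⁻¹
          = ((k * m' * Q : ℤ) : ZMod p) := by
        push_cast
        rw [hm'Z]
        field_simp
      rw [harg, ZMod.stdAddChar_coe]
      have hdvd : (m₁ : ℤ) ∣ m' - R := by
        have h1 : (m₁ : ℤ) ∣ r * (m' - R) := by
          refine ⟨p * n' - S - t * m', ?_⟩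
          push_cast at h
          rw [hn] at h
          linear_combination hRS - h
        exact (Int.isCoprime_iff_gcd_eq_one.2 hr).dvd_of_dvd_mul_left h1
      have hC := exp_two_pi_I_div_eq_of_dvd (m := m₁) (a := k * m' * P) (b := k * R * P)
        (by exact_mod_cast hm₁.ne') (by
          rw [show k * m' * P - k * R * P = (k * P) * (m' - R) by ring]
          exact hdvd.mul_left _)
      rw [← hC, ← Complex.exp_add]
      congr 1
      have hPQC : (P : ℂ) * p + Q * m₁ = 1 := by exact_mod_cast hPQ
      push_cast
      field_simp
      linear_combination (-(k * m' : ℂ)) * hPQC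

lemma sum_range_mul_eq (g : ℕ → ℂ) (a b : ℕ) :
    ∑ x ∈ Finset.range (a * b), g x
      = ∑ r ∈ Finset.range a, ∑ t ∈ Finset.range b, g (r + a * t) := by
  rw [Finset.sum_comm]
  induction b with
  | zero => simp
  | succ b ih =>
    rw [mul_add_one, Finset.sum_range_add, ih, Finset.sum_range_succ]
    congr 1
    exact Finset.sum_congr rfl fun x _ => by rw [add_comm]

lemma exists_norm_sum_kloPhase_le {ε : ℝ} (hε : 0 < ε) :
    ∃ p₀ : ℕ, ∀ (p : ℕ), p.Prime → p₀ ≤ p → ∀ (m₁ : ℕ), ¬ p ∣ m₁ →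
      ∀ k : ℤ, ¬ (p : ℤ) ∣ k → ∀ (A : ℤ) (X : ℕ),
      ‖∑ x ∈ Finset.range X, kloPhase k ((p * m₁ : ℕ) : ℤ) (A + x)‖
        ≤ ε * (X + 2 * (p * m₁ : ℕ)) := by
  obtain ⟨p₀, hp₀⟩ := exists_norm_sum_range_invPhase_le hε
  obtain ⟨p₁, hp₁⟩ := exists_nat_ge (1 / ε)
  refine ⟨max p₀ p₁, fun p hp hpp m₁ hpm k hk A X => ?_⟩
  have : Fact p.Prime := ⟨hp⟩
  have hm₁ : 0 < m₁ := Nat.pos_of_ne_zero fun h => hpm (h ▸ dvd_zero p)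
  have hm₁R : (0 : ℝ) < m₁ := by exact_mod_cast hm₁
  have hpε : 1 ≤ ε * p := by
    have : 1 / ε ≤ (p : ℝ) := hp₁.trans (by exact_mod_cast (le_max_right _ _).trans hpp)
    rw [div_le_iff₀ hε] at this
    linarith
  set q := X / m₁ with hq
  have hX : X = m₁ * q + X % m₁ := (Nat.div_add_mod X m₁).symm
  have hrem : ((X % m₁ : ℕ) : ℝ) ≤ m₁ := by exact_mod_cast (Nat.mod_lt X hm₁).le
  have hXR : (m₁ : ℝ) * q ≤ X := by exact_mod_cast Nat.mul_div_le X m₁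
  have hinner : ∀ r ∈ Finset.range m₁,
      ‖∑ t ∈ Finset.range q, kloPhase k ((p * m₁ : ℕ) : ℤ) (A + ((r + m₁ * t : ℕ) : ℤ))‖
        ≤ ε * (q + p) := by
    intro r _
    by_cases hr : Int.gcd m₁ (A + r) = 1
    · obtain ⟨C, a, c, hC, ha, h⟩ := exists_kloPhase_eq_mul_invPhase hm₁ hpm hk (A + r) hr
      have h1 : ∀ t ∈ Finset.range q,
          kloPhase k ((p * m₁ : ℕ) : ℤ) (A + ((r + m₁ * t : ℕ) : ℤ)) = C * invPhase a (c + t) := by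
        intro t _
        rw [← h t]
        congr 1
        push_cast
        ring
      rw [Finset.sum_congr rfl h1, ← Finset.mul_sum, norm_mul]
      have h2 := hp₀ p ((le_max_left _ _).trans hpp) a ha c q
      calc _ ≤ 1 * (ε * (q + p)) := by gcongr
        _ = _ := one_mul _
    · have h1 : ∀ t ∈ Finset.range q,
          kloPhase k ((p * m₁ : ℕ) : ℤ) (A + ((r + m₁ * t : ℕ) : ℤ)) = 0 := by
        intro t _
        apply kloPhase_of_gcd_ne
        intro hg
        apply hr
        rw [← Int.isCoprime_iff_gcd_eq_one] at hg ⊢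
        push_cast at hg
        have h2 := hg.of_mul_left_right
        rw [← add_assoc] at h2
        exact h2.of_add_mul_left_right
      rw [Finset.sum_congr rfl h1]
      simp
      positivity
  have hmain : ∑ x ∈ Finset.range X, kloPhase k ((p * m₁ : ℕ) : ℤ) (A + x)
      = ∑ r ∈ Finset.range m₁, ∑ t ∈ Finset.range q,
          kloPhase k ((p * m₁ : ℕ) : ℤ) (A + ((r + m₁ * t : ℕ) : ℤ))
        + ∑ x ∈ Finset.range (X % m₁),
          kloPhase k ((p * m₁ : ℕ) : ℤ) (A + ((m₁ * q + x : ℕ) : ℤ)) := by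
    conv_lhs => rw [hX]
    rw [Finset.sum_range_add, sum_range_mul_eq]
  rw [hmain]
  refine (norm_add_le _ _).trans ?_
  have h1 := norm_sum_le_of_le _ hinner
  have h2 : ‖∑ x ∈ Finset.range (X % m₁),
      kloPhase k ((p * m₁ : ℕ) : ℤ) (A + ((m₁ * q + x : ℕ) : ℤ))‖ ≤ (X % m₁ : ℕ) :=
    (norm_sum_le_of_le _ fun _ _ => norm_kloPhase_le _ _ _).trans (by simp)
  simp only [Finset.sum_const, Finset.card_range, nsmul_eq_mul] at h1
  have h3 : (m₁ : ℝ) ≤ ε * p * m₁ := by nlinarith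
  have h4 : ε * (m₁ * q) ≤ ε * X := by gcongr
  rw [show ((p * m₁ : ℕ) : ℝ) = p * m₁ by push_cast; ring]
  nlinarith

end KloostermanFractions

section Turan

lemma exists_finset_primes_sum_inv_ge (P₀ : ℕ) (W : ℝ) :
    ∃ s : Finset ℕ, (∀ p ∈ s, p.Prime ∧ P₀ ≤ p) ∧ W ≤ ∑ p ∈ s, (1 : ℝ) / p := by
  by_contra! h
  refine not_summable_one_div_on_primes ?_
  rw [← summable_nat_add_iff P₀]
  refine summable_of_sum_le (c := W) (fun n => Set.indicator_nonneg (fun _ _ => by positivity) _)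
    fun u => ?_
  have h1 := h ((u.image fun n => n + P₀).filter Nat.Prime) fun p hp => by
    simp only [Finset.mem_filter, Finset.mem_image] at hp
    obtain ⟨⟨n, -, rfl⟩, hp⟩ := hp
    exact ⟨hp, by omega⟩
  rw [Finset.sum_filter, Finset.sum_image fun a _ b _ h => by simpa using h] at h1
  refine le_trans (le_of_eq (Finset.sum_congr rfl fun n _ => ?_)) h1.le
  simp [Set.indicator_apply]

/-- `1` if the prime `p` divides `n` exactly once, `0` otherwise. -/
def exactDvd (p n : ℕ) : ℝ := if p ∣ n ∧ ¬ p ^ 2 ∣ n then 1 else 0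

lemma sum_dvd_indicator (X d : ℕ) :
    ∑ e ∈ Finset.range X, (if d ∣ e + 1 then (1 : ℝ) else 0) = (X / d : ℕ) := by
  rw [Finset.sum_boole, Nat.card_multiples]

lemma natCast_div_le_mul_one_div (X d : ℕ) : ((X / d : ℕ) : ℝ) ≤ X * (1 / d) := by
  rw [mul_one_div]
  exact Nat.cast_div_le

lemma sum_exactDvd_le (X p : ℕ) :
    ∑ e ∈ Finset.range X, exactDvd p (e + 1) ≤ X * (1 / p) := by
  refine le_trans (Finset.sum_le_sum fun e _ => ?_)
    ((sum_dvd_indicator X p).le.trans (natCast_div_le_mul_one_div X p))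
  unfold exactDvd
  split_ifs <;> first | tauto | norm_num

lemma le_sum_exactDvd (X p : ℕ) (hp : 0 < p) :
    X * (1 / p) - X * (1 / p) * (1 / p) - 1 ≤ ∑ e ∈ Finset.range X, exactDvd p (e + 1) := by
  have h1 : ∑ e ∈ Finset.range X, ((if p ∣ e + 1 then (1 : ℝ) else 0)
      - (if p ^ 2 ∣ e + 1 then (1 : ℝ) else 0)) ≤ ∑ e ∈ Finset.range X, exactDvd p (e + 1) := by
    refine Finset.sum_le_sum fun e _ => ?_
    unfold exactDvd
    split_ifs <;> first | tauto | norm_num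
  rw [Finset.sum_sub_distrib, sum_dvd_indicator, sum_dvd_indicator] at h1
  have h2 := natCast_div_le_mul_one_div X (p ^ 2)
  have h3 : (X : ℝ) * (1 / p) < (X / p : ℕ) + 1 := by
    have hpR : (0 : ℝ) < p := by exact_mod_cast hp
    rw [mul_one_div, div_lt_iff₀ hpR]
    have := Nat.lt_mul_div_succ X hp
    rw [mul_comm] at this
    exact_mod_cast this
  have h4 : (X : ℝ) * (1 / ((p ^ 2 : ℕ) : ℝ)) = X * (1 / p) * (1 / p) := by
    push_cast
    ring
  linarith

lemma sum_exactDvd_mul_le (X : ℕ) {p q : ℕ} (hp : p.Prime) (hq : q.Prime) :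
    ∑ e ∈ Finset.range X, exactDvd p (e + 1) * exactDvd q (e + 1)
      ≤ X * (1 / p) * (1 / q) + if p = q then (X : ℝ) * (1 / p) else 0 := by
  split_ifs with h
  · subst h
    refine le_trans (Finset.sum_le_sum fun e _ => ?_) ((sum_exactDvd_le X p).trans ?_)
    · unfold exactDvd
      split_ifs <;> norm_num
    · have : (0 : ℝ) ≤ X * (1 / p) * (1 / p) := by positivity
      linarith
  · have h1 : ∑ e ∈ Finset.range X, exactDvd p (e + 1) * exactDvd q (e + 1)
        ≤ ∑ e ∈ Finset.range X, (if p * q ∣ e + 1 then (1 : ℝ) else 0) := by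
      refine Finset.sum_le_sum fun e _ => ?_
      by_cases hd : p * q ∣ e + 1
      · rw [if_pos hd]
        unfold exactDvd
        split_ifs <;> norm_num
      · have hpq : ¬ (p ∣ e + 1 ∧ q ∣ e + 1) := fun ⟨a, b⟩ =>
          hd (((Nat.coprime_primes hp hq).2 h).mul_dvd_of_dvd_of_dvd a b)
        unfold exactDvd
        split_ifs <;> first | tauto | norm_num
    rw [sum_dvd_indicator] at h1
    refine h1.trans ((natCast_div_le_mul_one_div _ _).trans (le_of_eq ?_))
    push_cast
    ring

/-- For a suitable finite set of large primes, few integers are divisible exactly once by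
none of them. -/
lemma exists_finset_primes_card_le {ε : ℝ} (hε : 0 < ε) (P₀ : ℕ) :
    ∃ s : Finset ℕ, (∀ p ∈ s, p.Prime ∧ P₀ ≤ p) ∧ ∃ C : ℝ, ∀ X : ℕ,
      (((Finset.range X).filter fun e => ∀ p ∈ s, ¬ (p ∣ e + 1 ∧ ¬ p ^ 2 ∣ e + 1)).card : ℝ)
        ≤ ε * X + C := by
  obtain ⟨P₁, hP₁⟩ := exists_nat_ge (4 / ε)
  obtain ⟨s, hs, hW⟩ := exists_finset_primes_sum_inv_ge (max P₀ P₁) (2 / ε)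
  refine ⟨s, fun p hp => ⟨(hs p hp).1, (le_max_left _ _).trans (hs p hp).2⟩, ?_⟩
  set W := ∑ p ∈ s, (1 : ℝ) / p with hWdef
  have hWpos : 0 < W := lt_of_lt_of_le (by positivity) hW
  refine ⟨2 * s.card / W, fun X => ?_⟩
  set ω : ℕ → ℝ := fun e => ∑ p ∈ s, exactDvd p (e + 1) with hω
  have hsq : ∑ e ∈ Finset.range X, ω e ^ 2 ≤ X * (W ^ 2 + W) := by
    calc ∑ e ∈ Finset.range X, ω e ^ 2
        = ∑ p ∈ s, ∑ q ∈ s, ∑ e ∈ Finset.range X, exactDvd p (e + 1) * exactDvd q (e + 1) := by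
          simp only [hω, sq, Finset.sum_mul_sum]
          rw [Finset.sum_comm]
          exact Finset.sum_congr rfl fun p _ => Finset.sum_comm
      _ ≤ ∑ p ∈ s, ∑ q ∈ s, (X * (1 / p) * (1 / q) + if p = q then (X : ℝ) * (1 / p) else 0) :=
          Finset.sum_le_sum fun p hp => Finset.sum_le_sum fun q hq =>
            sum_exactDvd_mul_le X (hs p hp).1 (hs q hq).1
      _ = X * (W ^ 2 + W) := by
          simp only [Finset.sum_add_distrib, Finset.sum_ite_eq]
          rw [Finset.sum_congr rfl fun p hp => if_pos hp]
          simp only [← Finset.mul_sum, ← Finset.sum_mul, ← hWdef]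
          ring
  have hlin : X * W * (1 - ε / 4) - s.card ≤ ∑ e ∈ Finset.range X, ω e := by
    have h1 : ∑ e ∈ Finset.range X, ω e = ∑ p ∈ s, ∑ e ∈ Finset.range X, exactDvd p (e + 1) := by
      simp only [hω]
      exact Finset.sum_comm
    rw [h1]
    have h2 : X * W * (1 - ε / 4) - s.card = ∑ p ∈ s, (X * (1 / (p : ℝ)) * (1 - ε / 4) - 1) := by
      rw [Finset.sum_sub_distrib, ← Finset.sum_mul, ← Finset.mul_sum]
      simp [hWdef]
    rw [h2]
    refine Finset.sum_le_sum fun p hp => ?_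
    refine le_trans ?_ (le_sum_exactDvd X p (hs p hp).1.pos)
    have hpR : (0 : ℝ) < p := by exact_mod_cast (hs p hp).1.pos
    have h3 : (1 : ℝ) / p ≤ ε / 4 := by
      have : 4 / ε ≤ p := hP₁.trans (by exact_mod_cast (le_max_right _ _).trans (hs p hp).2)
      rw [div_le_iff₀ hε] at this
      rw [div_le_iff₀ hpR]
      linarith
    have h4 : X * (1 / (p : ℝ)) * (1 / p) ≤ X * (1 / (p : ℝ)) * (ε / 4) := by gcongr
    linarith
  have hvar : ∑ e ∈ Finset.range X, (ω e - W) ^ 2 ≤ X * W + X * W ^ 2 * ε / 2 + 2 * W * s.card := by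
    have h1 : ∑ e ∈ Finset.range X, (ω e - W) ^ 2
        = ∑ e ∈ Finset.range X, ω e ^ 2 - 2 * W * ∑ e ∈ Finset.range X, ω e + X * W ^ 2 := by
      simp only [sub_sq, Finset.sum_add_distrib, Finset.sum_sub_distrib, Finset.sum_const,
        Finset.card_range, nsmul_eq_mul, Finset.mul_sum]
      congr 2
      exact Finset.sum_congr rfl fun e _ => by ring
    rw [h1]
    have := mul_le_mul_of_nonneg_left hlin (by positivity : 0 ≤ 2 * W)
    nlinarith
  have hcard : ((Finset.range X).filter fun e => ∀ p ∈ s,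
      ¬ (p ∣ e + 1 ∧ ¬ p ^ 2 ∣ e + 1)).card * W ^ 2 ≤ ∑ e ∈ Finset.range X, (ω e - W) ^ 2 := by
    rw [← nsmul_eq_mul, ← Finset.sum_const, Finset.sum_filter]
    refine Finset.sum_le_sum fun e _ => ?_
    split_ifs with h
    · have : ω e = 0 := Finset.sum_eq_zero fun p hp => if_neg (h p hp)
      rw [this]
      simp
    · positivity
  have hfin := hcard.trans hvar
  have h1 : X * W ≤ X * W ^ 2 * (ε / 2) := by
    have : 1 ≤ W * (ε / 2) := by
      rw [div_le_iff₀ hε] at hW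
      linarith
    have h2 : (X : ℝ) * W * 1 ≤ X * W * (W * (ε / 2)) := by gcongr
    linarith
  rw [← sub_nonneg]
  have h2 : 0 ≤ W ^ 2 * (ε * X + 2 * s.card / W - ((Finset.range X).filter fun e => ∀ p ∈ s,
      ¬ (p ∣ e + 1 ∧ ¬ p ^ 2 ∣ e + 1)).card) := by
    have : W ^ 2 * (2 * s.card / W) = 2 * W * s.card := by field_simp
    nlinarith
  exact nonneg_of_mul_nonneg_right h2 (by positivity)

end Turan

section PhaseCells

lemma exists_sum_norm_sum_kloPhase_le {k : ℤ} (hk : k ≠ 0) (I : ℕ) {ε : ℝ} (hε : 0 < ε) :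
    ∃ C : ℝ, ∀ (X : ℕ) (A : ℤ),
      ∑ m ∈ Finset.range (I * X), ‖∑ y ∈ Finset.range X, kloPhase k m (A + y)‖
        ≤ ε * X ^ 2 + C * X := by
  set J : ℝ := I + 1 with hJ
  have hJpos : 0 < J := by positivity
  obtain ⟨p₀, hp₀⟩ := exists_norm_sum_kloPhase_le
    (ε := ε / (2 * J * (1 + 2 * J))) (by positivity)
  obtain ⟨s, hs, C, hC⟩ := exists_finset_primes_card_le (ε := ε / (2 * J)) (by positivity)
    (max p₀ (k.natAbs + 1))
  refine ⟨C + 1, fun X A => ?_⟩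
  have hY : ((I * X : ℕ) : ℝ) ≤ J * X := by
    rw [hJ]
    push_cast
    nlinarith [(Nat.cast_nonneg X : (0 : ℝ) ≤ X)]
  have htriv : ∀ m : ℤ, ‖∑ y ∈ Finset.range X, kloPhase k m (A + y)‖ ≤ X := fun m =>
    (norm_sum_le_of_le _ fun _ _ => norm_kloPhase_le _ _ _).trans (by simp)
  have hpt : ∀ e ∈ Finset.range (I * X),
      ‖∑ y ∈ Finset.range X, kloPhase k ((e + 1 : ℕ) : ℤ) (A + y)‖
        ≤ ε / (2 * J * (1 + 2 * J)) * (X + 2 * (J * X))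
          + if (∀ p ∈ s, ¬ (p ∣ e + 1 ∧ ¬ p ^ 2 ∣ e + 1)) then (X : ℝ) else 0 := by
    intro e he
    have h0 : 0 ≤ ε / (2 * J * (1 + 2 * J)) * (X + 2 * (J * X)) := by positivity
    split_ifs with hb
    · linarith [htriv ((e + 1 : ℕ) : ℤ)]
    · push Not at hb
      obtain ⟨p, hps, ⟨m₁, hm₁⟩, hp2⟩ := hb
      obtain ⟨hp, hpge⟩ := hs p hps
      have hpm : ¬ p ∣ m₁ := fun ⟨t, ht⟩ => hp2 ⟨t, by rw [hm₁, ht]; ring⟩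
      have hpk : ¬ (p : ℤ) ∣ k := fun h => by
        have h1 := Int.le_of_dvd (Int.natAbs_pos.2 hk |> Int.ofNat_lt.2)
          (Int.dvd_natAbs.2 h)
        have : k.natAbs + 1 ≤ p := (le_max_right _ _).trans hpge
        omega
      have h1 := hp₀ p hp ((le_max_left _ _).trans hpge) m₁ hpm k hpk A X
      rw [← hm₁] at h1
      rw [add_zero]
      refine h1.trans ?_
      have h2 : ((e + 1 : ℕ) : ℝ) ≤ J * X := le_trans
        (by exact_mod_cast Finset.mem_range.1 he) hY
      gcongr
  have hsum := Finset.sum_le_sum hpt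
  rw [Finset.sum_add_distrib, ← Finset.sum_filter, Finset.sum_const, Finset.sum_const,
    Finset.card_range, nsmul_eq_mul, nsmul_eq_mul] at hsum
  have hshift : ∑ m ∈ Finset.range (I * X), ‖∑ y ∈ Finset.range X, kloPhase k m (A + y)‖
      ≤ X + ∑ e ∈ Finset.range (I * X),
        ‖∑ y ∈ Finset.range X, kloPhase k ((e + 1 : ℕ) : ℤ) (A + y)‖ := by
    refine (Finset.sum_le_sum_of_subset_of_nonneg
      (Finset.range_mono (Nat.le_succ (I * X))) fun _ _ _ => norm_nonneg _).trans ?_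
    rw [Finset.sum_range_succ', add_comm]
    gcongr
    exact htriv _
  have hcard := mul_le_mul_of_nonneg_right (hC (I * X)) (Nat.cast_nonneg X : (0 : ℝ) ≤ X)
  have e1 : ((I * X : ℕ) : ℝ) * (ε / (2 * J * (1 + 2 * J)) * (X + 2 * (J * X)))
      ≤ ε / 2 * X ^ 2 := by
    calc _ ≤ (J * X) * (ε / (2 * J * (1 + 2 * J)) * (X + 2 * (J * X))) := by gcongr
      _ = ε / 2 * X ^ 2 := by
        have : (0 : ℝ) < 1 + 2 * J := by positivity
        field_simp
  have e2 : ε / (2 * J) * ((I * X : ℕ) : ℝ) ≤ ε / 2 * X := by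
    calc _ ≤ ε / (2 * J) * (J * X) := by gcongr
      _ = _ := by field_simp
  have e3 := mul_le_mul_of_nonneg_right e2 (Nat.cast_nonneg X : (0 : ℝ) ≤ X)
  nlinarith

lemma sum_range_le_sum_range_mul (g : ℕ → ℝ) (hg : ∀ n, 0 ≤ g n) {I a X : ℕ} (h : a + X ≤ I * X) :
    ∑ x ∈ Finset.range X, g (a + x) ≤ ∑ m ∈ Finset.range (I * X), g m := by
  refine le_trans ?_ (Finset.sum_le_sum_of_subset_of_nonneg (Finset.range_mono h)
    fun _ _ _ => hg _)
  rw [Finset.sum_range_add]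
  have := Finset.sum_nonneg fun (m : ℕ) (_ : m ∈ Finset.range a) => hg m
  linarith

lemma tendsto_div_sq_zero_of_norm_le {F : ℕ → ℂ}
    (h : ∀ ε > (0 : ℝ), ∃ C : ℝ, ∀ X : ℕ, 0 < X → ‖F X‖ ≤ ε * X ^ 2 + C * X) :
    Tendsto (fun X : ℕ => F X / (X : ℂ) ^ 2) atTop (𝓝 0) := by
  rw [Metric.tendsto_atTop]
  intro ε hε
  obtain ⟨C, hC⟩ := h (ε / 2) (by positivity)
  obtain ⟨N, hN⟩ := exists_nat_gt (2 * C / ε)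
  refine ⟨max N 1, fun X hX => ?_⟩
  have hX0 : 0 < X := (le_max_right N 1).trans hX
  have hXR : (0 : ℝ) < X := by exact_mod_cast hX0
  have hXN : 2 * C / ε < X := hN.trans_le (by exact_mod_cast (le_max_left N 1).trans hX)
  rw [div_lt_iff₀ hε] at hXN
  rw [dist_zero_right, norm_div, norm_pow, Complex.norm_natCast, div_lt_iff₀ (by positivity)]
  refine (hC X hX0).trans_lt ?_
  nlinarith

lemma tendsto_cell_kloPhase {k : ℤ} (hk : k ≠ 0) (i j : ℤ) :
    Tendsto (fun X : ℕ => (∑ x ∈ Finset.range X, ∑ y ∈ Finset.range X,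
      kloPhase k (i * X + x) (j * X + y)) / (X : ℂ) ^ 2) atTop (𝓝 0) := by
  refine tendsto_div_sq_zero_of_norm_le fun ε hε => ?_
  rcases i with I | I
  · obtain ⟨C, hC⟩ := exists_sum_norm_sum_kloPhase_le hk (I + 1) hε
    refine ⟨C, fun X _ => le_trans (norm_sum_le _ _) (le_trans ?_ (hC X (j * X)))⟩
    refine le_trans (le_of_eq (Finset.sum_congr rfl fun x _ => ?_))
      (sum_range_le_sum_range_mul (fun m => ‖∑ y ∈ Finset.range X, kloPhase k m (j * X + y)‖)
        (fun _ => norm_nonneg _) (a := I * X) (by ring_nf; rfl))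
    simp
  · obtain ⟨C, hC⟩ := exists_sum_norm_sum_kloPhase_le (neg_ne_zero.2 hk) (I + 2) hε
    refine ⟨C, fun X hX => le_trans (norm_sum_le _ _) (le_trans ?_ (hC X (j * X)))⟩
    rw [← Finset.sum_range_reflect]
    refine le_trans (le_of_eq (Finset.sum_congr rfl fun x hx => ?_))
      (sum_range_le_sum_range_mul (fun m => ‖∑ y ∈ Finset.range X, kloPhase (-k) m (j * X + y)‖)
        (fun _ => norm_nonneg _) (a := I * X + 1) (by nlinarith))
    have hx' := Finset.mem_range.1 hx
    have : Int.negSucc I * (X : ℤ) + ((X - 1 - x : ℕ) : ℤ) = -((I * X + 1 + x : ℕ) : ℤ) := by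
      rw [Int.negSucc_eq]
      have : ((X - 1 - x : ℕ) : ℤ) = X - 1 - x := by omega
      rw [this]
      push_cast
      ring
    rw [this]
    simp only [kloPhase_neg_left]

end PhaseCells

section CoprimeCells

open ArithmeticFunction

lemma kloPhase_zero_left (m n : ℤ) :
    kloPhase 0 m n = ((if Int.gcd m n = 1 then 1 else 0 : ℝ) : ℂ) := by
  unfold kloPhase
  split_ifs <;> simp

/-- The density `∑ μ(d) / d²` of coprime pairs. -/
def coprimeDensity : ℝ := ∑' d : ℕ, (moebius d : ℝ) * (1 / (d : ℝ)) ^ 2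

lemma coprimeDensity_ne_zero : coprimeDensity ≠ 0 := by
  have h := LSeries_zeta_mul_Lseries_moebius (s := 2) (by norm_num)
  have h1 : ((coprimeDensity : ℝ) : ℂ) = LSeries (fun n => (moebius n : ℂ)) 2 := by
    rw [coprimeDensity, Complex.ofReal_tsum, LSeries]
    refine tsum_congr fun d => ?_
    rcases eq_or_ne d 0 with rfl | hd
    · simp
    · rw [LSeries.term_of_ne_zero hd]
      push_cast
      rw [show (2 : ℂ) = ((2 : ℕ) : ℂ) by norm_num, Complex.cpow_natCast]
      ring
  intro h0
  rw [h0] at h1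
  rw [← h1] at h
  simp at h

/-- The number of multiples of `d` among `a, …, a + X - 1`. -/
def numMultiples (d : ℕ) (a : ℤ) (X : ℕ) : ℝ :=
  ∑ x ∈ Finset.range X, if (d : ℤ) ∣ a + x then 1 else 0

lemma abs_numMultiples_sub_le {d : ℕ} (hd : 0 < d) (a : ℤ) (X : ℕ) :
    |numMultiples d a X - X * (1 / d)| ≤ 1 := by
  have hdR : (0 : ℝ) < d := by exact_mod_cast hd
  set v : ℕ := ((-a) % d).toNat with hv
  have hv' : (v : ℤ) = (-a) % d := Int.toNat_of_nonneg (Int.emod_nonneg _ (by omega))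
  have h1 : numMultiples d a X = (Nat.count (· ≡ v [MOD d]) X : ℕ) := by
    rw [numMultiples, Finset.sum_boole, Nat.count_eq_card_filter_range]
    congr 2
    ext x
    simp only [Finset.mem_filter, Finset.mem_range, and_congr_right_iff]
    intro _
    rw [← Int.natCast_modEq_iff, hv', Int.modEq_iff_dvd, Int.dvd_iff_emod_eq_zero,
      Int.dvd_iff_emod_eq_zero, Int.sub_emod, Int.emod_emod, ← Int.sub_emod,
      ← Int.dvd_iff_emod_eq_zero, ← Int.dvd_iff_emod_eq_zero, ← dvd_neg]
    ring_nf
  rw [h1, Nat.count_modEq_card _ hd]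
  have h2 : (X : ℝ) = d * (X / d : ℕ) + (X % d : ℕ) := by exact_mod_cast (Nat.div_add_mod X d).symm
  have h3 : ((X % d : ℕ) : ℝ) * (1 / d) ≤ 1 := by
    rw [mul_one_div, div_le_one hdR]
    exact_mod_cast (Nat.mod_lt X hd).le
  have h4 : (0 : ℝ) ≤ ((X % d : ℕ) : ℝ) * (1 / d) := by positivity
  have h5 : (X : ℝ) * (1 / d) = (X / d : ℕ) + ((X % d : ℕ) : ℝ) * (1 / d) := by
    conv_lhs => rw [h2]
    field_simp
  rw [h5, abs_le]
  push_cast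
  split_ifs <;> constructor <;> linarith

/-- The number of nonzero vectors with both coordinates divisible by `d` in a box. -/
def numBoxMultiples (d : ℕ) (a b : ℤ) (X : ℕ) : ℝ :=
  ∑ x ∈ Finset.range X, ∑ y ∈ Finset.range X,
    if d ∣ Int.gcd (a + x) (b + y) ∧ Int.gcd (a + x) (b + y) ≠ 0 then 1 else 0

lemma numBoxMultiples_le (d : ℕ) (a b : ℤ) (X : ℕ) :
    numBoxMultiples d a b X ≤ numMultiples d a X * numMultiples d b X := by
  rw [numMultiples, numMultiples, Finset.sum_mul_sum]
  refine Finset.sum_le_sum fun x _ => Finset.sum_le_sum fun y _ => ?_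
  by_cases h : d ∣ Int.gcd (a + x) (b + y) ∧ Int.gcd (a + x) (b + y) ≠ 0
  · have h1 : (d : ℤ) ∣ a + x := (Int.natCast_dvd_natCast.2 h.1).trans (Int.gcd_dvd_left ..)
    have h2 : (d : ℤ) ∣ b + y := (Int.natCast_dvd_natCast.2 h.1).trans (Int.gcd_dvd_right ..)
    simp [h, h1, h2]
  · rw [if_neg h]
    split_ifs <;> norm_num

lemma sum_range_eq_zero_indicator_le (a : ℤ) (X : ℕ) :
    ∑ x ∈ Finset.range X, (if a + x = 0 then (1 : ℝ) else 0) ≤ 1 := by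
  rw [Finset.sum_boole]
  have : ((Finset.range X).filter fun x : ℕ => a + x = 0).card ≤ 1 :=
    Finset.card_le_one.2 fun x hx y hy => by
      have h1 := (Finset.mem_filter.1 hx).2
      have h2 := (Finset.mem_filter.1 hy).2
      omega
  exact_mod_cast this

lemma le_numBoxMultiples (d : ℕ) (a b : ℤ) (X : ℕ) :
    numMultiples d a X * numMultiples d b X - 1 ≤ numBoxMultiples d a b X := by
  have h0 : ∀ c : ℤ, 0 ≤ ∑ x ∈ Finset.range X, (if c + x = 0 then (1 : ℝ) else 0) := fun c =>
    Finset.sum_nonneg fun _ _ => by split_ifs <;> norm_num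
  have h1 : numMultiples d a X * numMultiples d b X
      - (∑ x ∈ Finset.range X, (if a + x = 0 then (1 : ℝ) else 0))
        * (∑ y ∈ Finset.range X, (if b + y = 0 then (1 : ℝ) else 0))
      ≤ numBoxMultiples d a b X := by
    rw [numMultiples, numMultiples, Finset.sum_mul_sum, Finset.sum_mul_sum,
      ← Finset.sum_sub_distrib]
    refine Finset.sum_le_sum fun x _ => ?_
    rw [← Finset.sum_sub_distrib]
    refine Finset.sum_le_sum fun y _ => ?_
    by_cases h : (d : ℤ) ∣ a + x ∧ (d : ℤ) ∣ b + y
    · have h1 : d ∣ Int.gcd (a + x) (b + y) := Int.dvd_gcd h.1 h.2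
      by_cases h2 : a + x = 0 ∧ b + y = 0
      · simp [h2.1, h2.2]
      · rw [if_pos h.1, if_pos h.2, if_pos (show d ∣ Int.gcd (a + x) (b + y) ∧ _ ≠ 0 from
          ⟨h1, fun h3 => h2 (Int.gcd_eq_zero_iff.1 h3)⟩)]
        split_ifs <;> norm_num
    · have : ((if (d : ℤ) ∣ a + x then 1 else 0) * if (d : ℤ) ∣ b + y then 1 else 0 : ℝ) = 0 := by
        split_ifs <;> first | tauto | norm_num
      rw [this]
      split_ifs <;> norm_num
  nlinarith [sum_range_eq_zero_indicator_le a X, sum_range_eq_zero_indicator_le b X, h0 a, h0 b]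

lemma numBoxMultiples_nonneg (d : ℕ) (a b : ℤ) (X : ℕ) : 0 ≤ numBoxMultiples d a b X :=
  Finset.sum_nonneg fun _ _ => Finset.sum_nonneg fun _ _ => by split_ifs <;> norm_num

lemma numMultiples_nonneg (d : ℕ) (a : ℤ) (X : ℕ) : 0 ≤ numMultiples d a X :=
  Finset.sum_nonneg fun _ _ => by split_ifs <;> norm_num

lemma numBoxMultiples_eq_zero {d : ℕ} {a b : ℤ} {X : ℕ}
    (ha : ∀ x : ℕ, x < X → (a + x).natAbs < d) (hb : ∀ x : ℕ, x < X → (b + x).natAbs < d) :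
    numBoxMultiples d a b X = 0 := by
  refine Finset.sum_eq_zero fun x hx => Finset.sum_eq_zero fun y hy => if_neg fun h => h.2 ?_
  have h1 : (d : ℤ) ∣ a + x := (Int.natCast_dvd_natCast.2 h.1).trans (Int.gcd_dvd_left ..)
  have h2 : (d : ℤ) ∣ b + y := (Int.natCast_dvd_natCast.2 h.1).trans (Int.gcd_dvd_right ..)
  rw [Int.gcd_eq_zero_iff]
  exact ⟨Int.eq_zero_of_dvd_of_natAbs_lt_natAbs h1 (by simpa using ha x (Finset.mem_range.1 hx)),
    Int.eq_zero_of_dvd_of_natAbs_lt_natAbs h2 (by simpa using hb y (Finset.mem_range.1 hy))⟩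

lemma hasSum_moebius_dvd (g : ℕ) :
    HasSum (fun d : ℕ => (moebius d : ℝ) * (if d ∣ g ∧ g ≠ 0 then 1 else 0))
      (if g = 1 then 1 else 0) := by
  have h : ∑ d ∈ g.divisors, (moebius d : ℝ) * (if d ∣ g ∧ g ≠ 0 then 1 else 0)
      = if g = 1 then 1 else 0 := by
    rw [Finset.sum_congr rfl fun d hd => by rw [if_pos (Nat.mem_divisors.1 hd), mul_one]]
    have h1 := congrArg (fun f : ArithmeticFunction ℤ => f g) moebius_mul_coe_zeta
    simp only [coe_mul_zeta_apply, ArithmeticFunction.one_apply] at h1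
    exact_mod_cast h1
  rw [← h]
  refine hasSum_sum_of_ne_finset_zero fun d hd => ?_
  rw [Nat.mem_divisors] at hd
  rw [if_neg hd, mul_zero]

lemma hasSum_numBoxMultiples (a b : ℤ) (X : ℕ) :
    HasSum (fun d : ℕ => (moebius d : ℝ) * numBoxMultiples d a b X)
      (∑ x ∈ Finset.range X, ∑ y ∈ Finset.range X,
        if Int.gcd (a + x) (b + y) = 1 then (1 : ℝ) else 0) := by
  have := hasSum_sum (s := Finset.range X) fun (x : ℕ) _ =>
    hasSum_sum (s := Finset.range X) fun (y : ℕ) _ => hasSum_moebius_dvd (Int.gcd (a + x) (b + y))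
  simpa only [numBoxMultiples, Finset.mul_sum] using this

lemma tendsto_numMultiples {d : ℕ} (hd : 0 < d) (i : ℤ) :
    Tendsto (fun X : ℕ => numMultiples d (i * X) X / X) atTop (𝓝 (1 / d)) := by
  have h : Tendsto (fun X : ℕ => (1 : ℝ) / X) atTop (𝓝 0) := tendsto_one_div_atTop_nhds_zero_nat
  rw [tendsto_iff_norm_sub_tendsto_zero]
  refine squeeze_zero' (Eventually.of_forall fun _ => norm_nonneg _) ?_ h
  filter_upwards [eventually_gt_atTop 0] with X hX
  have hXR : (0 : ℝ) < X := by exact_mod_cast hX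
  have h1 := abs_numMultiples_sub_le hd (i * X) X
  rw [Real.norm_eq_abs, show numMultiples d (i * X) X / X - 1 / d
    = (numMultiples d (i * X) X - X * (1 / d)) / X by field_simp, abs_div, abs_of_pos hXR]
  gcongr

lemma tendsto_cell_coprime (i j : ℤ) :
    Tendsto (fun X : ℕ => (∑ x ∈ Finset.range X, ∑ y ∈ Finset.range X,
      if Int.gcd (i * X + x) (j * X + y) = 1 then (1 : ℝ) else 0) / (X : ℝ) ^ 2) atTop
      (𝓝 coprimeDensity) := by
  set C : ℝ := i.natAbs + j.natAbs + 1 with hC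
  have hCpos : 0 < C := by positivity
  have hsum : ∀ X : ℕ, (∑ x ∈ Finset.range X, ∑ y ∈ Finset.range X,
      if Int.gcd (i * X + x) (j * X + y) = 1 then (1 : ℝ) else 0) / (X : ℝ) ^ 2
      = ∑' d : ℕ, (moebius d : ℝ) * (numBoxMultiples d (i * X) (j * X) X / (X : ℝ) ^ 2) := by
    intro X
    have := ((hasSum_numBoxMultiples (i * X) (j * X) X).div_const ((X : ℝ) ^ 2)).tsum_eq
    rw [← this]
    exact tsum_congr fun d => mul_div_assoc _ _ _
  simp only [hsum]
  have hmu : ∀ d : ℕ, |(moebius d : ℝ)| ≤ 1 := fun d => by exact_mod_cast abs_moebius_le_one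
  refine tendsto_tsum_of_dominated_convergence
    (bound := fun d : ℕ => (1 + C) ^ 2 * (1 / (d : ℝ) ^ 2)) ?_ ?_ ?_
  · exact (Real.summable_one_div_nat_pow.2 one_lt_two).mul_left _
  · intro d
    rcases Nat.eq_zero_or_pos d with rfl | hd
    · simp
    refine Tendsto.const_mul _ ?_
    have h1 := (tendsto_numMultiples hd i).mul (tendsto_numMultiples hd j)
    have h0 : Tendsto (fun X : ℕ => (1 : ℝ) / X * (1 / X)) atTop (𝓝 (0 * 0)) :=
      tendsto_one_div_atTop_nhds_zero_nat.mul tendsto_one_div_atTop_nhds_zero_nat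
    have h2 := h1.sub h0
    rw [mul_zero, sub_zero, ← sq] at h2
    rw [← sq] at h1
    refine tendsto_of_tendsto_of_tendsto_of_le_of_le h2 h1 (fun X => ?_) fun X => ?_
    · have := div_le_div_of_nonneg_right (le_numBoxMultiples d (i * X) (j * X) X)
        (sq_nonneg (X : ℝ))
      refine le_trans (le_of_eq ?_) this
      ring
    · have := div_le_div_of_nonneg_right (numBoxMultiples_le d (i * X) (j * X) X)
        (sq_nonneg (X : ℝ))
      refine le_trans this (le_of_eq ?_)
      ring
  · filter_upwards [eventually_gt_atTop 0] with X hX d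
    have hXR : (0 : ℝ) < X := by exact_mod_cast hX
    rcases Nat.eq_zero_or_pos d with rfl | hd
    · simp
    have hdR : (0 : ℝ) < d := by exact_mod_cast hd
    rw [norm_mul, Real.norm_eq_abs, Real.norm_eq_abs,
      abs_of_nonneg (div_nonneg (numBoxMultiples_nonneg ..) (sq_nonneg _))]
    refine (mul_le_of_le_one_left (div_nonneg (numBoxMultiples_nonneg ..) (sq_nonneg _))
      (hmu d)).trans ?_
    by_cases hlarge : C * X < d
    · have hcoord : ∀ c : ℤ, (c.natAbs : ℝ) + 1 ≤ C → ∀ x : ℕ, x < X → (c * X + x).natAbs < d := by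
        intro c hc x hx
        have h1 : ((c * X + x).natAbs : ℝ) ≤ (c.natAbs + 1) * X := by
          have h2 : (c * X + x).natAbs ≤ c.natAbs * X + x := by
            refine (Int.natAbs_add_le _ _).trans ?_
            rw [Int.natAbs_mul]
            simp
          have h3 : (x : ℝ) ≤ X := by exact_mod_cast hx.le
          have h4 : ((c * X + x).natAbs : ℝ) ≤ c.natAbs * X + x := by exact_mod_cast h2
          linarith
        have h5 : ((c.natAbs : ℝ) + 1) * X ≤ C * X := by gcongr
        exact_mod_cast (h1.trans h5).trans_lt hlarge
      rw [numBoxMultiples_eq_zero (hcoord i (by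
        rw [hC]; linarith [(Nat.cast_nonneg j.natAbs : (0 : ℝ) ≤ _)]))
        (hcoord j (by rw [hC]; linarith [(Nat.cast_nonneg i.natAbs : (0 : ℝ) ≤ _)])), zero_div]
      positivity
    · rw [not_lt] at hlarge
      have hb : ∀ c : ℤ, numMultiples d c X ≤ (1 + C) * (X / d) := by
        intro c
        have h1 := (abs_le.1 (abs_numMultiples_sub_le hd c X)).2
        have h2 : 1 ≤ C * (X / d) := by
          rw [← mul_div_assoc, le_div_iff₀ hdR]
          linarith
        have h3 : (X : ℝ) * (1 / d) = X / d := by ring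
        linarith
      rw [div_le_iff₀ (by positivity)]
      refine (numBoxMultiples_le ..).trans ((mul_le_mul (hb _) (hb _)
        (numMultiples_nonneg ..) (by positivity)).trans (le_of_eq ?_))
      ring

lemma coprimeDensity_pos : 0 < coprimeDensity :=
  lt_of_le_of_ne (ge_of_tendsto' (tendsto_cell_coprime 0 0) fun X => by positivity)
    coprimeDensity_ne_zero.symm

end CoprimeCells

/-- `c₀ = ∑ μ(d) / d²` for `k = 0`, and `0` for other `k`. -/
def phaseDensity (k : ℤ) : ℝ := if k = 0 then coprimeDensity else 0

lemma tendsto_cell_phase (k i j : ℤ) :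
    Tendsto (fun X : ℕ => (∑ x ∈ Finset.range X, ∑ y ∈ Finset.range X,
      kloPhase k (i * X + x) (j * X + y)) / (X : ℂ) ^ 2) atTop (𝓝 (phaseDensity k : ℂ)) := by
  rcases eq_or_ne k 0 with rfl | hk
  · have := (Complex.continuous_ofReal.tendsto _).comp (tendsto_cell_coprime i j)
    rw [phaseDensity, if_pos rfl]
    refine this.congr fun X => ?_
    simp only [Function.comp_apply, kloPhase_zero_left]
    push_cast
    rfl
  · rw [phaseDensity, if_neg hk, Complex.ofReal_zero]
    exact tendsto_cell_kloPhase hk i j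

section RiemannSums

lemma integral_comp_unimodular {E : Type*} [NormedAddCommGroup E] [NormedSpace ℝ E]
    (g : ℝ × ℝ → E) {a b c d : ℝ} (h : a * d - b * c = 1) :
    ∫ p : ℝ × ℝ, g (a * p.1 + b * p.2, c * p.1 + d * p.2) = ∫ p, g p := by
  have hdet : (!![a, b; c, d] : Matrix (Fin 2) (Fin 2) ℝ).det = 1 := by
    rw [Matrix.det_fin_two_of, h]
  have e := volume_preserving_finTwoArrow ℝ
  have hm : MeasurePreserving (Matrix.toLin' (!![a, b; c, d] : Matrix (Fin 2) (Fin 2) ℝ))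
      volume volume := by
    refine ⟨(LinearMap.continuous_on_pi _).measurable, ?_⟩
    rw [Real.map_matrix_volume_pi_eq_smul_volume_pi (by rw [hdet]; exact one_ne_zero), hdet]
    simp
  have hemb : MeasurableEmbedding
      (Matrix.toLin' (!![a, b; c, d] : Matrix (Fin 2) (Fin 2) ℝ)) := by
    have hunit : IsUnit (!![a, b; c, d] : Matrix (Fin 2) (Fin 2) ℝ).det := by
      rw [hdet]; exact isUnit_one
    exact (LinearEquiv.toContinuousLinearEquiv
      (Matrix.toLinearEquiv' _
        (Matrix.invertibleOfIsUnitDet _ hunit))).toHomeomorph.measurableEmbedding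
  rw [← e.integral_comp (MeasurableEquiv.measurableEmbedding _),
    ← e.integral_comp (MeasurableEquiv.measurableEmbedding _) g,
    ← hm.integral_comp hemb fun x => g (MeasurableEquiv.finTwoArrow x)]
  refine integral_congr_ae (Eventually.of_forall fun x => ?_)
  simp [MeasurableEquiv.finTwoArrow, Matrix.toLin'_apply, dotProduct,
    Fin.sum_univ_two]

lemma sum_Ico_int_mul {E : Type*} [AddCommMonoid E] (f : ℤ → E) (N : ℤ) {X : ℕ} (hX : 0 < X) :
    ∑ m ∈ Finset.Ico (-N * X) (N * X), f m
      = ∑ i ∈ Finset.Ico (-N) N, ∑ x ∈ Finset.range X, f (i * X + x) := by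
  have hXZ : (0 : ℤ) < X := by exact_mod_cast hX
  rw [← Finset.sum_product']
  symm
  refine Finset.sum_nbij' (fun q : ℤ × ℕ => q.1 * X + q.2) (fun m => (m / X, (m % X).toNat))
    ?_ ?_ ?_ ?_ ?_
  · rintro ⟨i, x⟩ h
    simp only [Finset.mem_product, Finset.mem_Ico, Finset.mem_range] at h ⊢
    have : (x : ℤ) < X := by exact_mod_cast h.2
    constructor <;> nlinarith
  · intro m h
    simp only [Finset.mem_product, Finset.mem_Ico, Finset.mem_range] at h ⊢
    refine ⟨⟨(Int.le_ediv_iff_mul_le hXZ).2 h.1, Int.ediv_lt_of_lt_mul hXZ h.2⟩, ?_⟩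
    have h1 := Int.emod_nonneg m hXZ.ne'
    have h2 := Int.emod_lt_of_pos m hXZ
    omega
  · rintro ⟨i, x⟩ h
    simp only [Finset.mem_product, Finset.mem_Ico, Finset.mem_range] at h
    have hx : (x : ℤ) < X := by exact_mod_cast h.2
    have hx0 : (0 : ℤ) ≤ x := by positivity
    simp only [Prod.mk.injEq]
    constructor
    · rw [add_comm, Int.add_mul_ediv_right _ _ hXZ.ne', Int.ediv_eq_zero_of_lt hx0 hx, zero_add]
    · rw [add_comm, Int.add_mul_emod_self_right, Int.emod_eq_of_lt hx0 hx]
      simp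
  · intro m _
    have h1 := Int.emod_nonneg m hXZ.ne'
    have h2 := Int.mul_ediv_add_emod m X
    simp only
    rw [Int.toNat_of_nonneg h1]
    linarith
  · intro q _
    rfl

lemma card_Ico_neg_natCast (N : ℕ) : (Finset.Ico (-(N : ℤ)) N).card = 2 * N := by
  rw [Int.card_Ico]
  omega

/-- The half-open square with corner `(i / K, j / K)` and side `1 / K`. -/
def gridCell (K : ℕ) (i j : ℤ) : Set (ℝ × ℝ) := {p | ⌊K * p.1⌋ = i ∧ ⌊K * p.2⌋ = j}

lemma gridCell_eq {K : ℕ} (hK : 0 < K) (i j : ℤ) :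
    gridCell K i j
      = Set.Ico ((i : ℝ) / K) ((i + 1 : ℝ) / K) ×ˢ Set.Ico ((j : ℝ) / K) ((j + 1 : ℝ) / K) := by
  have hKR : (0 : ℝ) < K := by exact_mod_cast hK
  ext p
  simp only [gridCell, Set.mem_ofPred_eq, Int.floor_eq_iff, Set.mem_prod, Set.mem_Ico,
    div_le_iff₀ hKR, lt_div_iff₀ hKR, mul_comm]

lemma volume_gridCell {K : ℕ} (hK : 0 < K) (i j : ℤ) :
    volume.real (gridCell K i j) = 1 / (K : ℝ) ^ 2 := by
  have hKR : (0 : ℝ) < K := by exact_mod_cast hK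
  have h : ∀ i : ℝ, (i + 1) / K - i / K = 1 / K := fun i => by ring
  rw [gridCell_eq hK, measureReal_def, Measure.volume_eq_prod, Measure.prod_prod, Real.volume_Ico,
    Real.volume_Ico, h, h, ENNReal.toReal_mul, ENNReal.toReal_ofReal (by positivity)]
  ring

lemma measurableSet_gridCell (K : ℕ) (i j : ℤ) : MeasurableSet (gridCell K i j) := by
  have h : ∀ f : ℝ × ℝ → ℝ, Measurable f → ∀ i : ℤ, MeasurableSet {p | ⌊(K : ℝ) * f p⌋ = i} :=
    fun f hf i => (Int.measurable_floor.comp (hf.const_mul _)) (measurableSet_singleton i)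
  exact (h _ measurable_fst i).inter (h _ measurable_snd j)

lemma norm_integral_sub_sum_gridCell_le {G : ℝ × ℝ → ℂ} (hG : Integrable G) {K L : ℕ} (hK : 0 < K)
    {ε : ℝ} (hsupp : ∀ p, G p ≠ 0 → (-(L : ℝ) ≤ p.1 ∧ p.1 < L) ∧ (-(L : ℝ) ≤ p.2 ∧ p.2 < L))
    (hosc : ∀ p q : ℝ × ℝ, |p.1 - q.1| ≤ 1 / K → |p.2 - q.2| ≤ 1 / K → ‖G p - G q‖ ≤ ε) :
    ‖(∫ p, G p) - ∑ i ∈ Finset.Ico (-(L * K : ℤ)) (L * K), ∑ j ∈ Finset.Ico (-(L * K : ℤ)) (L * K),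
      G ((i : ℝ) / K, (j : ℝ) / K) / (K : ℂ) ^ 2‖ ≤ 4 * L ^ 2 * ε := by
  have hKR : (0 : ℝ) < K := by exact_mod_cast hK
  set s := Finset.Ico (-(L * K : ℤ)) (L * K) with hs
  have hcard : (s.card : ℝ) = 2 * (L * K) := by
    have h := card_Ico_neg_natCast (L * K)
    push_cast at h
    rw [hs, h]
    push_cast
    ring
  have hI : ∫ p, G p = ∑ q ∈ s ×ˢ s, ∫ p in gridCell K q.1 q.2, G p := by
    rw [← integral_biUnion_finset _ (fun q _ => measurableSet_gridCell K q.1 q.2) ?_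
      fun q _ => hG.integrableOn]
    · symm
      refine setIntegral_eq_integral_of_forall_compl_eq_zero fun p hp => ?_
      by_contra hne
      refine hp ?_
      obtain ⟨h1, h2⟩ := hsupp p hne
      have hfl : ∀ x : ℝ, -(L : ℝ) ≤ x → x < L → ⌊K * x⌋ ∈ s := by
        intro x hx1 hx2
        rw [hs, Finset.mem_Ico, Int.le_floor, Int.floor_lt]
        push_cast
        constructor <;> nlinarith
      exact Set.mem_biUnion (x := (⌊K * p.1⌋, ⌊K * p.2⌋))
        (by simpa using ⟨hfl _ h1.1 h1.2, hfl _ h2.1 h2.2⟩) ⟨rfl, rfl⟩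
    · intro q _ q' _ hne
      refine Set.disjoint_left.2 fun p hp hp' => hne ?_
      exact Prod.ext (hp.1.symm.trans hp'.1) (hp.2.symm.trans hp'.2)
  have hcell : ∀ q ∈ s ×ˢ s, ‖(∫ p in gridCell K q.1 q.2, G p)
      - G ((q.1 : ℝ) / K, (q.2 : ℝ) / K) / (K : ℂ) ^ 2‖ ≤ ε * (1 / (K : ℝ) ^ 2) := by
    intro q _
    have hfin : volume (gridCell K q.1 q.2) < ⊤ := by
      rw [gridCell_eq hK, Measure.volume_eq_prod, Measure.prod_prod, Real.volume_Ico,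
        Real.volume_Ico]
      exact ENNReal.mul_lt_top ENNReal.ofReal_lt_top ENNReal.ofReal_lt_top
    have h1 : G ((q.1 : ℝ) / K, (q.2 : ℝ) / K) / (K : ℂ) ^ 2
        = ∫ p in gridCell K q.1 q.2, G ((q.1 : ℝ) / K, (q.2 : ℝ) / K) := by
      rw [setIntegral_const, volume_gridCell hK, Complex.real_smul]
      push_cast
      ring
    rw [h1, ← integral_sub hG.integrableOn (integrableOn_const hfin.ne),
      ← volume_gridCell hK q.1 q.2]
    refine norm_setIntegral_le_of_norm_le_const hfin fun p hp => hosc _ _ ?_ ?_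
    · rw [gridCell_eq hK] at hp
      have h3 := hp.1
      have h4 : ((q.1 : ℝ) + 1) / K = q.1 / K + 1 / K := by ring
      rw [Set.mem_Ico, h4] at h3
      simp only [abs_le]
      constructor <;> linarith [one_div_pos.2 hKR]
    · rw [gridCell_eq hK] at hp
      have h3 := hp.2
      have h4 : ((q.2 : ℝ) + 1) / K = q.2 / K + 1 / K := by ring
      rw [Set.mem_Ico, h4] at h3
      simp only [abs_le]
      constructor <;> linarith [one_div_pos.2 hKR]
  rw [hI, ← Finset.sum_product' (f := fun i j : ℤ => G ((i : ℝ) / K, (j : ℝ) / K) / (K : ℂ) ^ 2),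
    ← Finset.sum_sub_distrib]
  refine (norm_sum_le_of_le _ hcell).trans (le_of_eq ?_)
  rw [Finset.sum_const, Finset.card_product, nsmul_eq_mul]
  push_cast
  rw [hcard]
  field_simp
  ring

lemma norm_tsum_sub_mul_integral_le {ω : ℤ → ℤ → ℂ} (hω : ∀ m n, ‖ω m n‖ ≤ 1) {c : ℂ}
    {G : ℝ × ℝ → ℂ} (hG : Integrable G) {K L X : ℕ} (hK : 0 < K) (hX : 0 < X)
    {ε ε' B : ℝ}
    (hsupp : ∀ p, G p ≠ 0 → (-(L : ℝ) ≤ p.1 ∧ p.1 < L) ∧ (-(L : ℝ) ≤ p.2 ∧ p.2 < L))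
    (hosc : ∀ p q : ℝ × ℝ, |p.1 - q.1| ≤ 1 / K → |p.2 - q.2| ≤ 1 / K → ‖G p - G q‖ ≤ ε)
    (hB : ∀ p, ‖G p‖ ≤ B)
    (hcell : ∀ i ∈ Finset.Ico (-(L * K : ℤ)) (L * K), ∀ j ∈ Finset.Ico (-(L * K : ℤ)) (L * K),
      ‖(∑ x ∈ Finset.range X, ∑ y ∈ Finset.range X, ω (i * X + x) (j * X + y)) / (X : ℂ) ^ 2 - c‖
        ≤ ε') :
    ‖(∑' p : ℤ × ℤ, ω p.1 p.2 * G ((p.1 : ℝ) / (K * X : ℕ), (p.2 : ℝ) / (K * X : ℕ)))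
        / ((K * X : ℕ) : ℂ) ^ 2 - c * ∫ p, G p‖
      ≤ 4 * L ^ 2 * (ε + B * ε' + ‖c‖ * ε) := by
  have hKR : (0 : ℝ) < K := by exact_mod_cast hK
  have hXR : (0 : ℝ) < X := by exact_mod_cast hX
  have hKC : (K : ℂ) ≠ 0 := by exact_mod_cast hK.ne'
  have hXC : (X : ℂ) ≠ 0 := by exact_mod_cast hX.ne'
  set s := Finset.Ico (-(L * K : ℤ)) (L * K) with hs
  have hcard : (s.card : ℝ) = 2 * (L * K) := by
    have h := card_Ico_neg_natCast (L * K)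
    push_cast at h
    rw [hs, h]
    push_cast
    ring
  set P : ℤ → ℤ → ℝ × ℝ := fun m n => ((m : ℝ) / (K * X : ℕ), (n : ℝ) / (K * X : ℕ)) with hP
  have htsum : ∑' p : ℤ × ℤ, ω p.1 p.2 * G (P p.1 p.2)
      = ∑ i ∈ s, ∑ j ∈ s, ∑ x ∈ Finset.range X, ∑ y ∈ Finset.range X,
        ω (i * X + x) (j * X + y) * G (P (i * X + x) (j * X + y)) := by
    rw [tsum_eq_sum (s := Finset.Ico (-(L * K : ℤ) * X) ((L * K) * X)
      ×ˢ Finset.Ico (-(L * K : ℤ) * X) ((L * K) * X)) ?_]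
    · rw [Finset.sum_product, sum_Ico_int_mul _ _ hX]
      refine Finset.sum_congr rfl fun i _ => ?_
      rw [Finset.sum_comm, sum_Ico_int_mul _ _ hX]
      exact Finset.sum_congr rfl fun j _ => Finset.sum_comm
    · rintro ⟨m, n⟩ hmn
      by_contra hne
      obtain ⟨h1, h2⟩ := hsupp _ (right_ne_zero_of_mul hne)
      have hmem : ∀ m : ℤ, -(L : ℝ) ≤ (m : ℝ) / (K * X : ℕ) → (m : ℝ) / (K * X : ℕ) < L →
          m ∈ Finset.Ico (-(L * K : ℤ) * X) ((L * K) * X) := by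
        intro m h1 h2
        have hpos : (0 : ℝ) < (K * X : ℕ) := by exact_mod_cast Nat.mul_pos hK hX
        rw [le_div_iff₀ hpos] at h1
        rw [div_lt_iff₀ hpos] at h2
        rw [Finset.mem_Ico]
        constructor
        · have : ((-(L * K : ℤ) * X : ℤ) : ℝ) ≤ m := by push_cast at h1 ⊢; linarith
          exact_mod_cast this
        · have : (m : ℝ) < (((L * K) * X : ℤ) : ℝ) := by push_cast at h2 ⊢; linarith
          exact_mod_cast this
      exact hmn (Finset.mem_product.2 ⟨hmem m h1.1 h1.2, hmem n h2.1 h2.2⟩)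
  have hcellsum : ∀ i ∈ s, ∀ j ∈ s,
      ‖(∑ x ∈ Finset.range X, ∑ y ∈ Finset.range X,
        ω (i * X + x) (j * X + y) * G (P (i * X + x) (j * X + y))) / ((K * X : ℕ) : ℂ) ^ 2
        - c * (G ((i : ℝ) / K, (j : ℝ) / K) / (K : ℂ) ^ 2)‖ ≤ (ε + B * ε') * (1 / (K : ℝ) ^ 2) := by
    intro i hi j hj
    set G₀ := G ((i : ℝ) / K, (j : ℝ) / K) with hG₀
    set S := ∑ x ∈ Finset.range X, ∑ y ∈ Finset.range X, ω (i * X + x) (j * X + y) with hS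
    have hdecomp : (∑ x ∈ Finset.range X, ∑ y ∈ Finset.range X,
        ω (i * X + x) (j * X + y) * G (P (i * X + x) (j * X + y))) / ((K * X : ℕ) : ℂ) ^ 2
        - c * (G₀ / (K : ℂ) ^ 2)
        = ((∑ x ∈ Finset.range X, ∑ y ∈ Finset.range X,
          ω (i * X + x) (j * X + y) * (G (P (i * X + x) (j * X + y)) - G₀)) / (X : ℂ) ^ 2
          + G₀ * (S / (X : ℂ) ^ 2 - c)) * (1 / (K : ℂ) ^ 2) := by
      have : ∑ x ∈ Finset.range X, ∑ y ∈ Finset.range X,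
          ω (i * X + x) (j * X + y) * (G (P (i * X + x) (j * X + y)) - G₀)
          = ∑ x ∈ Finset.range X, ∑ y ∈ Finset.range X,
          ω (i * X + x) (j * X + y) * G (P (i * X + x) (j * X + y)) - S * G₀ := by
        simp only [mul_sub, Finset.sum_sub_distrib, hS, Finset.sum_mul]
      rw [this]
      push_cast
      field_simp
      ring
    have hoscsum : ‖(∑ x ∈ Finset.range X, ∑ y ∈ Finset.range X,
          ω (i * X + x) (j * X + y) * (G (P (i * X + x) (j * X + y)) - G₀)) / (X : ℂ) ^ 2‖ ≤ ε := by
      rw [norm_div, norm_pow, Complex.norm_natCast, div_le_iff₀ (by positivity)]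
      refine (norm_sum_le_of_le (n := fun _ => X * ε) _ fun x hx => ?_).trans
        (by rw [Finset.sum_const, Finset.card_range, nsmul_eq_mul]; exact le_of_eq (by ring))
      refine (norm_sum_le_of_le (n := fun _ => ε) _ fun y hy => ?_).trans
        (by rw [Finset.sum_const, Finset.card_range, nsmul_eq_mul])
      rw [norm_mul]
      have hclose : ∀ (i : ℤ) (x : ℕ), x ∈ Finset.range X →
          |(((i * X + x : ℤ) : ℝ) / (K * X : ℕ)) - (i : ℝ) / K| ≤ 1 / K := by
        intro i x hx
        have hxX : (x : ℝ) ≤ X := by exact_mod_cast (Finset.mem_range.1 hx).le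
        have : (((i * X + x : ℤ) : ℝ) / (K * X : ℕ)) - (i : ℝ) / K = (x / X : ℝ) / K := by
          push_cast
          field_simp
          ring
        rw [this, abs_of_nonneg (by positivity)]
        gcongr
        exact (div_le_one hXR).2 hxX
      have h1 := hosc (P (i * X + x) (j * X + y)) ((i : ℝ) / K, (j : ℝ) / K)
        (hclose i x hx) (hclose j y hy)
      exact (mul_le_of_le_one_left (norm_nonneg _) (hω _ _)).trans h1
    have hmean : ‖G₀ * (S / (X : ℂ) ^ 2 - c)‖ ≤ B * ε' := by
      rw [norm_mul]
      exact mul_le_mul (hB _) (hcell i hi j hj) (norm_nonneg _) ((norm_nonneg _).trans (hB 0))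
    rw [hdecomp, norm_mul]
    have hn : ‖(1 / (K : ℂ) ^ 2)‖ = 1 / (K : ℝ) ^ 2 := by simp
    rw [hn]
    gcongr
    exact (norm_add_le _ _).trans (add_le_add hoscsum hmean)
  have hsum : ‖(∑' p : ℤ × ℤ, ω p.1 p.2 * G (P p.1 p.2)) / ((K * X : ℕ) : ℂ) ^ 2
      - c * ∑ i ∈ s, ∑ j ∈ s, G ((i : ℝ) / K, (j : ℝ) / K) / (K : ℂ) ^ 2‖
      ≤ 4 * L ^ 2 * (ε + B * ε') := by
    rw [htsum]
    simp only [Finset.sum_div, Finset.mul_sum] at hcellsum ⊢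
    simp only [← Finset.sum_sub_distrib] at hcellsum ⊢
    refine (norm_sum_le_of_le _ fun i hi => norm_sum_le_of_le _ fun j hj => ?_).trans
      (b := ∑ i ∈ s, ∑ j ∈ s, (ε + B * ε') * (1 / (K : ℝ) ^ 2)) ?_
    · simpa only [← Finset.sum_sub_distrib] using hcellsum i hi j hj
    · rw [Finset.sum_const, Finset.sum_const, nsmul_eq_mul, nsmul_eq_mul, hcard]
      refine le_of_eq ?_
      field_simp
      ring
  have hI := norm_integral_sub_sum_gridCell_le hG hK hsupp hosc
  rw [← hs] at hI
  set T₀ := ∑ i ∈ s, ∑ j ∈ s, G ((i : ℝ) / K, (j : ℝ) / K) / (K : ℂ) ^ 2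
  have hfin : (∑' p : ℤ × ℤ, ω p.1 p.2 * G (P p.1 p.2)) / ((K * X : ℕ) : ℂ) ^ 2 - c * ∫ p, G p
      = ((∑' p : ℤ × ℤ, ω p.1 p.2 * G (P p.1 p.2)) / ((K * X : ℕ) : ℂ) ^ 2 - c * T₀)
        - c * ((∫ p, G p) - T₀) := by ring
  rw [hfin]
  refine (norm_sub_le _ _).trans ?_
  rw [norm_mul]
  have := mul_le_mul_of_nonneg_left hI (norm_nonneg c)
  linarith

end RiemannSums

section UniformApproximation

lemma exists_uniform_tsum_approx {ω : ℤ → ℤ → ℂ} (hω : ∀ m n, ‖ω m n‖ ≤ 1) {z : ℂ}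
    (hmean : ∀ i j : ℤ, Tendsto (fun X : ℕ => (∑ x ∈ Finset.range X, ∑ y ∈ Finset.range X,
      ω (i * X + x) (j * X + y)) / (X : ℂ) ^ 2) atTop (𝓝 z))
    {g : ℝ × ℝ → ℂ} (hg : Continuous g) (hgs : HasCompactSupport g) {C : ℝ} (hC : 0 < C)
    {ε : ℝ} (hε : 0 < ε) (R₀ : ℕ) :
    ∃ R : ℕ, R₀ ≤ R ∧ 0 < R ∧ ∀ a b c d : ℝ, a * d - b * c = 1 → |a| ≤ C → |b| ≤ C → |c| ≤ C →
      |d| ≤ C → ‖(∑' p : ℤ × ℤ, ω p.1 p.2 * g (a * ((p.1 : ℝ) / R) + b * ((p.2 : ℝ) / R),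
        c * ((p.1 : ℝ) / R) + d * ((p.2 : ℝ) / R))) / (R : ℂ) ^ 2 - z * ∫ p, g p‖ ≤ ε := by
  obtain ⟨B, hB⟩ := hgs.exists_bound_of_continuous hg
  have hB0 : 0 ≤ B := (norm_nonneg _).trans (hB 0)
  obtain ⟨r, hr⟩ := hgs.isBounded.subset_closedBall (0 : ℝ × ℝ)
  have hgr : ∀ p : ℝ × ℝ, g p ≠ 0 → |p.1| ≤ r ∧ |p.2| ≤ r := by
    intro p hp
    have := hr (subset_tsupport _ hp)
    rw [mem_closedBall_zero_iff, Prod.norm_def] at this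
    exact ⟨(le_max_left _ _).trans this, (le_max_right _ _).trans this⟩
  obtain ⟨L, hL⟩ := exists_nat_gt (max 1 (2 * C * r))
  have hL1 : (1 : ℝ) < L := (le_max_left _ _).trans_lt hL
  have hLr : 2 * C * r < L := (le_max_right _ _).trans_lt hL
  set ε₁ := ε / (4 * (L : ℝ) ^ 2 * (2 * (1 + ‖z‖))) with hε₁
  set ε₂ := ε / (4 * (L : ℝ) ^ 2 * (2 * (1 + B))) with hε₂
  have hz : 0 < 1 + ‖z‖ := by positivity
  have hε₁pos : 0 < ε₁ := by positivity
  have hε₂pos : 0 < ε₂ := by positivity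
  obtain ⟨δ, hδ, hunif⟩ := Metric.uniformContinuous_iff.1
    (hgs.uniformContinuous_of_continuous hg) ε₁ hε₁pos
  obtain ⟨K, hK⟩ := exists_nat_gt (max 1 (2 * C / δ))
  have hK1 : (1 : ℝ) < K := (le_max_left _ _).trans_lt hK
  have hK0 : 0 < K := by
    have : (0 : ℝ) < K := by linarith
    exact_mod_cast this
  have hKδ : 2 * C * (1 / K) < δ := by
    have h1 : 2 * C / δ < K := (le_max_right _ _).trans_lt hK
    rw [div_lt_iff₀ hδ] at h1
    rw [mul_one_div, div_lt_iff₀ (by linarith)]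
    linarith
  have hev : ∀ᶠ X : ℕ in atTop, ∀ i ∈ Finset.Ico (-(L * K : ℤ)) (L * K),
      ∀ j ∈ Finset.Ico (-(L * K : ℤ)) (L * K), ‖(∑ x ∈ Finset.range X, ∑ y ∈ Finset.range X,
        ω (i * X + x) (j * X + y)) / (X : ℂ) ^ 2 - z‖ ≤ ε₂ := by
    refine (Filter.eventually_all_finset _).2 fun i _ =>
      (Filter.eventually_all_finset _).2 fun j _ => ?_
    filter_upwards [Metric.tendsto_nhds.1 (hmean i j) ε₂ hε₂pos] with X hX
    rw [dist_eq_norm] at hX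
    exact hX.le
  obtain ⟨X, hX, hX1⟩ := (hev.and (eventually_ge_atTop (max R₀ 1))).exists
  have hX0 : 0 < X := (le_max_right R₀ 1).trans hX1
  refine ⟨K * X, ((le_max_left R₀ 1).trans hX1).trans (Nat.le_mul_of_pos_left X hK0),
    Nat.mul_pos hK0 hX0, fun a b c d hdet ha hb hc hd => ?_⟩
  set G : ℝ × ℝ → ℂ := fun p => g (a * p.1 + b * p.2, c * p.1 + d * p.2) with hG
  have hGsupp : ∀ p, G p ≠ 0 → (-(L : ℝ) ≤ p.1 ∧ p.1 < L) ∧ (-(L : ℝ) ≤ p.2 ∧ p.2 < L) := by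
    intro p hp
    obtain ⟨h1, h2⟩ := hgr _ hp
    have hlin : ∀ s t x y : ℝ, |s| ≤ C → |t| ≤ C → |x| ≤ r → |y| ≤ r → |s * x - t * y| < L := by
      intro s t x y hs ht hx hy
      refine lt_of_le_of_lt ?_ hLr
      calc |s * x - t * y| ≤ |s| * |x| + |t| * |y| := by
            rw [← abs_mul, ← abs_mul]; exact abs_sub _ _
        _ ≤ C * r + C * r := by gcongr
        _ = 2 * C * r := by ring
    have e1 : p.1 = d * (a * p.1 + b * p.2) - b * (c * p.1 + d * p.2) := by
      linear_combination (-p.1) * hdet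
    have e2 : p.2 = a * (c * p.1 + d * p.2) - c * (a * p.1 + b * p.2) := by
      linear_combination (-p.2) * hdet
    have f1 := abs_lt.1 (hlin _ _ _ _ hd hb h1 h2)
    have f2 := abs_lt.1 (hlin _ _ _ _ ha hc h2 h1)
    rw [← e1] at f1
    rw [← e2] at f2
    exact ⟨⟨f1.1.le, f1.2⟩, ⟨f2.1.le, f2.2⟩⟩
  have hGcont : Continuous G := hg.comp (by fun_prop)
  have hGint : Integrable G := by
    refine hGcont.integrable_of_hasCompactSupport
      (HasCompactSupport.intro (K := Set.Icc (-(L : ℝ)) L ×ˢ Set.Icc (-(L : ℝ)) L)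
        (isCompact_Icc.prod isCompact_Icc) fun p hp => ?_)
    by_contra hne
    obtain ⟨h1, h2⟩ := hGsupp p hne
    exact hp ⟨⟨h1.1, h1.2.le⟩, ⟨h2.1, h2.2.le⟩⟩
  have hosc : ∀ p q : ℝ × ℝ, |p.1 - q.1| ≤ 1 / K → |p.2 - q.2| ≤ 1 / K → ‖G p - G q‖ ≤ ε₁ := by
    intro p q h1 h2
    rw [← dist_eq_norm]
    refine (hunif ?_).le
    have hlin : ∀ s t : ℝ, |s| ≤ C → |t| ≤ C →
        dist (s * p.1 + t * p.2) (s * q.1 + t * q.2) < δ := by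
      intro s t hs ht
      refine lt_of_le_of_lt ?_ hKδ
      rw [Real.dist_eq]
      calc |s * p.1 + t * p.2 - (s * q.1 + t * q.2)|
          = |s * (p.1 - q.1) + t * (p.2 - q.2)| := by ring_nf
        _ ≤ |s| * |p.1 - q.1| + |t| * |p.2 - q.2| := by
            rw [← abs_mul, ← abs_mul]; exact abs_add_le _ _
        _ ≤ C * (1 / K) + C * (1 / K) := by gcongr
        _ = 2 * C * (1 / K) := by ring
    exact max_lt (hlin a b ha hb) (hlin c d hc hd)
  have hmain := norm_tsum_sub_mul_integral_le hω hGint hK0 hX0 hGsupp hosc (fun p => hB _) hX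
  rw [hG, integral_comp_unimodular g hdet] at hmain
  refine hmain.trans ?_
  have h1 : 4 * (L : ℝ) ^ 2 * (ε₁ * (1 + ‖z‖)) = ε / 2 := by
    rw [hε₁]; field_simp
  have h2 : 4 * (L : ℝ) ^ 2 * ((1 + B) * ε₂) = ε / 2 := by
    rw [hε₂]; field_simp
  have h3 : 4 * (L : ℝ) ^ 2 * (B * ε₂) ≤ 4 * (L : ℝ) ^ 2 * ((1 + B) * ε₂) := by
    gcongr; linarith
  linarith

end UniformApproximation

/-- A unimodular lattice without vertical vectors, with a chosen basis `(a, c)`, `(b, d)`. -/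
structure NonVertLattice where
  a : ℝ
  b : ℝ
  c : ℝ
  d : ℝ
  det_eq_one : a * d - b * c = 1
  eq_zero_of_u : ∀ m n : ℤ, a * m + b * n = 0 → m = 0 ∧ n = 0

/-- The determinant of two integer vectors. -/
def idet (w x : ℤ × ℤ) : ℤ := w.1 * x.2 - w.2 * x.1

lemma eq_idet_smul_add {e f : ℤ × ℤ} (h : idet e f = 1) (x : ℤ × ℤ) :
    x = idet x f • e + idet e x • f := by
  unfold idet at *
  ext
  · simp only [Prod.fst_add, Prod.smul_fst, smul_eq_mul]
    linear_combination (-x.1) * h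
  · simp only [Prod.snd_add, Prod.smul_snd, smul_eq_mul]
    linear_combination (-x.2) * h

lemma exists_idet_eq_one {w : ℤ × ℤ} (h : IsCoprime w.1 w.2) : ∃ x, idet w x = 1 := by
  obtain ⟨s, t, hst⟩ := h
  exact ⟨(-t, s), by unfold idet; linarith⟩

lemma isCoprime_of_idet_left {w x : ℤ × ℤ} (h : idet w x = 1) : IsCoprime w.1 w.2 :=
  ⟨x.2, -x.1, by unfold idet at h; linarith⟩

lemma isCoprime_of_idet_right {w x : ℤ × ℤ} (h : idet w x = 1) : IsCoprime x.1 x.2 :=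
  ⟨-w.2, w.1, by unfold idet at h; linarith⟩

lemma idet_add_zsmul (w x : ℤ × ℤ) (t : ℤ) : idet w (x + t • w) = idet w x := by
  simp only [idet, Prod.fst_add, Prod.snd_add, Prod.smul_fst, Prod.smul_snd, smul_eq_mul]
  ring

namespace NonVertLattice

variable (L : NonVertLattice)

/-- The horizontal coordinate of the lattice vector with integer coordinates `w`. -/
def u (w : ℤ × ℤ) : ℝ := L.a * w.1 + L.b * w.2

/-- The vertical coordinate of the lattice vector with integer coordinates `w`. -/
def v (w : ℤ × ℤ) : ℝ := L.c * w.1 + L.d * w.2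

/-- The slope of a lattice vector. -/
def slope (w : ℤ × ℤ) : ℝ := L.v w / L.u w

lemma u_add (w x : ℤ × ℤ) : L.u (w + x) = L.u w + L.u x := by
  simp only [u, Prod.fst_add, Prod.snd_add]; push_cast; ring

lemma v_add (w x : ℤ × ℤ) : L.v (w + x) = L.v w + L.v x := by
  simp only [v, Prod.fst_add, Prod.snd_add]; push_cast; ring

lemma u_zsmul (t : ℤ) (w : ℤ × ℤ) : L.u (t • w) = t * L.u w := by
  simp only [u, Prod.smul_fst, Prod.smul_snd, smul_eq_mul]; push_cast; ring

lemma v_zsmul (t : ℤ) (w : ℤ × ℤ) : L.v (t • w) = t * L.v w := by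
  simp only [v, Prod.smul_fst, Prod.smul_snd, smul_eq_mul]; push_cast; ring

lemma u_mul_v_sub (w x : ℤ × ℤ) : L.u w * L.v x - L.v w * L.u x = idet w x := by
  simp only [u, v, idet]
  push_cast
  linear_combination ((w.1 : ℝ) * x.2 - w.2 * x.1) * L.det_eq_one

lemma v_eq_slope_mul {w : ℤ × ℤ} (hw : 0 < L.u w) : L.v w = L.slope w * L.u w :=
  (div_mul_cancel₀ _ hw.ne').symm

lemma slope_sub {w x : ℤ × ℤ} (hw : 0 < L.u w) (hx : 0 < L.u x) :
    L.slope x - L.slope w = idet w x / (L.u w * L.u x) := by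
  rw [← L.u_mul_v_sub, slope, slope]
  field_simp

lemma slope_lt_iff {w x : ℤ × ℤ} (hw : 0 < L.u w) (hx : 0 < L.u x) :
    L.slope w < L.slope x ↔ 0 < idet w x := by
  rw [← sub_pos, L.slope_sub hw hx, div_pos_iff_of_pos_right (mul_pos hw hx)]
  exact Int.cast_pos

lemma eq_of_idet_eq_zero {w x : ℤ × ℤ} (hw : IsCoprime w.1 w.2) (hx : IsCoprime x.1 x.2)
    (huw : 0 < L.u w) (hux : 0 < L.u x) (h : idet w x = 0) : x = w := by
  obtain ⟨f, hf⟩ := exists_idet_eq_one hw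
  have h1 := eq_idet_smul_add hf x
  rw [h, zero_smul, add_zero] at h1
  set k := idet x f
  have hk : IsUnit k := by
    obtain ⟨s, t, hst⟩ := hx
    rw [h1] at hst
    simp only [Prod.smul_fst, Prod.smul_snd, smul_eq_mul] at hst
    exact IsUnit.of_mul_eq_one (s * w.1 + t * w.2) (by linear_combination hst)
  rcases Int.isUnit_iff.1 hk with hk | hk
  · rw [h1, hk, one_smul]
  · rw [h1, L.u_zsmul, hk] at hux
    push_cast at hux
    linarith

lemma one_div_le_abs_slope_sub {w x : ℤ × ℤ} (hw : IsCoprime w.1 w.2) (hx : IsCoprime x.1 x.2)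
    (huw : 0 < L.u w) (hux : 0 < L.u x) (h : x ≠ w) :
    1 / (L.u w * L.u x) ≤ |L.slope x - L.slope w| := by
  rw [L.slope_sub huw hux, abs_div, abs_of_pos (mul_pos huw hux)]
  have h0 : idet w x ≠ 0 := fun h0 => h (L.eq_of_idet_eq_zero hw hx huw hux h0)
  have : (1 : ℝ) ≤ |(idet w x : ℝ)| := by exact_mod_cast Int.one_le_abs h0
  have := mul_pos huw hux
  gcongr

lemma slope_le_of_slope_lt {e f x : ℤ × ℤ} {ρ : ℝ} (h : idet e f = 1) (he : 0 < L.u e)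
    (hf : 0 < L.u f) (hef : ρ < L.u e + L.u f) (hx : 0 < L.u x) (hxρ : L.u x ≤ ρ)
    (hlt : L.slope e < L.slope x) : L.slope f ≤ L.slope x := by
  by_contra! hlt'
  rw [L.slope_lt_iff he hx] at hlt
  rw [L.slope_lt_iff hx hf] at hlt'
  have h1 : L.u x = idet x f * L.u e + idet e x * L.u f := by
    conv_lhs => rw [eq_idet_smul_add h x, L.u_add, L.u_zsmul, L.u_zsmul]
  have h2 : (1 : ℝ) ≤ idet x f := by exact_mod_cast hlt'
  have h3 : (1 : ℝ) ≤ idet e x := by exact_mod_cast hlt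
  nlinarith

lemma exists_next {w : ℤ × ℤ} (hw : IsCoprime w.1 w.2) {ρ : ℝ} (hu : 0 < L.u w) :
    ∃ x, idet w x = 1 ∧ ρ - L.u w < L.u x ∧ L.u x ≤ ρ := by
  obtain ⟨x, hx⟩ := exists_idet_eq_one hw
  obtain ⟨t, ht, -⟩ := existsUnique_add_zsmul_mem_Ioc hu (L.u x) (ρ - L.u w)
  refine ⟨x + t • w, by rw [idet_add_zsmul, hx], ?_⟩
  rw [L.u_add, L.u_zsmul]
  simp only [zsmul_eq_mul, Set.mem_Ioc, sub_add_cancel] at ht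
  exact ht

lemma finite_setOf_bounded (B C : ℝ) : {w : ℤ × ℤ | |L.u w| ≤ C ∧ |L.v w| ≤ B}.Finite := by
  set N := ⌈(|L.a| + |L.b| + |L.c| + |L.d|) * (|B| + |C|)⌉ with hN
  refine ((Set.finite_Icc (-N) N).prod (Set.finite_Icc (-N) N)).subset ?_
  rintro w ⟨h1, h2⟩
  have key : ∀ (s t : ℝ) (m : ℤ), |s| ≤ |L.a| + |L.b| + |L.c| + |L.d| →
      |t| ≤ |L.a| + |L.b| + |L.c| + |L.d| → (m : ℝ) = s * L.u w - t * L.v w → -N ≤ m ∧ m ≤ N := by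
    intro s t m hs ht hm
    have h3 : |(m : ℝ)| ≤ (|L.a| + |L.b| + |L.c| + |L.d|) * (|B| + |C|) := by
      rw [hm]
      calc |s * L.u w - t * L.v w| ≤ |s| * |L.u w| + |t| * |L.v w| := by
            rw [← abs_mul, ← abs_mul]; exact abs_sub _ _
        _ ≤ (|L.a| + |L.b| + |L.c| + |L.d|) * |C| + (|L.a| + |L.b| + |L.c| + |L.d|) * |B| := by
            exact add_le_add
              (mul_le_mul hs (h1.trans (le_abs_self _)) (abs_nonneg _) (by positivity))
              (mul_le_mul ht (h2.trans (le_abs_self _)) (abs_nonneg _) (by positivity))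
        _ = _ := by ring
    have h4 := (h3.trans (Int.le_ceil _))
    rw [← hN] at h4
    exact abs_le.1 (by exact_mod_cast h4)
  have pa := abs_nonneg L.a
  have pb := abs_nonneg L.b
  have pc := abs_nonneg L.c
  have pd := abs_nonneg L.d
  refine ⟨key L.d L.b w.1 (by linarith) (by linarith) ?_,
    key (-L.c) (-L.a) w.2 (by rw [abs_neg]; linarith) (by rw [abs_neg]; linarith) ?_⟩
  · simp only [u, v]
    linear_combination (-(w.1 : ℝ)) * L.det_eq_one
  · simp only [u, v]
    linear_combination (-(w.2 : ℝ)) * L.det_eq_one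

lemma finite_setOf_slope_mem (C s t : ℝ) :
    {w : ℤ × ℤ | 0 < L.u w ∧ L.u w ≤ C ∧ s ≤ L.slope w ∧ L.slope w ≤ t}.Finite := by
  refine (L.finite_setOf_bounded ((|s| + |t|) * C) C).subset ?_
  rintro w ⟨h1, h2, h3, h4⟩
  refine ⟨by rwa [abs_of_pos h1], ?_⟩
  rw [L.v_eq_slope_mul h1, abs_mul, abs_of_pos h1]
  have h5 : |L.slope w| ≤ |s| + |t| := by
    rw [abs_le]
    constructor
    · linarith [neg_abs_le s, abs_nonneg t]
    · linarith [le_abs_self t, abs_nonneg s]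
  gcongr

lemma exists_u_mem_Ioc {ρ : ℝ} (hρ : 0 < ρ) : ∃ w, 0 < L.u w ∧ L.u w ≤ ρ := by
  let φ : ℤ × ℤ →+ ℝ := AddMonoidHom.mk' L.u L.u_add
  rcases AddSubgroup.dense_or_cyclic φ.range with h | ⟨g, hg⟩
  · obtain ⟨x, hx, hx2⟩ := h.exists_mem_open isOpen_Ioo (Set.nonempty_Ioo.2 hρ)
    obtain ⟨w, rfl⟩ := hx
    exact ⟨w, hx2.1, hx2.2.le⟩
  · exfalso
    have hmem : ∀ w, ∃ t : ℤ, t * g = L.u w := by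
      intro w
      have h1 : φ w ∈ AddSubgroup.closure {g} := hg ▸ ⟨w, rfl⟩
      obtain ⟨t, ht⟩ := AddSubgroup.mem_closure_singleton.1 h1
      exact ⟨t, by rw [← zsmul_eq_mul]; exact ht⟩
    obtain ⟨p, hp⟩ := hmem (1, 0)
    obtain ⟨q, hq⟩ := hmem (0, 1)
    simp only [u, Int.cast_one, Int.cast_zero, mul_one, mul_zero, add_zero, zero_add] at hp hq
    obtain ⟨h1, h2⟩ := L.eq_zero_of_u q (-p) (by rw [← hp, ← hq]; push_cast; ring)
    have h3 : p = 0 := by omega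
    have h4 := L.det_eq_one
    rw [← hp, ← hq, h1, h3] at h4
    simp at h4

lemma exists_coprime_of_u_pos {w : ℤ × ℤ} (hw : 0 < L.u w) :
    ∃ x : ℤ × ℤ, IsCoprime x.1 x.2 ∧ 0 < L.u x ∧ L.u x ≤ L.u w ∧ L.slope x = L.slope w := by
  have hg : 0 < Int.gcd w.1 w.2 := by
    rw [Nat.pos_iff_ne_zero, Ne, Int.gcd_eq_zero_iff]
    rintro ⟨h1, h2⟩
    simp [u, h1, h2] at hw
  obtain ⟨m, n, hmn, h1, h2⟩ := Int.exists_gcd_one hg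
  set g := Int.gcd w.1 w.2
  have hwx : w = (g : ℤ) • (m, n) := by
    ext
    · simpa [mul_comm] using h1
    · simpa [mul_comm] using h2
  have hgR : (1 : ℝ) ≤ g := by exact_mod_cast hg
  have hu : L.u w = g * L.u (m, n) := by rw [hwx, L.u_zsmul]; push_cast; rfl
  have hv : L.v w = g * L.v (m, n) := by rw [hwx, L.v_zsmul]; push_cast; rfl
  have hpos : 0 < L.u (m, n) := by
    rw [hu] at hw
    exact pos_of_mul_pos_right hw (by linarith)
  refine ⟨(m, n), Int.isCoprime_iff_gcd_eq_one.2 hmn, hpos, by rw [hu]; nlinarith, ?_⟩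
  rw [slope, slope, hu, hv, mul_div_mul_left _ _ (by linarith)]

lemma exists_coprime_u_mem_Ioc {ρ : ℝ} (hρ : 0 < ρ) :
    ∃ w : ℤ × ℤ, IsCoprime w.1 w.2 ∧ 0 < L.u w ∧ L.u w ≤ ρ := by
  obtain ⟨w, h1, h2⟩ := L.exists_u_mem_Ioc hρ
  obtain ⟨x, hx, h3, h4, -⟩ := L.exists_coprime_of_u_pos h1
  exact ⟨x, hx, h3, h4.trans h2⟩

lemma slope_add_le_of_idet {w x : ℤ × ℤ} {ρ : ℝ} (h : idet w x = 1) (hw : 0 < L.u w)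
    (hwρ : L.u w ≤ ρ) (hx : 0 < L.u x) (hxρ : L.u x ≤ ρ) :
    L.slope w + 1 / ρ ^ 2 ≤ L.slope x := by
  have h1 := L.slope_sub hw hx
  rw [h] at h1
  have h2 : 1 / ρ ^ 2 ≤ ((1 : ℤ) : ℝ) / (L.u w * L.u x) := by
    push_cast
    have := mul_pos hw hx
    have hρ : 0 ≤ ρ := hw.le.trans hwρ
    rw [sq]
    gcongr
  linarith

lemma exists_slope_ge {ρ : ℝ} (hρ : 0 < ρ) (s : ℝ) :
    ∃ w : ℤ × ℤ, IsCoprime w.1 w.2 ∧ 0 < L.u w ∧ L.u w ≤ ρ ∧ s ≤ L.slope w := by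
  obtain ⟨w₀, hw₀, hu₀, huρ₀⟩ := L.exists_coprime_u_mem_Ioc hρ
  have key : ∀ n : ℕ, ∃ w : ℤ × ℤ, IsCoprime w.1 w.2 ∧ 0 < L.u w ∧ L.u w ≤ ρ ∧
      L.slope w₀ + n * (1 / ρ ^ 2) ≤ L.slope w := by
    intro n
    induction n with
    | zero => exact ⟨w₀, hw₀, hu₀, huρ₀, by simp⟩
    | succ n ih =>
      obtain ⟨w, h1, h2, h3, h4⟩ := ih
      obtain ⟨x, hx, hx1, hx2⟩ := L.exists_next h1 (ρ := ρ) h2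
      have hx0 : 0 < L.u x := by linarith
      refine ⟨x, isCoprime_of_idet_right hx, hx0, hx2, ?_⟩
      have := L.slope_add_le_of_idet hx h2 h3 hx0 hx2
      push_cast
      linarith
  obtain ⟨n, hn⟩ := exists_nat_ge ((s - L.slope w₀) * ρ ^ 2)
  obtain ⟨w, h1, h2, h3, h4⟩ := key n
  refine ⟨w, h1, h2, h3, ?_⟩
  have h5 : s - L.slope w₀ ≤ n * (1 / ρ ^ 2) := by
    rw [mul_one_div, le_div_iff₀ (by positivity)]
    exact hn
  linarith

lemma exists_slope_le {ρ : ℝ} (hρ : 0 < ρ) (s : ℝ) :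
    ∃ w : ℤ × ℤ, IsCoprime w.1 w.2 ∧ 0 < L.u w ∧ L.u w ≤ ρ ∧ L.slope w ≤ s := by
  obtain ⟨w, h1, h2, h3, h4⟩ := NonVertLattice.exists_slope_ge
    ⟨L.a, -L.b, -L.c, L.d, by linarith [L.det_eq_one], fun m n h => by
      obtain ⟨h1, h2⟩ := L.eq_zero_of_u m (-n) (by push_cast; linarith)
      exact ⟨h1, by omega⟩⟩ hρ (-s)
  have hu : L.u (w.1, -w.2) = L.a * w.1 + -L.b * w.2 := by simp only [u]; push_cast; ring
  have hv : L.v (w.1, -w.2) = -(-L.c * w.1 + L.d * w.2) := by simp only [v]; push_cast; ring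
  refine ⟨(w.1, -w.2), h1.neg_right, hu ▸ h2, hu ▸ h3, ?_⟩
  rw [slope, hu, hv, neg_div]
  simp only [slope, u, v] at h4
  linarith

lemma exists_consecutive_basis {ρ : ℝ} (hρ : 0 < ρ) (s : ℝ) :
    ∃ e f : ℤ × ℤ, idet e f = 1 ∧ 0 < L.u e ∧ L.u e ≤ ρ ∧ 0 < L.u f ∧ L.u f ≤ ρ ∧
      ρ < L.u e + L.u f ∧ L.slope e ≤ s ∧ s < L.slope f := by
  obtain ⟨w, hw, hu, huρ, hs⟩ := L.exists_slope_le hρ s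
  have hfin : {x : ℤ × ℤ | IsCoprime x.1 x.2 ∧ 0 < L.u x ∧ L.u x ≤ ρ ∧ L.slope w ≤ L.slope x ∧
      L.slope x ≤ s}.Finite := (L.finite_setOf_slope_mem ρ (L.slope w) s).subset fun _ h => h.2
  obtain ⟨e, ⟨he, hue, heρ, hwe, hes⟩, hmax⟩ :=
    Set.exists_max_image _ L.slope hfin ⟨w, hw, hu, huρ, le_rfl, hs⟩
  obtain ⟨f, hf, hf1, hf2⟩ := L.exists_next he (ρ := ρ) hue
  have hf0 : 0 < L.u f := by linarith
  have hlt : L.slope e < L.slope f := (L.slope_lt_iff hue hf0).2 (by omega)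
  refine ⟨e, f, hf, hue, heρ, hf0, hf2, by linarith, hes, ?_⟩
  by_contra! hfs
  exact hlt.not_ge (hmax f ⟨isCoprime_of_idet_right hf, hf0, hf2, hwe.trans hlt.le, hfs⟩)

end NonVertLattice

lemma card_le_of_separated {ι : Type*} (s : Finset ι) (σ : ι → ℝ) {δ T p : ℝ} (hδ : 0 < δ)
    (hT : 0 ≤ T) (hmem : ∀ i ∈ s, p ≤ σ i ∧ σ i ≤ p + T)
    (hsep : ∀ i ∈ s, ∀ j ∈ s, i ≠ j → δ ≤ |σ i - σ j|) : (s.card : ℝ) ≤ T / δ + 1 := by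
  have hinj : Set.InjOn (fun i => ⌊(σ i - p) / δ⌋₊) s := by
    intro i hi j hj hij
    by_contra hne
    have h1 := hsep i hi j hj hne
    have hi0 : 0 ≤ (σ i - p) / δ := div_nonneg (by linarith [(hmem i hi).1]) hδ.le
    have hj0 : 0 ≤ (σ j - p) / δ := div_nonneg (by linarith [(hmem j hj).1]) hδ.le
    have a1 := Nat.floor_le hi0
    have a2 := Nat.lt_floor_add_one ((σ i - p) / δ)
    have b1 := Nat.floor_le hj0
    have b2 := Nat.lt_floor_add_one ((σ j - p) / δ)
    simp only at hij
    rw [hij] at a1 a2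
    have h2 : |(σ i - p) / δ - (σ j - p) / δ| < 1 := by
      rw [abs_lt]; constructor <;> linarith
    rw [← sub_div, sub_sub_sub_cancel_right, abs_div, abs_of_pos hδ, div_lt_one hδ] at h2
    linarith
  have hcard : s.card ≤ ⌊T / δ⌋₊ + 1 := by
    rw [← Finset.card_image_of_injOn hinj, ← Finset.card_range (⌊T / δ⌋₊ + 1)]
    refine Finset.card_le_card fun n hn => ?_
    obtain ⟨i, hi, rfl⟩ := Finset.mem_image.1 hn
    rw [Finset.mem_range, Nat.lt_add_one_iff]
    apply Nat.floor_le_floor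
    have := (hmem i hi).2
    gcongr
    linarith
  have h3 := Nat.floor_le (div_nonneg hT hδ.le)
  have h4 : (s.card : ℝ) ≤ ⌊T / δ⌋₊ + 1 := by exact_mod_cast hcard
  linarith

lemma NonVertLattice.card_le_of_slope_mem (L : NonVertLattice) (s : Finset (ℤ × ℤ)) {C T p : ℝ}
    (hC : 0 < C) (hT : 0 ≤ T) (hs : ∀ w ∈ s, IsCoprime w.1 w.2 ∧ 0 < L.u w ∧ L.u w ≤ C ∧
      p ≤ L.slope w ∧ L.slope w ≤ p + T) : (s.card : ℝ) ≤ C ^ 2 * T + 1 := by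
  have := card_le_of_separated s L.slope (δ := 1 / C ^ 2) (T := T) (p := p) (by positivity) hT
    (fun w hw => (hs w hw).2.2.2) fun w hw x hx hne => by
      obtain ⟨hw1, hw2, hw3, -⟩ := hs w hw
      obtain ⟨hx1, hx2, hx3, -⟩ := hs x hx
      refine le_trans ?_ (L.one_div_le_abs_slope_sub hx1 hw1 hx2 hw2 hne)
      have := mul_pos hx2 hw2
      rw [sq]
      gcongr
  rwa [div_div_eq_mul_div, div_one, mul_comm] at this

lemma sum_two_mul_le_of_separated {ι : Type*} (s : Finset ι) (σ r : ι → ℝ) {A B : ℝ} (hAB : A ≤ B)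
    (hr : ∀ i ∈ s, 0 ≤ r i) (hsep : ∀ i ∈ s, ∀ j ∈ s, i ≠ j → r i + r j ≤ |σ i - σ j|)
    (hmem : ∀ i ∈ s, A ≤ σ i - r i ∧ σ i + r i ≤ B) : ∑ i ∈ s, 2 * r i ≤ B - A := by
  have hdisj : Set.PairwiseDisjoint (s : Set ι) fun i => Set.Ioo (σ i - r i) (σ i + r i) := by
    intro i hi j hj hij
    rw [Function.onFun, Set.disjoint_left]
    rintro x ⟨h1, h2⟩ ⟨h3, h4⟩
    have h5 := hsep i hi j hj hij
    rcases abs_cases (σ i - σ j) with ⟨h6, -⟩ | ⟨h6, -⟩ <;> linarith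
  have h1 := measure_biUnion_finset (μ := volume) hdisj fun i _ => measurableSet_Ioo
  have h2 : volume (⋃ i ∈ s, Set.Ioo (σ i - r i) (σ i + r i)) ≤ volume (Set.Icc A B) := by
    refine measure_mono (Set.iUnion₂_subset fun i hi x hx => ?_)
    have := hmem i hi
    exact ⟨by linarith [hx.1], by linarith [hx.2]⟩
  have h3 : ∀ i ∈ s, volume (Set.Ioo (σ i - r i) (σ i + r i)) = ENNReal.ofReal (2 * r i) := by
    intro i _
    rw [Real.volume_Ioo]
    congr 1
    ring
  rw [h1, Finset.sum_congr rfl h3, ← ENNReal.ofReal_sum_of_nonneg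
    (fun i hi => mul_nonneg zero_le_two (hr i hi)), Real.volume_Icc] at h2
  exact (ENNReal.ofReal_le_ofReal_iff (by linarith)).1 h2

namespace NonVertLattice

variable (L : NonVertLattice)

/-- A primitive lattice vector in a thin strip whose slope is close to `t`. -/
def IsCusp (κ : ℝ) (R : ℕ) (t : ℝ) (e : ℤ × ℤ) : Prop :=
  IsCoprime e.1 e.2 ∧ 0 < L.u e ∧ L.u e < κ / R ∧ |t - L.slope e| ≤ 2 * R / L.u e

variable {L} in
lemma exists_balanced_basis {κ : ℝ} (hκ : κ ≤ 1 / 4) {R : ℕ} (hR : 0 < R) {t : ℝ}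
    (ht : ¬ ∃ e, L.IsCusp κ R t e) :
    ∃ e f : ℤ × ℤ, idet e f = 1 ∧ 0 < L.u e ∧ κ / R ≤ L.u e ∧ L.u e ≤ 1 / R ∧ 0 < L.u f ∧
      κ / R ≤ L.u f ∧ L.u f ≤ 1 / R ∧ L.slope e ≤ t ∧ t < L.slope f := by
  have hR' : (0 : ℝ) < R := by exact_mod_cast hR
  obtain ⟨e, f, hef, he, heR, hf, hfR, hsum, h1, h2⟩ :=
    L.exists_consecutive_basis (ρ := 1 / R) (by positivity) t
  have hsub := L.slope_sub he hf
  rw [hef, Int.cast_one] at hsub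
  have hκR : κ / R ≤ 1 / R - 1 / (2 * R) := by
    rw [div_le_iff₀ hR', show (1 / (R : ℝ) - 1 / (2 * R)) * R = 1 / 2 by field_simp; norm_num]
    linarith
  have key : ∀ x y : ℝ, 0 < x → 0 < y → 1 / (R : ℝ) < x + y → x < κ / R →
      1 / (x * y) ≤ 2 * R / x := by
    intro x y hx hy hxy hxκ
    have : 1 / (2 * (R : ℝ)) ≤ y := by linarith
    rw [div_le_div_iff₀ (mul_pos hx hy) hx]
    have h3 : 1 ≤ y * (2 * R) := by rwa [div_le_iff₀ (by positivity)] at this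
    nlinarith
  refine ⟨e, f, hef, he, ?_, heR, hf, ?_, hfR, h1, h2⟩
  · by_contra! hlt
    refine ht ⟨e, isCoprime_of_idet_left hef, he, hlt, ?_⟩
    refine le_trans ?_ (key _ _ he hf hsum hlt)
    rw [abs_of_nonneg (by linarith)]
    linarith
  · by_contra! hlt
    refine ht ⟨f, isCoprime_of_idet_right hef, hf, hlt, ?_⟩
    refine le_trans ?_ (key _ _ hf he (by linarith) hlt)
    rw [abs_of_nonpos (by linarith), mul_comm]
    linarith

lemma card_isCusp_le {κ : ℝ} (hκ : 0 < κ) (hκ' : κ ≤ 1 / 4) {R : ℕ} (hR : 0 < R)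
    {e : ℤ × ℤ} (he : 0 < L.u e) (he' : L.u e < κ / R) (s : Finset ℕ)
    (hs : ∀ j ∈ s, |(j : ℝ) * R ^ 2 - L.slope e| ≤ 2 * R / L.u e) :
    (s.card : ℝ) ≤ 5 * κ / R ^ 2 * (2 * (R / (2 * κ * L.u e))) := by
  have hR' : (0 : ℝ) < R := by exact_mod_cast hR
  have h1 := card_le_of_separated s (fun j => (j : ℝ) * R ^ 2) (δ := (R : ℝ) ^ 2)
    (T := 4 * R / L.u e) (p := L.slope e - 2 * R / L.u e) (by positivity) (by positivity)
    (fun j hj => by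
      have h2 := abs_le.1 (hs j hj)
      have h3 : 4 * R / L.u e = 2 * R / L.u e + 2 * R / L.u e := by ring
      constructor <;> linarith [h2.1, h2.2]) fun i _ j _ hij => by
      rw [← sub_mul, abs_mul, abs_of_pos (by positivity : (0 : ℝ) < (R : ℝ) ^ 2)]
      refine le_mul_of_one_le_left (by positivity) ?_
      have : (i : ℤ) - j ≠ 0 := sub_ne_zero.2 (by exact_mod_cast hij)
      exact_mod_cast Int.one_le_abs this
  refine h1.trans ?_
  rw [lt_div_iff₀ hR'] at he'
  have h2 : 1 ≤ 1 / (L.u e * R) := by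
    rw [le_div_iff₀ (by positivity)]
    linarith
  have h3 : 4 * R / L.u e / (R : ℝ) ^ 2 = 4 * (1 / (L.u e * R)) := by field_simp
  have h4 : 5 * κ / R ^ 2 * (2 * (R / (2 * κ * L.u e))) = 5 * (1 / (L.u e * R)) := by field_simp
  rw [h3, h4]
  linarith

open Classical in
/-- Most windows are not cuspidal. -/
lemma eventually_card_isCusp_le {κ : ℝ} (hκ : 0 < κ) (hκ' : κ ≤ 1 / 4) {R : ℕ} (hR : 0 < R) :
    ∀ᶠ J : ℕ in atTop,
      (((Finset.range J).filter fun j : ℕ => ∃ e, L.IsCusp κ R (j * R ^ 2) e).card : ℝ) ≤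
        15 * κ * J := by
  have hR' : (0 : ℝ) < R := by exact_mod_cast hR
  have hR1 : (1 : ℝ) ≤ R := by exact_mod_cast hR
  have hev : ∀ᶠ J : ℕ in atTop, ∀ w ∈ {w : ℤ × ℤ | |L.u w| ≤ 1 ∧ |L.v w| ≤ R / κ + 2 * R},
      0 < L.u w → R / (κ * (J * R ^ 2)) ≤ L.u w := by
    rw [Filter.eventually_all_finite (L.finite_setOf_bounded _ _)]
    intro w _
    by_cases hw : 0 < L.u w
    · have hlim : Tendsto (fun J : ℕ => R / (κ * ((J : ℝ) * R ^ 2))) atTop (𝓝 0) := by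
        refine Tendsto.div_atTop tendsto_const_nhds ?_
        exact Tendsto.const_mul_atTop hκ
          (tendsto_natCast_atTop_atTop.atTop_mul_const (by positivity))
      filter_upwards [hlim.eventually (eventually_le_nhds hw)] with J hJ _ using hJ
    · exact Eventually.of_forall fun J h => absurd h hw
  filter_upwards [hev, eventually_gt_atTop 0] with J hJ hJ0
  have hJ' : (0 : ℝ) < J := by exact_mod_cast hJ0
  set bad := (Finset.range J).filter fun j : ℕ => ∃ e, L.IsCusp κ R (j * R ^ 2) e
  have hbad : ∀ j ∈ bad, ∃ e, L.IsCusp κ R (j * R ^ 2) e := fun j hj => (Finset.mem_filter.1 hj).2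
  choose! c hc using hbad
  set E := bad.image c
  set S : ℝ := J * R ^ 2 with hS
  have hS0 : 0 < S := by positivity
  set r : ℤ × ℤ → ℝ := fun e => R / (2 * κ * L.u e) with hr
  have hEmem : ∀ e ∈ E, ∃ j : ℕ, (j : ℝ) * R ^ 2 ≤ S ∧ L.IsCusp κ R (j * R ^ 2) e := by
    intro e he
    obtain ⟨j, hj, rfl⟩ := Finset.mem_image.1 he
    refine ⟨j, ?_, hc j hj⟩
    have : (j : ℝ) ≤ J := by
      exact_mod_cast (Finset.mem_range.1 (Finset.mem_filter.1 hj).1).le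
    rw [hS]
    gcongr
  have hcard : (bad.card : ℝ) ≤ ∑ e ∈ E, 5 * κ / R ^ 2 * (2 * r e) := by
    rw [Finset.card_eq_sum_card_image c bad]
    push_cast
    refine Finset.sum_le_sum fun e he => ?_
    obtain ⟨j, -, -, h1, h2, -⟩ := hEmem e he
    refine L.card_isCusp_le hκ hκ' hR h1 h2 _ fun i hi => ?_
    obtain ⟨hi', rfl⟩ := Finset.mem_filter.1 hi
    exact (hc i hi').2.2.2
  have hsum : ∑ e ∈ E, 2 * r e ≤ 2 * S - -S := by
    refine sum_two_mul_le_of_separated E L.slope r (by linarith) ?_ ?_ ?_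
    · intro e he
      obtain ⟨j, -, -, h1, -⟩ := hEmem e he
      positivity
    · intro e he e' he' hne
      obtain ⟨j, -, hp, h1, h2, -⟩ := hEmem e he
      obtain ⟨j', -, hp', h1', h2', -⟩ := hEmem e' he'
      refine le_trans ?_ (L.one_div_le_abs_slope_sub hp' hp h1' h1 hne)
      rw [lt_div_iff₀ hR'] at h2 h2'
      rw [hr, div_add_div _ _ (by positivity) (by positivity),
        div_le_div_iff₀ (by positivity) (by positivity)]
      have : R * (L.u e + L.u e') ≤ 2 * κ := by linarith
      calc (R * (2 * κ * L.u e') + 2 * κ * L.u e * R) * (L.u e' * L.u e)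
          = (R * (L.u e + L.u e')) * (2 * κ * (L.u e' * L.u e)) := by ring
        _ ≤ (2 * κ) * (2 * κ * (L.u e' * L.u e)) := by gcongr
        _ = _ := by ring
    · intro e he
      obtain ⟨j, hjS, hp, h1, h2, h3⟩ := hEmem e he
      have hj0 : (0 : ℝ) ≤ j * R ^ 2 := by positivity
      have h4 : 2 * R / L.u e ≤ r e := by
        rw [hr, div_le_div_iff₀ h1 (by positivity)]
        nlinarith [mul_pos hR' h1]
      have h5 : 2 * r e ≤ S := by
        have h6 : R / (κ * S) ≤ L.u e := by
          by_contra! hlt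
          refine hlt.not_ge (hJ e ⟨?_, ?_⟩ h1)
          · rw [abs_of_pos h1]
            refine h2.le.trans ((div_le_one hR').2 (by linarith))
          · have h7 := abs_le.1 h3
            have h8 : |L.slope e| ≤ S + 2 * R / L.u e := by
              rw [abs_le]
              constructor <;> linarith [h7.1, h7.2]
            rw [L.v_eq_slope_mul h1, abs_mul, abs_of_pos h1]
            calc |L.slope e| * L.u e ≤ (S + 2 * R / L.u e) * L.u e := by gcongr
              _ = S * L.u e + 2 * R := by field_simp
              _ ≤ S * (R / (κ * S)) + 2 * R := by gcongr
              _ = _ := by field_simp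
        rw [div_le_iff₀ (by positivity)] at h6
        rw [hr, mul_div_assoc', div_le_iff₀ (by positivity)]
        linarith
      have h7 := abs_le.1 h3
      constructor <;> linarith [h7.1, h7.2]
  calc (bad.card : ℝ) ≤ ∑ e ∈ E, 5 * κ / R ^ 2 * (2 * r e) := hcard
    _ = 5 * κ / R ^ 2 * ∑ e ∈ E, 2 * r e := (Finset.mul_sum _ _ _).symm
    _ ≤ 5 * κ / R ^ 2 * (2 * S - -S) := by gcongr
    _ = 15 * κ * J := by rw [hS]; field_simp; ring

end NonVertLattice

lemma idet_smul_add_smul {e f : ℤ × ℤ} (h : idet e f = 1) (p q : ℤ × ℤ) :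
    idet (p.1 • e + p.2 • f) (q.1 • e + q.2 • f) = idet p q := by
  simp only [idet, Prod.fst_add, Prod.smul_fst, Prod.snd_add, Prod.smul_snd, smul_eq_mul] at *
  linear_combination (p.1 * q.2 - p.2 * q.1) * h

/-- Coordinates with respect to a basis of `ℤ²`. -/
def basisEquiv {e f : ℤ × ℤ} (h : idet e f = 1) : ℤ × ℤ ≃ ℤ × ℤ where
  toFun p := p.1 • e + p.2 • f
  invFun x := (idet x f, idet e x)
  left_inv p := by
    simp only [idet, Prod.fst_add, Prod.smul_fst, Prod.snd_add, Prod.smul_snd, smul_eq_mul] at *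
    ext
    · linear_combination p.1 * h
    · linear_combination p.2 * h
  right_inv x := (eq_idet_smul_add h x).symm

lemma norm_exp_two_pi_I_sub_le (x y : ℝ) :
    ‖Complex.exp (2 * Real.pi * Complex.I * x) - Complex.exp (2 * Real.pi * Complex.I * y)‖ ≤
      2 * Real.pi * |x - y| := by
  have h1 : Complex.exp (2 * Real.pi * Complex.I * x) - Complex.exp (2 * Real.pi * Complex.I * y) =
      Complex.exp (2 * Real.pi * Complex.I * y) *
        (Complex.exp (Complex.I * ((2 * Real.pi * (x - y) : ℝ) : ℂ)) - 1) := by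
    rw [mul_sub, ← Complex.exp_add, mul_one]
    congr 2
    push_cast
    ring
  rw [h1, norm_mul, norm_exp_two_pi_I_mul_real, one_mul]
  refine (Real.norm_exp_I_mul_ofReal_sub_one_le).trans_eq ?_
  rw [Real.norm_eq_abs, abs_mul, abs_of_pos Real.two_pi_pos]

/-- The hat function. -/
def hat (x : ℝ) : ℝ := max 0 (1 - |x|)

lemma continuous_hat : Continuous hat := by unfold hat; fun_prop

lemma hat_nonneg (x : ℝ) : 0 ≤ hat x := le_max_left _ _

lemma hat_le_one (x : ℝ) : hat x ≤ 1 := max_le zero_le_one (by linarith [abs_nonneg x])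

lemma norm_hat_le_one (x : ℝ) : ‖(hat x : ℂ)‖ ≤ 1 := by
  rw [Complex.norm_real, Real.norm_of_nonneg (hat_nonneg x)]
  exact hat_le_one x

lemma abs_le_one_of_hat_ne_zero {x : ℝ} (h : hat x ≠ 0) : |x| ≤ 1 := by
  by_contra! h1
  exact h (max_eq_left (by linarith))

lemma sum_hat {J : ℕ} (hJ : 0 < J) (x : ℝ) :
    ∑ j ∈ Finset.range J, hat (x - j) = max 0 (min 1 (min (x + 1) (J - x))) := by
  induction J, hJ using Nat.le_induction with
  | base =>
    simp only [hat, Finset.range_one, Finset.sum_singleton, Nat.cast_zero, sub_zero,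
      Nat.cast_one, max_def, min_def]
    rcases abs_cases x with ⟨h, h'⟩ | ⟨h, h'⟩ <;> rw [h] <;> split_ifs <;> linarith
  | succ J hJ ih =>
    have : (1 : ℝ) ≤ J := by exact_mod_cast hJ
    rw [Finset.sum_range_succ, ih]
    simp only [hat, Nat.cast_add, Nat.cast_one, max_def, min_def]
    rcases abs_cases (x - J) with ⟨h, h'⟩ | ⟨h, h'⟩ <;> rw [h] <;> split_ifs <;> linarith

lemma integral_hat : ∫ x, hat x = 1 := by
  have h1 : ∫ x, hat x = ∫ x in (-1 : ℝ)..1, hat x := by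
    rw [intervalIntegral.integral_of_le (by norm_num), ← integral_Icc_eq_integral_Ioc,
      setIntegral_eq_integral_of_forall_compl_eq_zero]
    intro x hx
    by_contra h
    exact hx (abs_le.1 (abs_le_one_of_hat_ne_zero h))
  rw [h1, ← intervalIntegral.integral_add_adjacent_intervals (b := 0)
    (continuous_hat.intervalIntegrable _ _) (continuous_hat.intervalIntegrable _ _)]
  have h2 : ∫ x in (-1 : ℝ)..0, hat x = ∫ x in (-1 : ℝ)..0, (1 + x) := by
    refine intervalIntegral.integral_congr fun x hx => ?_
    rw [Set.uIcc_of_le (by norm_num)] at hx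
    simp only [hat]
    rw [abs_of_nonpos hx.2, max_eq_right (by linarith [hx.1]), sub_neg_eq_add]
  have h3 : ∫ x in (0 : ℝ)..1, hat x = ∫ x in (0 : ℝ)..1, (1 - x) := by
    refine intervalIntegral.integral_congr fun x hx => ?_
    rw [Set.uIcc_of_le (by norm_num)] at hx
    simp only [hat]
    rw [abs_of_nonneg hx.1, max_eq_right (by linarith [hx.2])]
  rw [h2, h3, intervalIntegral.integral_add (by simp) (by simp),
    intervalIntegral.integral_sub (by simp) (by simp)]
  norm_num [integral_id]

/-- The test function attached to a window. -/
def windowFun (f : ℝ → ℂ) (p : ℝ × ℝ) : ℂ := f p.1 * hat (p.2 / p.1)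

section windowFun

variable {f : ℝ → ℂ} {η C : ℝ}

lemma continuous_windowFun (hf : Continuous f) (hη : 0 < η) (hfs : ∀ x, f x ≠ 0 → η ≤ x ∧ x ≤ C) :
    Continuous (windowFun f) := by
  have h1 : windowFun f = fun p : ℝ × ℝ => f p.1 * hat (p.2 / max p.1 η) := by
    funext p
    by_cases h : f p.1 = 0
    · simp [windowFun, h]
    · rw [windowFun, max_eq_left (hfs _ h).1]
  rw [h1]
  refine (hf.comp continuous_fst).mul (Complex.continuous_ofReal.comp (continuous_hat.comp ?_))
  refine continuous_snd.div (by fun_prop) fun p => ?_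
  exact (hη.trans_le (le_max_right _ _)).ne'

lemma hasCompactSupport_windowFun (hη : 0 < η)
    (hfs : ∀ x, f x ≠ 0 → η ≤ x ∧ x ≤ C) : HasCompactSupport (windowFun f) := by
  refine HasCompactSupport.intro (isCompact_Icc.prod isCompact_Icc : IsCompact
    (Set.Icc η C ×ˢ Set.Icc (-C) C)) fun p hp => ?_
  by_contra h
  have h1 : f p.1 ≠ 0 := left_ne_zero_of_mul h
  have h2 : hat (p.2 / p.1) ≠ 0 := fun h0 => h (by rw [windowFun, h0]; simp)
  obtain ⟨h3, h4⟩ := hfs _ h1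
  have h5 := abs_le_one_of_hat_ne_zero h2
  rw [abs_div, abs_of_pos (hη.trans_le h3), div_le_one (hη.trans_le h3)] at h5
  exact hp ⟨⟨h3, h4⟩, abs_le.1 (h5.trans h4)⟩

lemma integral_windowFun (hf : Continuous f) (hη : 0 < η)
    (hfs : ∀ x, f x ≠ 0 → η ≤ x ∧ x ≤ C) : ∫ p, windowFun f p = ∫ x, f x * x := by
  rw [Measure.volume_eq_prod, integral_prod _ ((continuous_windowFun hf hη
    hfs).integrable_of_hasCompactSupport (hasCompactSupport_windowFun hη hfs))]
  congr 1
  funext x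
  by_cases h : f x = 0
  · simp [windowFun, h]
  · have hx : 0 < x := hη.trans_le (hfs x h).1
    simp only [windowFun]
    rw [integral_const_mul]
    congr 1
    rw [integral_complex_ofReal, Measure.integral_comp_div, integral_hat, abs_of_pos hx]
    simp

end windowFun

namespace NonVertLattice

variable (L : NonVertLattice)

open Classical in
/-- The character `e(k u'/u)` of the horizontal coordinate `u'` of a complementary vector. -/
def latPhase (k : ℤ) (w : ℤ × ℤ) : ℂ :=
  if h : IsCoprime w.1 w.2 then
    Complex.exp (2 * Real.pi * Complex.I *
      ((k * (L.u (exists_idet_eq_one h).choose / L.u w) : ℝ) : ℂ))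
  else 0

lemma latPhase_of_not_isCoprime {k : ℤ} {w : ℤ × ℤ} (h : ¬ IsCoprime w.1 w.2) :
    L.latPhase k w = 0 := dif_neg h

lemma latPhase_eq (k : ℤ) {w x : ℤ × ℤ} (h : idet w x = 1) (hw : L.u w ≠ 0) :
    L.latPhase k w = Complex.exp (2 * Real.pi * Complex.I * ((k * (L.u x / L.u w) : ℝ) : ℂ)) := by
  have hc := isCoprime_of_idet_left h
  rw [latPhase, dif_pos hc]
  have hy := (exists_idet_eq_one hc).choose_spec
  set y := (exists_idet_eq_one hc).choose
  have h1 := eq_idet_smul_add h y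
  rw [hy, one_smul] at h1
  rw [Complex.exp_eq_exp_iff_exists_int]
  refine ⟨k * idet y x, ?_⟩
  have h2 : L.u y = idet y x * L.u w + L.u x := by
    conv_lhs => rw [h1, L.u_add, L.u_zsmul]
  have h3 : (L.u y / L.u w : ℝ) = idet y x + L.u x / L.u w := by
    rw [h2]
    field_simp
  rw [h3]
  push_cast
  ring

lemma norm_latPhase_le (k : ℤ) (w : ℤ × ℤ) : ‖L.latPhase k w‖ ≤ 1 := by
  unfold latPhase
  split_ifs
  · exact (norm_exp_two_pi_I_mul_real _).le
  · simp

lemma norm_latPhase_sub_kloPhase_le (k : ℤ) {e f w : ℤ × ℤ} (hef : idet e f = 1)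
    (hf : 0 < L.u f) (hw : IsCoprime w.1 w.2) (hu : 0 < L.u w) (hx : idet w f ≠ 0) :
    ‖L.latPhase k w - kloPhase k (idet w f) (idet e w)‖ ≤
      2 * Real.pi * (|(k : ℝ)| * (L.u f / L.u w)) := by
  obtain ⟨w', hw'⟩ := exists_idet_eq_one hw
  have hbez : idet w f * idet e w' - idet e w * idet w' f = 1 := by
    rw [← hw']
    conv_rhs => rw [eq_idet_smul_add hef w, eq_idet_smul_add hef w']
    exact (idet_smul_add_smul hef (idet w f, idet e w) (idet w' f, idet e w')).symm
  rw [L.latPhase_eq k hw' hu.ne', kloPhase_eq hx hbez]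
  have hxR : (idet w f : ℝ) ≠ 0 := by exact_mod_cast hx
  have h1 : 2 * Real.pi * Complex.I * ((k * idet w' f : ℤ) : ℂ) / (idet w f : ℂ) =
      2 * Real.pi * Complex.I * ((k * (idet w' f / idet w f) : ℝ) : ℂ) := by
    push_cast
    ring
  rw [h1]
  refine (norm_exp_two_pi_I_sub_le _ _).trans ?_
  have hu1 : L.u w = idet w f * L.u e + idet e w * L.u f := by
    conv_lhs => rw [eq_idet_smul_add hef w, L.u_add, L.u_zsmul, L.u_zsmul]
  have hu2 : L.u w' = idet w' f * L.u e + idet e w' * L.u f := by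
    conv_lhs => rw [eq_idet_smul_add hef w', L.u_add, L.u_zsmul, L.u_zsmul]
  have hbezR : (idet w f : ℝ) * idet e w' - idet e w * idet w' f = 1 := by exact_mod_cast hbez
  have h2 : L.u w' / L.u w - idet w' f / idet w f = L.u f / L.u w / idet w f := by
    rw [div_sub_div _ _ hu.ne' hxR, div_div]
    congr 1
    rw [hu1, hu2]
    linear_combination L.u f * hbezR
  rw [← mul_sub, abs_mul, h2, abs_div, abs_of_pos (div_pos hf hu)]
  have h3 : (1 : ℝ) ≤ |(idet w f : ℝ)| := by exact_mod_cast Int.one_le_abs hx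
  have := div_pos hf hu
  exact mul_le_mul_of_nonneg_left (mul_le_mul_of_nonneg_left (div_le_self this.le h3)
    (abs_nonneg _)) Real.two_pi_pos.le

lemma eq_of_idet_eq_zero_of_basis {e f w : ℤ × ℤ} (hef : idet e f = 1) (hf : 0 < L.u f)
    (hw : IsCoprime w.1 w.2) (hu : 0 < L.u w) (hx : idet w f = 0) : w = f :=
  (L.eq_of_idet_eq_zero hw (isCoprime_of_idet_right hef) hu hf hx).symm

/-- The sum over the primitive vectors whose slope lies in the window of length `2 * ℓ` around
`t`. -/
def windowSum (f : ℝ → ℂ) (k : ℤ) (ℓ t : ℝ) : ℂ :=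
  ∑' w : ℤ × ℤ, f (L.u w) * L.latPhase k w * hat ((L.slope w - t) / ℓ)

lemma exists_window_finset {C T : ℝ} (hC : 0 < C) (hT : 0 ≤ T) (p : ℝ) :
    ∃ s : Finset (ℤ × ℤ), (∀ w, w ∈ s ↔ IsCoprime w.1 w.2 ∧ 0 < L.u w ∧ L.u w ≤ C ∧
      p ≤ L.slope w ∧ L.slope w ≤ p + T) ∧ (s.card : ℝ) ≤ C ^ 2 * T + 1 := by
  have hfin : {w : ℤ × ℤ | IsCoprime w.1 w.2 ∧ 0 < L.u w ∧ L.u w ≤ C ∧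
      p ≤ L.slope w ∧ L.slope w ≤ p + T}.Finite :=
    (L.finite_setOf_slope_mem C p (p + T)).subset fun _ h => h.2
  have hmem : ∀ w, w ∈ hfin.toFinset ↔ IsCoprime w.1 w.2 ∧ 0 < L.u w ∧ L.u w ≤ C ∧
      p ≤ L.slope w ∧ L.slope w ≤ p + T := fun w => hfin.mem_toFinset
  exact ⟨hfin.toFinset, hmem, L.card_le_of_slope_mem _ hC hT fun w hw => (hmem w).1 hw⟩

variable {f : ℝ → ℂ} {η C B : ℝ}

lemma norm_windowSum_le (hη : 0 < η) (hC : 0 < C) (hfs : ∀ x, f x ≠ 0 → η ≤ x ∧ x ≤ C)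
    (hB : ∀ x, ‖f x‖ ≤ B) (k : ℤ) {ℓ : ℝ} (hℓ : 0 < ℓ) (t : ℝ) :
    (Function.support fun w : ℤ × ℤ =>
      f (L.u w) * L.latPhase k w * hat ((L.slope w - t) / ℓ)).Finite ∧
    ‖L.windowSum f k ℓ t‖ ≤ B * (C ^ 2 * (2 * ℓ) + 1) := by
  have hB0 : 0 ≤ B := (norm_nonneg _).trans (hB 0)
  obtain ⟨s, hs, hcard⟩ := L.exists_window_finset hC (by positivity : 0 ≤ 2 * ℓ) (t - ℓ)
  have hout : ∀ w ∉ s, f (L.u w) * L.latPhase k w * hat ((L.slope w - t) / ℓ) = 0 := by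
    intro w hw
    by_contra h
    refine hw ((hs w).2 ?_)
    have h1 : f (L.u w) ≠ 0 := left_ne_zero_of_mul (left_ne_zero_of_mul h)
    have h2 : IsCoprime w.1 w.2 := by
      by_contra h2
      exact h (by rw [L.latPhase_of_not_isCoprime h2]; simp)
    have h3 : hat ((L.slope w - t) / ℓ) ≠ 0 := fun h3 => h (by rw [h3]; simp)
    have h4 := abs_le_one_of_hat_ne_zero h3
    rw [abs_div, abs_of_pos hℓ, div_le_one hℓ, abs_le] at h4
    obtain ⟨h5, h6⟩ := hfs _ h1
    exact ⟨h2, by linarith, h6, by linarith [h4.1], by linarith [h4.2]⟩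
  refine ⟨s.finite_toSet.subset fun w hw => by_contra fun h => hw (hout w h), ?_⟩
  rw [windowSum, tsum_eq_sum hout]
  calc ‖∑ w ∈ s, f (L.u w) * L.latPhase k w * hat ((L.slope w - t) / ℓ)‖
      ≤ ∑ w ∈ s, B * 1 * 1 := by
        refine norm_sum_le_of_le _ fun w _ => ?_
        rw [norm_mul, norm_mul]
        exact mul_le_mul (mul_le_mul (hB _) (L.norm_latPhase_le k w) (norm_nonneg _) hB0)
          (norm_hat_le_one _) (norm_nonneg _) (by positivity)
    _ = B * s.card := by rw [Finset.sum_const, nsmul_eq_mul]; ring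
    _ ≤ _ := by gcongr

lemma norm_windowSum_sub_le (hη : 0 < η) (hC : 0 < C) (hfs : ∀ x, f x ≠ 0 → η ≤ x ∧ x ≤ C)
    (hB : ∀ x, ‖f x‖ ≤ B) (k : ℤ) {R : ℕ} (hR : 0 < R) (t : ℝ) {e e' : ℤ × ℤ}
    (he : idet e e' = 1) (hu : 0 < L.u e') (huR : L.u e' ≤ 1 / R) :
    ‖L.windowSum f k (R ^ 2) t - ∑' p : ℤ × ℤ, kloPhase k p.1 p.2 * windowFun f
      ((R * L.u e) * ((p.1 : ℝ) / R) + (R * L.u e') * ((p.2 : ℝ) / R),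
        ((L.v e - t * L.u e) / R) * ((p.1 : ℝ) / R) +
          ((L.v e' - t * L.u e') / R) * ((p.2 : ℝ) / R))‖ ≤
      B * ((C ^ 2 * (2 * R ^ 2) + 1) * (2 * Real.pi * (|(k : ℝ)| / (η * R))) + 2) := by
  have hR' : (0 : ℝ) < R := by exact_mod_cast hR
  have hB0 : 0 ≤ B := (norm_nonneg _).trans (hB 0)
  obtain ⟨s, hs, hcard⟩ := L.exists_window_finset hC (by positivity : 0 ≤ 2 * (R : ℝ) ^ 2)
    (t - R ^ 2)
  set g : ℤ × ℤ → ℂ := fun w => f (L.u w) * hat ((L.slope w - t) / (R : ℝ) ^ 2) with hg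
  have hgs : ∀ w, IsCoprime w.1 w.2 → g w ≠ 0 → w ∈ s := by
    intro w h2 h
    refine (hs w).2 ?_
    have h1 : f (L.u w) ≠ 0 := left_ne_zero_of_mul h
    have h3 : hat ((L.slope w - t) / (R : ℝ) ^ 2) ≠ 0 := fun h3 => h (by
      simp only [hg]; rw [h3]; simp)
    have h4 := abs_le_one_of_hat_ne_zero h3
    have hR2 : (0 : ℝ) < (R : ℝ) ^ 2 := by positivity
    rw [abs_div, abs_of_pos hR2, div_le_one hR2, abs_le] at h4
    obtain ⟨h5, h6⟩ := hfs _ h1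
    exact ⟨h2, by linarith, h6, by linarith [h4.1], by linarith [h4.2]⟩
  have hgB : ∀ w, ‖g w‖ ≤ B := by
    intro w
    rw [hg, norm_mul, ← mul_one B]
    exact mul_le_mul (hB _) (norm_hat_le_one _) (norm_nonneg _) hB0
  have h1 : L.windowSum f k (R ^ 2) t = ∑ w ∈ s, L.latPhase k w * g w := by
    refine (tsum_congr fun w => ?_).trans
      (tsum_eq_sum (f := fun w => L.latPhase k w * g w) fun w hw => ?_)
    · rw [hg]
      ring
    · by_cases hc : IsCoprime w.1 w.2
      · rw [not_not.1 fun h => hw (hgs w hc h), mul_zero]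
      · rw [L.latPhase_of_not_isCoprime hc, zero_mul]
  have h2 : ∀ p : ℤ × ℤ, windowFun f
      ((R * L.u e) * ((p.1 : ℝ) / R) + (R * L.u e') * ((p.2 : ℝ) / R),
        ((L.v e - t * L.u e) / R) * ((p.1 : ℝ) / R) +
          ((L.v e' - t * L.u e') / R) * ((p.2 : ℝ) / R)) = g (basisEquiv he p) := by
    intro p
    have hw1 : L.u (basisEquiv he p) = p.1 * L.u e + p.2 * L.u e' := by
      simp only [basisEquiv, Equiv.coe_fn_mk, L.u_add, L.u_zsmul]
    have hw2 : L.v (basisEquiv he p) = p.1 * L.v e + p.2 * L.v e' := by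
      simp only [basisEquiv, Equiv.coe_fn_mk, L.v_add, L.v_zsmul]
    have h3 : (R * L.u e) * ((p.1 : ℝ) / R) + (R * L.u e') * ((p.2 : ℝ) / R) =
        L.u (basisEquiv he p) := by
      rw [hw1]
      field_simp
    have h4 : ((L.v e - t * L.u e) / R) * ((p.1 : ℝ) / R) +
          ((L.v e' - t * L.u e') / R) * ((p.2 : ℝ) / R) =
        (L.v (basisEquiv he p) - t * L.u (basisEquiv he p)) / (R : ℝ) ^ 2 := by
      rw [hw1, hw2]
      field_simp
      ring
    rw [windowFun, h3, h4]
    simp only [hg]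
    by_cases hf0 : f (L.u (basisEquiv he p)) = 0
    · rw [hf0, zero_mul, zero_mul]
    · have hpos := hη.trans_le (hfs _ hf0).1
      rw [slope, div_right_comm, sub_div, mul_div_cancel_right₀ _ hpos.ne']
  have h3 : ∑' p : ℤ × ℤ, kloPhase k p.1 p.2 * windowFun f
      ((R * L.u e) * ((p.1 : ℝ) / R) + (R * L.u e') * ((p.2 : ℝ) / R),
        ((L.v e - t * L.u e) / R) * ((p.1 : ℝ) / R) +
          ((L.v e' - t * L.u e') / R) * ((p.2 : ℝ) / R)) =
      ∑ w ∈ s, kloPhase k (idet w e') (idet e w) * g w := by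
    refine Eq.trans (tsum_congr fun p => ?_) (((basisEquiv he).tsum_eq fun w =>
      kloPhase k (idet w e') (idet e w) * g w).trans (tsum_eq_sum fun w hw => ?_))
    · have h4 : (idet (basisEquiv he p) e', idet e (basisEquiv he p)) = p :=
        (basisEquiv he).symm_apply_apply p
      rw [h2, show idet (basisEquiv he p) e' = p.1 from congrArg Prod.fst h4,
        show idet e (basisEquiv he p) = p.2 from congrArg Prod.snd h4]
    · by_cases hc : IsCoprime w.1 w.2
      · rw [not_not.1 fun h => hw (hgs w hc h), mul_zero]
      · rw [kloPhase_of_gcd_ne, zero_mul]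
        intro hgcd
        obtain ⟨y1, y2, hy⟩ := exists_bezout hgcd
        have h5 := idet_smul_add_smul he (idet w e', idet e w) (y1, y2)
        rw [← eq_idet_smul_add he w] at h5
        exact hc (isCoprime_of_idet_left (h5.trans hy))
  rw [h1, h3, ← Finset.sum_sub_distrib]
  have hterm : ∀ w ∈ s, ‖L.latPhase k w * g w - kloPhase k (idet w e') (idet e w) * g w‖ ≤
      B * (2 * Real.pi * (|(k : ℝ)| / (η * R))) + if w = e' then 2 * B else 0 := by
    intro w hw
    obtain ⟨hc, hu0, -⟩ := (hs w).1 hw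
    have hnn : 0 ≤ B * (2 * Real.pi * (|(k : ℝ)| / (η * R))) := by positivity
    rw [← sub_mul, norm_mul, mul_comm]
    by_cases hx : idet w e' = 0
    · rw [if_pos (L.eq_of_idet_eq_zero_of_basis he hu hc hu0 hx)]
      have h4 : ‖L.latPhase k w - kloPhase k (idet w e') (idet e w)‖ ≤ 2 := by
        refine (norm_sub_le _ _).trans ?_
        linarith [L.norm_latPhase_le k w, norm_kloPhase_le k (idet w e') (idet e w)]
      have := mul_le_mul (hgB w) h4 (norm_nonneg _) hB0
      linarith
    · have h5 : 0 ≤ if w = e' then 2 * B else 0 := by split_ifs <;> positivity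
      refine le_add_of_le_of_nonneg ?_ h5
      by_cases hf0 : f (L.u w) = 0
      · simpa [hg, hf0] using hnn
      refine mul_le_mul (hgB w) ?_ (norm_nonneg _) hB0
      refine (L.norm_latPhase_sub_kloPhase_le k he hu hc hu0 hx).trans ?_
      have h6 : L.u e' / L.u w ≤ 1 / (η * R) := by
        rw [mul_comm, ← div_div]
        exact div_le_div₀ (by positivity) huR hη (hfs _ hf0).1
      rw [← mul_one_div |(k : ℝ)|]
      gcongr
  refine (norm_sum_le_of_le s hterm).trans ?_
  rw [Finset.sum_add_distrib, Finset.sum_const, nsmul_eq_mul, Finset.sum_ite_eq']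
  have h7 : (if e' ∈ s then 2 * B else 0) ≤ 2 * B := by split_ifs <;> linarith
  have h8 : (s.card : ℝ) * (B * (2 * Real.pi * (|(k : ℝ)| / (η * R)))) ≤
      (C ^ 2 * (2 * R ^ 2) + 1) * (B * (2 * Real.pi * (|(k : ℝ)| / (η * R)))) := by gcongr
  linarith

open Classical in
/-- The sum of `f(u) e(k u'/u)` over the primitive vectors with slope in `(0, S]`. -/
def slopeSum (f : ℝ → ℂ) (k : ℤ) (S : ℝ) : ℂ :=
  ∑' w : ℤ × ℤ, if 0 < L.slope w ∧ L.slope w ≤ S then f (L.u w) * L.latPhase k w else 0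

lemma norm_slopeSum_sub_sum_windowSum_le (hη : 0 < η) (hC : 0 < C)
    (hfs : ∀ x, f x ≠ 0 → η ≤ x ∧ x ≤ C) (hB : ∀ x, ‖f x‖ ≤ B) (k : ℤ) {ℓ S : ℝ} (hℓ : 0 < ℓ)
    {J : ℕ} (hJ : 0 < J) (hJS : S < J * ℓ) (hSJ : (J - 1) * ℓ ≤ S) :
    ‖L.slopeSum f k S - ∑ j ∈ Finset.range J, L.windowSum f k ℓ (j * ℓ)‖ ≤
      2 * (B * (C ^ 2 * ℓ + 1)) := by
  classical
  have hB0 : 0 ≤ B := (norm_nonneg _).trans (hB 0)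
  have hJ1 : (1 : ℝ) ≤ J := by exact_mod_cast hJ
  obtain ⟨s, hs, -⟩ := L.exists_window_finset hC (by positivity : 0 ≤ (J + 1) * ℓ) (-ℓ)
  obtain ⟨s₁, hs₁, hcard₁⟩ := L.exists_window_finset hC hℓ.le (-ℓ)
  obtain ⟨s₂, hs₂, hcard₂⟩ := L.exists_window_finset hC hℓ.le ((J - 1) * ℓ)
  have hmem : ∀ w : ℤ × ℤ, f (L.u w) * L.latPhase k w ≠ 0 →
      IsCoprime w.1 w.2 ∧ 0 < L.u w ∧ L.u w ≤ C := by
    intro w hw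
    have h1 := hfs _ (left_ne_zero_of_mul hw)
    refine ⟨?_, hη.trans_le h1.1, h1.2⟩
    by_contra h2
    exact hw (by rw [L.latPhase_of_not_isCoprime h2, mul_zero])
  have h1 : L.slopeSum f k S = ∑ w ∈ s, if 0 < L.slope w ∧ L.slope w ≤ S then
      f (L.u w) * L.latPhase k w else 0 := by
    refine tsum_eq_sum fun w hw => ?_
    rw [ite_eq_right_iff]
    intro h2
    by_contra h3
    obtain ⟨h4, h5, h6⟩ := hmem w h3
    exact hw ((hs w).2 ⟨h4, h5, h6, by linarith, by linarith⟩)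
  have h2 : ∀ j ∈ Finset.range J, L.windowSum f k ℓ (j * ℓ) =
      ∑ w ∈ s, f (L.u w) * L.latPhase k w * hat (L.slope w / ℓ - j) := by
    intro j hj
    have hjJ : (j : ℝ) + 1 ≤ J := by exact_mod_cast Finset.mem_range.1 hj
    have hx : ∀ w, (L.slope w - j * ℓ) / ℓ = L.slope w / ℓ - j := fun w => by
      rw [sub_div, mul_div_cancel_right₀ _ hℓ.ne']
    simp only [windowSum, hx]
    refine tsum_eq_sum fun w hw => ?_
    by_contra h3
    obtain ⟨h4, h5, h6⟩ := hmem w (left_ne_zero_of_mul h3)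
    have h7 : hat (L.slope w / ℓ - j) ≠ 0 := fun h7 => h3 (by rw [h7]; simp)
    have h8 := abs_le.1 (abs_le_one_of_hat_ne_zero h7)
    have hj0 : (0 : ℝ) ≤ j := j.cast_nonneg
    refine hw ((hs w).2 ⟨h4, h5, h6, ?_, ?_⟩)
    · have : -1 ≤ L.slope w / ℓ := by linarith [h8.1]
      rw [le_div_iff₀ hℓ] at this
      linarith
    · have : L.slope w / ℓ ≤ J := by linarith [h8.2]
      rw [div_le_iff₀ hℓ] at this
      linarith
  rw [h1, Finset.sum_congr rfl h2, Finset.sum_comm, ← Finset.sum_sub_distrib]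
  have hterm : ∀ w ∈ s, ‖(if 0 < L.slope w ∧ L.slope w ≤ S then f (L.u w) * L.latPhase k w else 0) -
      ∑ j ∈ Finset.range J, f (L.u w) * L.latPhase k w * hat (L.slope w / ℓ - j)‖ ≤
      (if w ∈ s₁ then B else 0) + if w ∈ s₂ then B else 0 := by
    intro w hw
    rw [← Finset.mul_sum, ← Complex.ofReal_sum, sum_hat hJ]
    set Ψ := max 0 (min 1 (min (L.slope w / ℓ + 1) (J - L.slope w / ℓ))) with hΨ
    have hΨ0 : 0 ≤ Ψ := le_max_left _ _
    have hΨ1 : Ψ ≤ 1 := max_le zero_le_one (min_le_left _ _)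
    obtain ⟨hc, hu, huC, hp, hp'⟩ := (hs w).1 hw
    have hF : ‖f (L.u w) * L.latPhase k w‖ ≤ B := by
      rw [norm_mul, ← mul_one B]
      exact mul_le_mul (hB _) (L.norm_latPhase_le k w) (norm_nonneg _) hB0
    have n1 : 0 ≤ if w ∈ s₁ then B else 0 := by split_ifs <;> linarith
    have n2 : 0 ≤ if w ∈ s₂ then B else 0 := by split_ifs <;> linarith
    have hle : ∀ c : ℝ, 0 ≤ c → c ≤ 1 → ‖f (L.u w) * L.latPhase k w * (c : ℂ)‖ ≤ B := by
      intro c h0 h1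
      rw [norm_mul, Complex.norm_real, Real.norm_of_nonneg h0]
      exact (mul_le_of_le_one_right (norm_nonneg _) h1).trans hF
    have hdiff : ‖(if 0 < L.slope w ∧ L.slope w ≤ S then f (L.u w) * L.latPhase k w else 0) -
        f (L.u w) * L.latPhase k w * (Ψ : ℂ)‖ ≤ B := by
      split_ifs
      · have := hle (1 - Ψ) (by linarith) (by linarith)
        push_cast at this
        rwa [mul_sub, mul_one] at this
      · rw [zero_sub, norm_neg]
        exact hle Ψ hΨ0 hΨ1
    by_cases m1 : L.slope w ≤ 0
    · rw [if_pos ((hs₁ w).2 ⟨hc, hu, huC, hp, by linarith⟩)]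
      linarith
    by_cases m2 : (J - 1) * ℓ ≤ L.slope w
    · rw [if_pos ((hs₂ w).2 ⟨hc, hu, huC, m2, by linarith⟩)]
      linarith
    push Not at m1 m2
    have h9 : L.slope w / ℓ ≤ J - 1 := by
      rw [div_le_iff₀ hℓ]
      exact m2.le
    have h10 : 0 < L.slope w / ℓ := div_pos m1 hℓ
    have hΨ' : Ψ = 1 := by
      rw [hΨ, min_eq_left (le_min (by linarith) (by linarith)), max_eq_right zero_le_one]
    rw [if_pos ⟨m1, by linarith⟩, hΨ']
    simp only [Complex.ofReal_one, mul_one, sub_self, norm_zero]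
    linarith
  refine (norm_sum_le_of_le s hterm).trans ?_
  rw [Finset.sum_add_distrib, Finset.sum_ite_mem, Finset.sum_ite_mem, Finset.sum_const,
    Finset.sum_const, nsmul_eq_mul, nsmul_eq_mul]
  have c1 : ((s ∩ s₁).card : ℝ) ≤ s₁.card := by
    exact_mod_cast Finset.card_le_card Finset.inter_subset_right
  have c2 : ((s ∩ s₂).card : ℝ) ≤ s₂.card := by
    exact_mod_cast Finset.card_le_card Finset.inter_subset_right
  have d1 := mul_le_mul_of_nonneg_right (c1.trans hcard₁) hB0
  have d2 := mul_le_mul_of_nonneg_right (c2.trans hcard₂) hB0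
  linarith

/-- The window sum is close to its expected value if the lattice has a balanced basis at the scale
of the window. -/
lemma exists_norm_windowSum_sub_le (hf : Continuous f) (hη : 0 < η) (hC : 0 < C)
    (hfs : ∀ x, f x ≠ 0 → η ≤ x ∧ x ≤ C) (hB : ∀ x, ‖f x‖ ≤ B) (k : ℤ) {κ ε : ℝ} (hκ : 0 < κ)
    (hκ' : κ ≤ 1 / 4) (hε : 0 < ε) :
    ∃ R : ℕ, 0 < R ∧ ∀ t : ℝ, (¬ ∃ e, L.IsCusp κ R t e) →
      ‖L.windowSum f k (R ^ 2) t - (R : ℂ) ^ 2 * (phaseDensity k * ∫ x, f x * x)‖ ≤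
        ε * R ^ 2 := by
  have hB0 : 0 ≤ B := (norm_nonneg _).trans (hB 0)
  set K := B * ((C ^ 2 * 2 + 1) * (2 * Real.pi * (|(k : ℝ)| / η)) + 2) with hK
  obtain ⟨R₀, hR₀⟩ := exists_nat_ge (K / (ε / 2))
  obtain ⟨R, hRR₀, hR, hmain⟩ := exists_uniform_tsum_approx (norm_kloPhase_le k)
    (tendsto_cell_phase k) (continuous_windowFun hf hη hfs) (hasCompactSupport_windowFun hη hfs)
    (C := 1 / κ) (by positivity) (half_pos hε) R₀
  have hR' : (0 : ℝ) < R := by exact_mod_cast hR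
  have hR1 : (1 : ℝ) ≤ R := by exact_mod_cast hR
  refine ⟨R, hR, fun t ht => ?_⟩
  obtain ⟨e, e', he, hu, hκu, huR, hu', hκu', huR', hlt, hlt'⟩ := exists_balanced_basis hκ' hR ht
  have hdet : L.u e * L.v e' - L.v e * L.u e' = 1 := by rw [L.u_mul_v_sub, he, Int.cast_one]
  have h1κ : 1 ≤ 1 / κ := by rw [le_div_iff₀ hκ]; linarith
  have hent : ∀ w, 0 < L.u w → L.u w ≤ 1 / R → |R * L.u w| ≤ 1 / κ := by
    intro w h1 h2
    rw [abs_of_pos (by positivity)]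
    rw [le_div_iff₀ hR'] at h2
    linarith
  have hsub := L.slope_sub hu hu'
  rw [he, Int.cast_one] at hsub
  have hent' : ∀ w w', 0 < L.u w → 0 < L.u w' → κ / R ≤ L.u w' →
      |L.slope w - t| ≤ 1 / (L.u w * L.u w') → |(L.v w - t * L.u w) / R| ≤ 1 / κ := by
    intro w w' h1 h1' h2 h3
    rw [L.v_eq_slope_mul h1, ← sub_mul, abs_div, abs_mul, abs_of_pos h1, abs_of_pos hR']
    rw [div_le_iff₀ hR'] at h2
    calc |L.slope w - t| * L.u w / R ≤ 1 / (L.u w * L.u w') * L.u w / R := by gcongr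
      _ = 1 / (L.u w' * R) := by field_simp
      _ ≤ 1 / κ := by gcongr
  have h1 := hmain (R * L.u e) (R * L.u e') ((L.v e - t * L.u e) / R)
    ((L.v e' - t * L.u e') / R) (by field_simp; linarith) (hent e hu huR) (hent e' hu' huR')
    (hent' e e' hu hu' hκu' (by rw [abs_of_nonpos (by linarith)]; linarith))
    (hent' e' e hu' hu hκu (by rw [abs_of_pos (by linarith), mul_comm]; linarith))
  have h2 := L.norm_windowSum_sub_le hη hC hfs hB k hR t he hu' huR'
  rw [integral_windowFun hf hη hfs] at h1
  set T := ∑' p : ℤ × ℤ, kloPhase k p.1 p.2 * windowFun f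
      ((R * L.u e) * ((p.1 : ℝ) / R) + (R * L.u e') * ((p.2 : ℝ) / R),
        ((L.v e - t * L.u e) / R) * ((p.1 : ℝ) / R) +
          ((L.v e' - t * L.u e') / R) * ((p.2 : ℝ) / R))
  have hRC : (R : ℂ) ≠ 0 := by exact_mod_cast hR.ne'
  have h3 : ‖T - (R : ℂ) ^ 2 * (phaseDensity k * ∫ x, f x * x)‖ ≤ ε / 2 * R ^ 2 := by
    have h4 : T - (R : ℂ) ^ 2 * (phaseDensity k * ∫ x, f x * x) =
        (T / (R : ℂ) ^ 2 - phaseDensity k * ∫ x, f x * x) * (R : ℂ) ^ 2 := by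
      field_simp
    rw [h4, norm_mul, norm_pow, Complex.norm_natCast]
    gcongr
  have h5 : B * ((C ^ 2 * (2 * R ^ 2) + 1) * (2 * Real.pi * (|(k : ℝ)| / (η * R))) + 2) ≤
      ε / 2 * R ^ 2 := by
    have hKR : K ≤ ε / 2 * R := by
      rw [div_le_iff₀ (half_pos hε)] at hR₀
      have : (R₀ : ℝ) ≤ R := by exact_mod_cast hRR₀
      nlinarith
    have h6 : (C ^ 2 * (2 * (R : ℝ) ^ 2) + 1) * (2 * Real.pi * (|(k : ℝ)| / (η * R))) + 2 ≤
        ((C ^ 2 * 2 + 1) * (2 * Real.pi * (|(k : ℝ)| / η)) + 2) * R := by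
      calc (C ^ 2 * (2 * (R : ℝ) ^ 2) + 1) * (2 * Real.pi * (|(k : ℝ)| / (η * R))) + 2
          ≤ (C ^ 2 * (2 * (R : ℝ) ^ 2) + 1 * (R : ℝ) ^ 2) *
              (2 * Real.pi * (|(k : ℝ)| / (η * R))) + 2 * R := by
            have : (1 : ℝ) ≤ 1 * (R : ℝ) ^ 2 := by rw [one_mul]; exact one_le_pow₀ hR1
            gcongr
            linarith
        _ = _ := by field_simp
    calc _ ≤ B * (((C ^ 2 * 2 + 1) * (2 * Real.pi * (|(k : ℝ)| / η)) + 2) * R) := by gcongr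
      _ = K * R := by rw [hK]; ring
      _ ≤ ε / 2 * R * R := by gcongr
      _ = _ := by ring
  calc _ ≤ ‖L.windowSum f k (R ^ 2) t - T‖ +
        ‖T - (R : ℂ) ^ 2 * (phaseDensity k * ∫ x, f x * x)‖ :=
          norm_sub_le_norm_sub_add_norm_sub _ _ _
    _ ≤ ε / 2 * R ^ 2 + ε / 2 * R ^ 2 := add_le_add (h2.trans h5) h3
    _ = _ := by ring

/-- Equidistribution of `u'/u` modulo one, tested against characters. -/
lemma tendsto_slopeSum_div (hf : Continuous f) (hη : 0 < η) (hC : 0 < C)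
    (hfs : ∀ x, f x ≠ 0 → η ≤ x ∧ x ≤ C) (k : ℤ) :
    Tendsto (fun S : ℝ => L.slopeSum f k S / S) atTop (𝓝 (phaseDensity k * ∫ x, f x * x)) := by
  classical
  have hcs : HasCompactSupport f := HasCompactSupport.intro (isCompact_Icc (a := η) (b := C))
    fun x hx => not_not.1 fun h => hx (hfs x h)
  obtain ⟨B, hB⟩ := hcs.exists_bound_of_continuous hf
  have hB0 : 0 ≤ B := (norm_nonneg _).trans (hB 0)
  set I : ℂ := phaseDensity k * ∫ x, f x * x with hI
  set K := B * (C ^ 2 * 2 + 1) + ‖I‖ + 1 with hK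
  have hK0 : 0 < K := by positivity
  rw [Metric.tendsto_atTop']
  intro ε hε
  set κ := min (1 / 4) (ε / (120 * K)) with hκ
  have hκ0 : 0 < κ := by positivity
  obtain ⟨R, hR, hwin⟩ := L.exists_norm_windowSum_sub_le hf hη hC hfs hB k hκ0 (min_le_left _ _)
    (by positivity : 0 < ε / 16)
  have hR' : (0 : ℝ) < R := by exact_mod_cast hR
  have hR1 : (1 : ℝ) ≤ R := by exact_mod_cast hR
  set ℓ : ℝ := (R : ℝ) ^ 2 with hℓ
  have hℓ1 : 1 ≤ ℓ := one_le_pow₀ hR1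
  have hℓ0 : 0 < ℓ := by linarith
  have hJlim : Tendsto (fun S : ℝ => ⌊S / ℓ⌋₊ + 1) atTop atTop :=
    (tendsto_add_atTop_nat 1).comp
      (tendsto_nat_floor_atTop.comp (tendsto_id.atTop_div_const hℓ0))
  set E := 2 * (B * (C ^ 2 * ℓ + 1)) + ℓ * ‖I‖ with hE
  have hev := (hJlim.eventually
    (L.eventually_card_isCusp_le hκ0 (min_le_left _ _) hR)).and
    ((eventually_ge_atTop ℓ).and (eventually_ge_atTop (E / (ε / 4))))
  obtain ⟨S₀, hS₀⟩ := (eventually_atTop.1 hev)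
  refine ⟨S₀, fun S hS => ?_⟩
  obtain ⟨hbad, hSℓ, hSE⟩ := hS₀ S hS.le
  have hS0 : 0 < S := by linarith
  set J := ⌊S / ℓ⌋₊ + 1 with hJ
  have hJ1 : S < J * ℓ := by
    have := Nat.lt_floor_add_one (S / ℓ)
    rw [div_lt_iff₀ hℓ0] at this
    rw [hJ]
    push_cast
    exact this
  have hJ2 : ((J : ℝ) - 1) * ℓ ≤ S := by
    have := Nat.floor_le (div_nonneg hS0.le hℓ0.le)
    rw [le_div_iff₀ hℓ0] at this
    rw [hJ]
    push_cast
    linarith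
  have h1 := L.norm_slopeSum_sub_sum_windowSum_le hη hC hfs hB k hℓ0
    (Nat.succ_pos _ : 0 < J) hJ1 hJ2
  have h2 : ‖∑ j ∈ Finset.range J, L.windowSum f k ℓ (j * ℓ) - (J * ℓ : ℝ) * I‖ ≤
      J * ℓ * (ε / 16 + 15 * κ * K) := by
    have h3 : ∀ j ∈ Finset.range J, ‖L.windowSum f k ℓ (j * ℓ) - (ℓ : ℂ) * I‖ ≤
        ε / 16 * ℓ + if ∃ e, L.IsCusp κ R (j * R ^ 2) e then K * ℓ else 0 := by
      intro j _
      split_ifs with hc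
      · have h4 := (L.norm_windowSum_le hη hC hfs hB k hℓ0 (j * ℓ)).2
        have h5 : ‖(ℓ : ℂ) * I‖ = ℓ * ‖I‖ := by
          rw [norm_mul, Complex.norm_real, Real.norm_of_nonneg hℓ0.le]
        have h6 : B * 1 ≤ B * ℓ := by gcongr
        have h7 : 0 < ε / 16 * ℓ := by positivity
        refine (norm_sub_le _ _).trans ?_
        rw [h5, hK]
        linarith
      · have h4 := hwin _ hc
        rw [add_zero]
        simpa [hℓ] using h4
    have h4 : ∑ j ∈ Finset.range J, L.windowSum f k ℓ (j * ℓ) - (J * ℓ : ℝ) * I =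
        ∑ j ∈ Finset.range J, (L.windowSum f k ℓ (j * ℓ) - (ℓ : ℂ) * I) := by
      rw [Finset.sum_sub_distrib, Finset.sum_const, Finset.card_range, nsmul_eq_mul]
      push_cast
      ring
    rw [h4]
    refine (norm_sum_le_of_le _ h3).trans ?_
    rw [Finset.sum_add_distrib, ← Finset.sum_filter, Finset.sum_const, Finset.sum_const,
      Finset.card_range, nsmul_eq_mul, nsmul_eq_mul]
    have h5 := mul_le_mul_of_nonneg_right hbad (by positivity : 0 ≤ K * ℓ)
    linarith
  have h3 : ‖((J * ℓ : ℝ) : ℂ) * I - S * I‖ ≤ ℓ * ‖I‖ := by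
    rw [← sub_mul, norm_mul, ← Complex.ofReal_sub, Complex.norm_real,
      Real.norm_of_nonneg (by linarith)]
    gcongr
    linarith
  have hκK : 15 * κ * K ≤ ε / 8 := by
    have : κ * (120 * K) ≤ ε := by
      rw [← le_div_iff₀ (by positivity)]
      exact min_le_right _ _
    linarith
  have h4 : ‖L.slopeSum f k S - S * I‖ < ε * S := by
    rw [div_le_iff₀ (by positivity)] at hSE
    have h5 : J * ℓ * (ε / 16 + 15 * κ * K) ≤ (2 * S) * (ε / 16 + ε / 8) := by
      refine mul_le_mul ?_ ?_ (by positivity) (by positivity) <;> linarith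
    have h6 := norm_sub_le_norm_sub_add_norm_sub (L.slopeSum f k S)
      (∑ j ∈ Finset.range J, L.windowSum f k ℓ (j * ℓ)) (S * I)
    have h7 := norm_sub_le_norm_sub_add_norm_sub
      (∑ j ∈ Finset.range J, L.windowSum f k ℓ (j * ℓ)) ((J * ℓ : ℝ) * I) (S * I)
    have h8 : 0 < ε * S := by positivity
    linarith
  have hSC : (S : ℂ) ≠ 0 := by exact_mod_cast hS0.ne'
  rw [dist_eq_norm, show L.slopeSum f k S / S - I = (L.slopeSum f k S - S * I) / S by field_simp,
    norm_div, Complex.norm_real, Real.norm_of_nonneg hS0.le, div_lt_iff₀ hS0]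
  exact h4

end NonVertLattice

/-- The point of the two-dimensional torus represented by a pair of reals. -/
def torusPt (p : ℝ × ℝ) : UnitAddTorus (Fin 2) := ![(p.1 : UnitAddCircle), (p.2 : UnitAddCircle)]

lemma continuous_torusPt : Continuous torusPt := by
  refine continuous_pi fun i => ?_
  fin_cases i
  · exact (AddCircle.continuous_mk' 1).comp continuous_fst
  · exact (AddCircle.continuous_mk' 1).comp continuous_snd

lemma mFourier_torusPt (n : Fin 2 → ℤ) (p : ℝ × ℝ) : UnitAddTorus.mFourier n (torusPt p) =
    Complex.exp (2 * Real.pi * Complex.I * ((n 0 * p.1 : ℝ) : ℂ)) *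
      Complex.exp (2 * Real.pi * Complex.I * ((n 1 * p.2 : ℝ) : ℂ)) := by
  simp only [UnitAddTorus.mFourier, torusPt, ContinuousMap.coe_mk, Fin.prod_univ_two]
  simp only [Matrix.cons_val_zero, Matrix.cons_val_one, fourier_coe_apply]
  congr 2 <;> push_cast <;> ring

/-- A continuous biperiodic function descends to the torus. -/
lemma exists_continuousMap_torusPt {P : ℝ × ℝ → ℂ} (hP : Continuous P)
    (hper : ∀ p q, torusPt p = torusPt q → P p = P q) :
    ∃ g : C(UnitAddTorus (Fin 2), ℂ), ∀ p, g (torusPt p) = P p := by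
  have hq : IsOpenQuotientMap fun (x : Fin 2 → ℝ) (i : Fin 2) => (x i : UnitAddCircle) :=
    IsOpenQuotientMap.piMap fun _ => QuotientAddGroup.isOpenQuotientMap_mk
  have hvec : ∀ p : ℝ × ℝ, (fun i : Fin 2 => ((![p.1, p.2] i : ℝ) : UnitAddCircle)) =
      torusPt p := by
    intro p
    funext i
    fin_cases i <;> rfl
  have hpt : ∀ x : Fin 2 → ℝ, (fun i => (x i : UnitAddCircle)) = torusPt (x 0, x 1) := by
    intro x
    funext i
    fin_cases i <;> rfl
  let F : C(Fin 2 → ℝ, UnitAddTorus (Fin 2)) := ⟨_, hq.continuous⟩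
  let G : C(Fin 2 → ℝ, ℂ) := ⟨fun x => P (x 0, x 1), by fun_prop⟩
  have hF : IsQuotientMap F := hq.isQuotientMap
  have hfac : Function.FactorsThrough G F := fun x y hxy => hper _ _ <| by
    rw [← hpt, ← hpt]
    exact hxy
  refine ⟨hF.lift G hfac, fun p => ?_⟩
  rw [← hvec p]
  exact DFunLike.congr_fun (hF.lift_comp G hfac) ![p.1, p.2]

/-- The measure `du dt` on the strip `t ∈ (0, 1]`. -/
def stripMeasure : Measure (ℝ × ℝ) :=
  (volume : Measure ℝ).prod ((volume : Measure ℝ).restrict (Set.Ioc 0 1))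

lemma integral_exp_two_pi_I_int_mul (n : ℤ) :
    ∫ t in Set.Ioc (0 : ℝ) 1, Complex.exp (2 * Real.pi * Complex.I * ((n * t : ℝ) : ℂ)) =
      if n = 0 then 1 else 0 := by
  split_ifs with h
  · simp [h]
  · have hc : (2 * Real.pi * Complex.I * n : ℂ) ≠ 0 := by
      simp [h, Real.pi_ne_zero]
    rw [← intervalIntegral.integral_of_le zero_le_one]
    have := integral_exp_mul_complex (a := 0) (b := 1) hc
    simp only [Complex.ofReal_one, mul_one, Complex.ofReal_zero, mul_zero, Complex.exp_zero] at this
    rw [show (2 * Real.pi * Complex.I * n : ℂ) = n * (2 * Real.pi * Complex.I) by ring,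
      Complex.exp_int_mul_two_pi_mul_I, sub_self, zero_div] at this
    rw [← this]
    refine intervalIntegral.integral_congr fun t _ => ?_
    push_cast
    congr 1
    ring

lemma integral_mul_mFourier (φ : ℝ → ℂ) (n : Fin 2 → ℤ) :
    ∫ p, φ p.1 * UnitAddTorus.mFourier n (torusPt p) ∂stripMeasure =
      if n 1 = 0 then
        ∫ u, φ u * Complex.exp (2 * Real.pi * Complex.I * ((n 0 * u : ℝ) : ℂ)) else 0 := by
  simp only [mFourier_torusPt, ← mul_assoc (φ _)]
  rw [stripMeasure, integral_prod_mul
    (fun u : ℝ => φ u * Complex.exp (2 * Real.pi * Complex.I * ((n 0 * u : ℝ) : ℂ)))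
    (fun t : ℝ => Complex.exp (2 * Real.pi * Complex.I * ((n 1 * t : ℝ) : ℂ))),
    integral_exp_two_pi_I_int_mul]
  split_ifs <;> simp

lemma integrable_mul_torus {φ : ℝ → ℂ} (hφ : Integrable φ) (g : C(UnitAddTorus (Fin 2), ℂ)) :
    Integrable (fun p => φ p.1 * g (torusPt p)) stripMeasure :=
  (hφ.comp_fst _).mul_bdd (g.continuous.comp continuous_torusPt).aestronglyMeasurable
    (ae_of_all _ fun _ => g.norm_coe_le_norm _)

lemma norm_integral_mul_torus_le {φ : ℝ → ℂ} (hφ : Integrable φ)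
    (g : C(UnitAddTorus (Fin 2), ℂ)) :
    ‖∫ p, φ p.1 * g (torusPt p) ∂stripMeasure‖ ≤ (∫ p, ‖φ p.1‖ ∂stripMeasure) * ‖g‖ := by
  rw [← integral_mul_const]
  refine norm_integral_le_of_norm_le ((hφ.comp_fst _).norm.mul_const _) (ae_of_all _ fun p => ?_)
  rw [norm_mul]
  gcongr
  exact g.norm_coe_le_norm _

namespace NonVertLattice

variable (L : NonVertLattice)

/-- The primitive vectors with `0 < u ≤ 1` and slope in `(0, S]`. -/
def stripFinset (S : ℝ) : Finset (ℤ × ℤ) :=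
  ((L.finite_setOf_slope_mem 1 0 S).subset (t := {w : ℤ × ℤ | IsCoprime w.1 w.2 ∧ 0 < L.u w ∧
    L.u w ≤ 1 ∧ 0 < L.slope w ∧ L.slope w ≤ S})
    fun _ h => ⟨h.2.1, h.2.2.1, h.2.2.2.1.le, h.2.2.2.2⟩).toFinset

variable {L} in
lemma mem_stripFinset {S : ℝ} {w : ℤ × ℤ} : w ∈ L.stripFinset S ↔ IsCoprime w.1 w.2 ∧ 0 < L.u w ∧
    L.u w ≤ 1 ∧ 0 < L.slope w ∧ L.slope w ≤ S :=
  Set.Finite.mem_toFinset _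

lemma card_stripFinset_le {S : ℝ} (hS : 0 ≤ S) : ((L.stripFinset S).card : ℝ) ≤ S + 1 := by
  have := L.card_le_of_slope_mem (L.stripFinset S) one_pos hS (p := 0) fun w hw => by
    obtain ⟨h1, h2, h3, h4, h5⟩ := mem_stripFinset.1 hw
    exact ⟨h1, h2, h3, h4.le, by linarith⟩
  simpa using this

lemma exists_next' (w : ℤ × ℤ) : ∃ x, IsCoprime w.1 w.2 → 0 < L.u w →
    idet w x = 1 ∧ 1 - L.u w < L.u x ∧ L.u x ≤ 1 := by
  by_cases h : IsCoprime w.1 w.2 ∧ 0 < L.u w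
  · obtain ⟨x, hx⟩ := L.exists_next h.1 (ρ := 1) h.2
    exact ⟨x, fun _ _ => hx⟩
  · exact ⟨0, fun h1 h2 => (h ⟨h1, h2⟩).elim⟩

/-- The vector following `w` in the strip `0 < u ≤ 1` in order of slope. -/
def next (w : ℤ × ℤ) : ℤ × ℤ := (L.exists_next' w).choose

variable {L} in
lemma idet_next {w : ℤ × ℤ} (h : IsCoprime w.1 w.2) (hu : 0 < L.u w) : idet w (L.next w) = 1 :=
  ((L.exists_next' w).choose_spec h hu).1

variable {L} in
lemma u_next {w : ℤ × ℤ} (h : IsCoprime w.1 w.2) (hu : 0 < L.u w) :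
    1 - L.u w < L.u (L.next w) ∧ L.u (L.next w) ≤ 1 :=
  ((L.exists_next' w).choose_spec h hu).2

/-- The sum of `χ(u) g(u, (1 - u')/u)` over the primitive vectors of the strip. -/
def torusSum (χ : ℝ → ℂ) (S : ℝ) (g : C(UnitAddTorus (Fin 2), ℂ)) : ℂ :=
  ∑ w ∈ L.stripFinset S, χ (L.u w) * g (torusPt (L.u w, (1 - L.u (L.next w)) / L.u w))

lemma norm_torusSum_le {χ : ℝ → ℂ} {B : ℝ} (hB : ∀ x, ‖χ x‖ ≤ B) {S : ℝ} (hS : 0 ≤ S)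
    (g : C(UnitAddTorus (Fin 2), ℂ)) : ‖L.torusSum χ S g‖ ≤ (S + 1) * (B * ‖g‖) := by
  have hB0 : 0 ≤ B := (norm_nonneg _).trans (hB 0)
  refine (norm_sum_le_of_le _ fun w _ => ?_).trans (?_ : ∑ w ∈ L.stripFinset S, B * ‖g‖ ≤ _)
  · rw [norm_mul]
    exact mul_le_mul (hB _) (g.norm_coe_le_norm _) (norm_nonneg _) hB0
  · rw [Finset.sum_const, nsmul_eq_mul]
    exact mul_le_mul_of_nonneg_right (L.card_stripFinset_le hS) (by positivity)

lemma torusSum_mFourier {χ : ℝ → ℂ} {η : ℝ} (hη : 0 < η)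
    (hs : ∀ x, χ x ≠ 0 → η ≤ x ∧ x ≤ 1) (S : ℝ) (n : Fin 2 → ℤ) :
    L.torusSum χ S (UnitAddTorus.mFourier n) =
      L.slopeSum (fun u => χ u * Complex.exp (2 * Real.pi * Complex.I * ((n 0 * u : ℝ) : ℂ)) *
        Complex.exp (2 * Real.pi * Complex.I * ((n 1 * (1 / max u η) : ℝ) : ℂ))) (-n 1) S := by
  classical
  symm
  rw [slopeSum, torusSum]
  refine (tsum_eq_sum (s := L.stripFinset S) fun w hw => ?_).trans (Finset.sum_congr rfl ?_)
  · rw [ite_eq_right_iff]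
    intro h
    by_contra h0
    have h1 := left_ne_zero_of_mul (left_ne_zero_of_mul (left_ne_zero_of_mul h0))
    have h2 := hs _ h1
    refine hw (mem_stripFinset.2 ⟨?_, hη.trans_le h2.1, h2.2, h⟩)
    by_contra h3
    exact h0 (by rw [L.latPhase_of_not_isCoprime h3, mul_zero])
  · intro w hw
    obtain ⟨h1, h2, h3, h4, h5⟩ := mem_stripFinset.1 hw
    rw [if_pos ⟨h4, h5⟩, mFourier_torusPt, L.latPhase_eq _ (idet_next h1 h2) h2.ne']
    by_cases hχ : χ (L.u w) = 0
    · simp [hχ]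
    rw [max_eq_left (hs _ hχ).1, mul_assoc, mul_assoc, mul_assoc, ← Complex.exp_add,
      ← Complex.exp_add, ← Complex.exp_add]
    congr 2
    push_cast
    have : (L.u w : ℂ) ≠ 0 := by exact_mod_cast h2.ne'
    field_simp
    ring

/-- Joint equidistribution of `(u, (1 - u')/u)` against functions on the torus. -/
theorem tendsto_torusSum_div {χ : ℝ → ℂ} (hχ : Continuous χ) {η : ℝ} (hη : 0 < η)
    (hs : ∀ x, χ x ≠ 0 → η ≤ x ∧ x ≤ 1) (g : C(UnitAddTorus (Fin 2), ℂ)) :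
    Tendsto (fun S : ℝ => L.torusSum χ S g / S) atTop
      (𝓝 (coprimeDensity * ∫ p, χ p.1 * p.1 * g (torusPt p) ∂stripMeasure)) := by
  have hsupp : HasCompactSupport χ := HasCompactSupport.intro (isCompact_Icc (a := η) (b := 1))
    fun x hx => by
      by_contra h
      exact hx (hs x h)
  obtain ⟨B, hB⟩ := hsupp.exists_bound_of_continuous hχ
  have hB0 : 0 ≤ B := (norm_nonneg _).trans (hB 0)
  have hφ : Integrable fun u : ℝ => χ u * u :=
    (hχ.mul Complex.continuous_ofReal).integrable_of_hasCompactSupport hsupp.mul_right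
  set K := ∫ p, ‖χ p.1 * p.1‖ ∂stripMeasure with hK
  have hK0 : 0 ≤ K := integral_nonneg fun _ => norm_nonneg _
  have hmono : ∀ n : Fin 2 → ℤ, Tendsto
      (fun S : ℝ => L.torusSum χ S (UnitAddTorus.mFourier n) / S) atTop
      (𝓝 (coprimeDensity * ∫ p, χ p.1 * p.1 * UnitAddTorus.mFourier n (torusPt p)
        ∂stripMeasure)) := by
    intro n
    simp only [L.torusSum_mFourier hη hs]
    have hmax : ∀ x : ℝ, max x η ≠ 0 := fun x => (hη.trans_le (le_max_right _ _)).ne'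
    convert L.tendsto_slopeSum_div (C := 1) (η := η) ?_ hη one_pos ?_ (-n 1) using 2
    · rw [integral_mul_mFourier (fun u => χ u * u), phaseDensity]
      by_cases h0 : n 1 = 0
      · simp only [h0, neg_zero, if_true]
        congr 1
        refine integral_congr_ae (ae_of_all _ fun u => ?_)
        simp
        ring
      · simp [h0]
    · fun_prop (disch := exact hmax _)
    · intro x hx
      exact hs x (left_ne_zero_of_mul (left_ne_zero_of_mul hx))
  have hspan : ∀ h ∈ Submodule.span ℂ (Set.range (UnitAddTorus.mFourier (d := Fin 2))), Tendsto
      (fun S : ℝ => L.torusSum χ S h / S) atTop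
      (𝓝 (coprimeDensity * ∫ p, χ p.1 * p.1 * h (torusPt p) ∂stripMeasure)) := by
    intro h hh
    induction hh using Submodule.span_induction with
    | mem x hx =>
      obtain ⟨n, rfl⟩ := hx
      exact hmono n
    | zero => simp [torusSum]
    | add x y _ _ hx hy =>
      have h1 := hx.add hy
      rw [← mul_add, ← integral_add (integrable_mul_torus hφ x) (integrable_mul_torus hφ y)] at h1
      simp only [torusSum, ContinuousMap.add_apply, mul_add, Finset.sum_add_distrib,
        add_div] at h1 ⊢
      exact h1
    | smul c x _ hx =>
      have h1 := hx.const_mul c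
      rw [mul_left_comm, ← integral_const_mul] at h1
      simp only [torusSum, ContinuousMap.smul_apply, smul_eq_mul, mul_left_comm _ c,
        ← Finset.mul_sum, mul_div_assoc] at h1 ⊢
      exact h1
  rw [Metric.tendsto_atTop]
  intro ε hε
  have hc := coprimeDensity_pos
  set D := 2 * B + coprimeDensity * K + 1 with hD
  have hD0 : 0 < D := by positivity
  have hg : g ∈ (Submodule.span ℂ
      (Set.range (UnitAddTorus.mFourier (d := Fin 2)))).topologicalClosure := by
    rw [UnitAddTorus.span_mFourier_closure_eq_top]
    trivial
  obtain ⟨h, hh, hgh⟩ := Metric.mem_closure_iff.1 hg (ε / (2 * D)) (by positivity)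
  rw [dist_eq_norm] at hgh
  obtain ⟨S₀, hS₀⟩ := Metric.tendsto_atTop.1 (hspan h hh) (ε / 2) (by positivity)
  refine ⟨max S₀ 1, fun S hS => ?_⟩
  have hS1 : 1 ≤ S := (le_max_right _ _).trans hS
  have hS0 : 0 < S := by linarith
  have h1 := hS₀ S ((le_max_left _ _).trans hS)
  rw [dist_eq_norm] at h1 ⊢
  have h2 : L.torusSum χ S g = L.torusSum χ S h + L.torusSum χ S (g - h) := by
    simp [torusSum, ContinuousMap.sub_apply, mul_sub]
  have h3 : ∫ p, χ p.1 * p.1 * g (torusPt p) ∂stripMeasure =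
      (∫ p, χ p.1 * p.1 * h (torusPt p) ∂stripMeasure) +
        ∫ p, χ p.1 * p.1 * (g - h) (torusPt p) ∂stripMeasure := by
    rw [← integral_add (integrable_mul_torus hφ _) (integrable_mul_torus hφ _)]
    simp [mul_sub]
  have h4 : ‖L.torusSum χ S (g - h) / S‖ ≤ 2 * B * ‖g - h‖ := by
    rw [norm_div, Complex.norm_real, Real.norm_of_nonneg hS0.le, div_le_iff₀ hS0]
    refine (L.norm_torusSum_le hB hS0.le _).trans ?_
    have : 0 ≤ B * ‖g - h‖ := by positivity
    nlinarith
  have h5 : ‖(coprimeDensity : ℂ) * ∫ p, χ p.1 * p.1 * (g - h) (torusPt p) ∂stripMeasure‖ ≤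
      coprimeDensity * K * ‖g - h‖ := by
    rw [norm_mul, Complex.norm_real, Real.norm_of_nonneg hc.le, mul_assoc]
    exact mul_le_mul_of_nonneg_left (norm_integral_mul_torus_le hφ _) hc.le
  rw [h2, h3, add_div, mul_add, add_sub_add_comm]
  have h6 : (2 * B + coprimeDensity * K) * ‖g - h‖ ≤ ε / 2 := by
    have : D * ‖g - h‖ ≤ D * (ε / (2 * D)) := by gcongr
    rw [show D * (ε / (2 * D)) = ε / 2 by field_simp] at this
    have := norm_nonneg (g - h)
    rw [hD] at *
    linarith
  refine (norm_add_le _ _).trans_lt ?_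
  have h7 := norm_sub_le (L.torusSum χ S (g - h) / S)
    (coprimeDensity * ∫ p, χ p.1 * p.1 * (g - h) (torusPt p) ∂stripMeasure)
  linarith

end NonVertLattice

/-- The interior of the triangle `Ω`. -/
def openTri : Set (ℝ × ℝ) := {p | p.1 < 1 ∧ p.2 < 1 ∧ 1 < p.1 + p.2}

lemma isOpen_openTri : IsOpen openTri :=
  (isOpen_lt continuous_fst continuous_const).inter
    ((isOpen_lt continuous_snd continuous_const).inter
      (isOpen_lt continuous_const (continuous_fst.add continuous_snd)))

lemma fract_eq_of_coe_eq {x y : ℝ} (h : (x : UnitAddCircle) = (y : UnitAddCircle)) :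
    Int.fract x = Int.fract y := by
  rw [← AddCircle.coe_fract x, ← AddCircle.coe_fract y] at h
  refine (AddCircle.coe_eq_coe_iff_of_mem_Ico (p := (1 : ℝ)) (a := 0) ?_ ?_).1 h <;>
  simp [Int.fract_nonneg, Int.fract_lt_one]

/-- The function `G(u, 1 - u t)`, extended periodically in `u` and `t`. -/
lemma exists_torus_lift {G : ℝ × ℝ → ℝ} (hG : Continuous G) (hs : ∀ p, G p ≠ 0 → p ∈ openTri) :
    ∃ g : C(UnitAddTorus (Fin 2), ℂ), ∀ p,
      g (torusPt p) = G (Int.fract p.1, 1 - Int.fract p.1 * Int.fract p.2) := by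
  have h0 : ∀ p, p ∉ openTri → G p = 0 := fun p hp => by
    by_contra h
    exact hp (hs p h)
  have h1 : Continuous fun q : ℝ × ℝ => G (q.1, 1 - q.1 * Int.fract q.2) := by
    refine ContinuousOn.comp_fract (s := fun q : ℝ × ℝ => q.2)
      (f := fun q t => G (q.1, 1 - q.1 * t)) (by fun_prop) continuous_snd fun q => ?_
    rw [h0 _ (by simp [openTri]), h0 _ (by simp [openTri])]
  have h2 : Continuous fun q : ℝ × ℝ => G (Int.fract q.1, 1 - Int.fract q.1 * Int.fract q.2) := by
    refine ContinuousOn.comp_fract (s := fun q : ℝ × ℝ => q.1)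
      (f := fun q u => G (u, 1 - u * Int.fract q.2)) ?_ continuous_fst fun q => ?_
    · exact (h1.comp (continuous_snd.prodMk (continuous_snd.comp continuous_fst))).continuousOn
    · rw [h0 _ (by simp [openTri]), h0 _ (by simp [openTri])]
  refine exists_continuousMap_torusPt (P := fun p => G (Int.fract p.1,
    1 - Int.fract p.1 * Int.fract p.2)) (Complex.continuous_ofReal.comp h2) fun p q h => ?_
  have h3 := fract_eq_of_coe_eq (congr_fun h 0)
  have h4 := fract_eq_of_coe_eq (congr_fun h 1)
  simp only [h3, h4]

lemma exists_cutoff {K : Set ℝ} (hK : IsCompact K) (hK1 : K ⊆ Set.Ioo 0 1) :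
    ∃ (χ : ℝ → ℝ) (η : ℝ), Continuous χ ∧ 0 < η ∧ (∀ x, χ x ≠ 0 → η ≤ x ∧ x < 1) ∧
      ∀ x ∈ K, χ x = 1 := by
  obtain ⟨χ, h1, h2, h3, -⟩ := exists_continuousMap_one_of_isCompact_subset_isOpen hK isOpen_Ioo hK1
  have hc : IsCompact (insert (1 / 2) (tsupport χ)) := h2.insert _
  obtain ⟨m, hm, hmin⟩ := hc.exists_isMinOn (Set.insert_nonempty _ _) continuousOn_id
  have hm0 : 0 < m := by
    rcases hm with rfl | hm
    · norm_num
    · exact (h3 hm).1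
  refine ⟨χ, m, χ.continuous, hm0, fun x hx => ?_, h1⟩
  have hx' := subset_tsupport _ (Function.mem_support.2 hx)
  exact ⟨hmin (Set.mem_insert_of_mem _ hx'), (h3 hx').2⟩

lemma integral_stripMeasure_eq {G : ℝ × ℝ → ℝ} (hG : Continuous G) (hGc : HasCompactSupport G)
    (hs : ∀ p, G p ≠ 0 → p ∈ openTri) {χ : ℝ → ℝ} {η : ℝ} (hχ : Continuous χ) (hη : 0 < η)
    (hχs : ∀ x, χ x ≠ 0 → η ≤ x ∧ x < 1) (hχ1 : ∀ p, G p ≠ 0 → χ p.1 = 1)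
    {g : C(UnitAddTorus (Fin 2), ℂ)} (hg : ∀ p,
      g (torusPt p) = G (Int.fract p.1, 1 - Int.fract p.1 * Int.fract p.2)) :
    ∫ p, (χ p.1 : ℂ) * p.1 * g (torusPt p) ∂stripMeasure = (∫ p, G p : ℝ) := by
  have h0 : ∀ p, p ∉ openTri → G p = 0 := fun p hp => by
    by_contra h
    exact hp (hs p h)
  have hsupp : HasCompactSupport fun x => (χ x : ℂ) := HasCompactSupport.intro
    (isCompact_Icc (a := η) (b := 1)) fun x hx => by
      rw [Complex.ofReal_eq_zero]
      by_contra h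
      exact hx ⟨(hχs x h).1, (hχs x h).2.le⟩
  have hφ : Integrable fun u : ℝ => (χ u : ℂ) * u :=
    ((Complex.continuous_ofReal.comp hχ).mul
      Complex.continuous_ofReal).integrable_of_hasCompactSupport hsupp.mul_right
  have hI := integrable_mul_torus hφ g
  have hGI : Integrable G := hG.integrable_of_hasCompactSupport hGc
  rw [stripMeasure] at hI ⊢
  rw [integral_prod _ hI, Measure.volume_eq_prod, integral_prod _ hGI, ← integral_complex_ofReal]
  refine integral_congr_ae (ae_of_all _ fun u => ?_)
  simp only
  by_cases hu : χ u = 0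
  · have : ∀ x, G (u, x) = 0 := fun x => by
      by_contra h
      have := hχ1 _ h
      simp_all
    simp [hu, this]
  obtain ⟨hu1, hu2⟩ := hχs u hu
  have hu0 : 0 < u := by linarith
  have hfu : Int.fract u = u := Int.fract_eq_self.2 ⟨hu0.le, hu2⟩
  have h1 : ∀ t ∈ Set.Ioc (0 : ℝ) 1, (χ u : ℂ) * u * g (torusPt (u, t)) =
      ((χ u * (u * G (u, 1 - u * t)) : ℝ) : ℂ) := by
    intro t ht
    rw [hg]
    simp only [hfu]
    rcases ht.2.lt_or_eq with h | rfl
    · rw [Int.fract_eq_self.2 ⟨ht.1.le, h⟩]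
      push_cast
      ring
    · rw [Int.fract_one, h0 (u, _) (by simp [openTri]), h0 (u, _) (by simp [openTri])]
      simp
  rw [setIntegral_congr_fun measurableSet_Ioc h1, integral_complex_ofReal, integral_const_mul,
    ← intervalIntegral.integral_of_le zero_le_one, intervalIntegral.integral_const_mul,
    ← smul_eq_mul u, intervalIntegral.smul_integral_comp_sub_mul (fun x => G (u, x)), mul_zero,
    mul_one, sub_zero, intervalIntegral.integral_of_le (by linarith),
    setIntegral_eq_integral_of_forall_compl_eq_zero, ← integral_const_mul]
  · congr 2
    funext x
    by_cases hx : G (u, x) = 0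
    · simp [hx]
    · rw [hχ1 _ hx, one_mul]
  · intro x hx
    refine h0 _ fun h => hx ⟨?_, h.2.1.le⟩
    have := h.2.2
    simp only at this
    linarith

namespace NonVertLattice

variable (L : NonVertLattice)

/-- Equidistribution of the pairs `(u, u')` against continuous functions supported inside the
triangle. -/
theorem tendsto_sum_next_div {G : ℝ × ℝ → ℝ} (hG : Continuous G) (hGc : HasCompactSupport G)
    (hs : tsupport G ⊆ openTri) :
    Tendsto (fun S : ℝ => (∑ w ∈ L.stripFinset S, G (L.u w, L.u (L.next w))) / S) atTop
      (𝓝 (coprimeDensity * ∫ p, G p)) := by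
  have hs' : ∀ p, G p ≠ 0 → p ∈ openTri := fun p hp => hs (subset_tsupport _ hp)
  have h0 : ∀ p, p ∉ openTri → G p = 0 := fun p hp => by
    by_contra h
    exact hp (hs' p h)
  obtain ⟨g, hg⟩ := exists_torus_lift hG hs'
  obtain ⟨χ, η, hχ, hη, hχs, hχ1⟩ := exists_cutoff (IsCompact.image hGc continuous_fst) (by
    rintro _ ⟨p, hp, rfl⟩
    obtain ⟨h1, h2, h3⟩ := hs hp
    exact ⟨by linarith, h1⟩)
  have hχ1' : ∀ p, G p ≠ 0 → χ p.1 = 1 := fun p hp =>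
    hχ1 _ ⟨p, subset_tsupport _ hp, rfl⟩
  have h1 := L.tendsto_torusSum_div (χ := fun x => (χ x : ℂ)) (by fun_prop) hη
    (fun x hx => (hχs x (by simpa using hx)).imp_right le_of_lt) g
  rw [integral_stripMeasure_eq hG hGc hs' hχ hη hχs hχ1' hg] at h1
  rw [← Filter.tendsto_ofReal_iff]
  push_cast at h1 ⊢
  refine h1.congr fun S => ?_
  congr 1
  refine Finset.sum_congr rfl fun w hw => ?_
  obtain ⟨hw1, hu0, hu1, -, -⟩ := mem_stripFinset.1 hw
  obtain ⟨hx1, hx2⟩ := u_next hw1 hu0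
  rw [hg]
  rcases hu1.lt_or_eq with h | h
  · have ht : Int.fract ((1 - L.u (L.next w)) / L.u w) = (1 - L.u (L.next w)) / L.u w :=
      Int.fract_eq_self.2 ⟨div_nonneg (by linarith) hu0.le, by rw [div_lt_one hu0]; linarith⟩
    simp only [Int.fract_eq_self.2 ⟨hu0.le, h⟩, ht]
    rw [mul_div_cancel₀ _ hu0.ne', sub_sub_cancel]
    by_cases hz : G (L.u w, L.u (L.next w)) = 0
    · simp [hz]
    · simp [hχ1' _ hz]
  · have h2 : χ (L.u w) = 0 := by
      by_contra h3
      exact (hχs _ h3).2.ne h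
    rw [h0 (L.u w, _) (by simp [openTri, h])]
    simp [h2]

end NonVertLattice

lemma volume_openTri : volume openTri = ENNReal.ofReal (1 / 2) := by
  have h1 : openTri = regionBetween (fun x : ℝ => 1 - x) (fun _ => 1) (Set.Ioc 0 1 \ {1}) := by
    ext p
    simp only [openTri, regionBetween, Set.mem_ofPred_eq, Set.mem_Ioo, Set.mem_sdiff, Set.mem_Ioc,
      Set.mem_singleton_iff]
    constructor
    · rintro ⟨h1, h2, h3⟩
      exact ⟨⟨⟨by linarith, h1.le⟩, h1.ne⟩, by linarith, h2⟩
    · rintro ⟨⟨⟨h1, h2⟩, h3⟩, h4, h5⟩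
      exact ⟨lt_of_le_of_ne h2 h3, h5, by linarith⟩
  have h2 : (Set.Ioc (0 : ℝ) 1 \ {1} : Set ℝ) =ᵐ[volume] Set.Ioc (0 : ℝ) 1 :=
    sdiff_null_ae_eq_self (measure_singleton 1)
  rw [h1, Measure.volume_eq_prod, volume_regionBetween_eq_integral]
  · congr 1
    rw [setIntegral_congr_set h2, ← intervalIntegral.integral_of_le zero_le_one]
    simp
  · exact (Continuous.integrableOn_Icc (by fun_prop)).mono_set
      (Set.sdiff_subset.trans Set.Ioc_subset_Icc_self)
  · exact (continuous_const.integrableOn_Icc).mono_set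
      (Set.sdiff_subset.trans Set.Ioc_subset_Icc_self)
  · exact measurableSet_Ioc.diff (measurableSet_singleton 1)
  · rintro x ⟨⟨h, -⟩, -⟩
    simp [h.le]

lemma volume_ne_top_of_subset_openTri {U : Set (ℝ × ℝ)} (hU : U ⊆ openTri) : volume U ≠ ⊤ :=
  ((measure_mono hU).trans_lt (by simp [volume_openTri])).ne

namespace NonVertLattice

variable (L : NonVertLattice)

open Classical in
/-- The vectors `w` of the strip for which `(u, u')` lies in `A`. -/
def pairFinset (A : Set (ℝ × ℝ)) (S : ℝ) : Finset (ℤ × ℤ) :=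
  {w ∈ L.stripFinset S | (L.u w, L.u (L.next w)) ∈ A}

variable {L} in
lemma mem_pairFinset {A : Set (ℝ × ℝ)} {S : ℝ} {w : ℤ × ℤ} : w ∈ L.pairFinset A S ↔
    w ∈ L.stripFinset S ∧ (L.u w, L.u (L.next w)) ∈ A := by
  classical
  rw [pairFinset, Finset.mem_filter]

lemma eventually_le_card_pairFinset {U : Set (ℝ × ℝ)} (hU : IsOpen U) (hUT : U ⊆ openTri) {ε : ℝ}
    (hε : 0 < ε) : ∀ᶠ S : ℝ in atTop,
      coprimeDensity * volume.real U - ε ≤ (L.pairFinset U S).card / S := by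
  classical
  have hc := coprimeDensity_pos
  obtain hv | hv := measureReal_nonneg (μ := volume) (s := U) |>.eq_or_lt
  · filter_upwards [eventually_ge_atTop 0] with S hS
    rw [← hv, mul_zero]
    have : (0 : ℝ) ≤ (L.pairFinset U S).card / S := by positivity
    linarith
  set δ := ε / (2 * coprimeDensity) with hδ
  have hδ0 : 0 < δ := by positivity
  obtain ⟨K, hKU, hK, hlt⟩ := hU.exists_lt_isCompact (μ := volume)
    (r := ENNReal.ofReal (volume.real U - δ)) (by
      rw [← ofReal_measureReal (volume_ne_top_of_subset_openTri hUT)]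
      exact (ENNReal.ofReal_lt_ofReal_iff hv).2 (by linarith))
  have hKlt : volume.real U - δ ≤ volume.real K :=
    (ENNReal.ofReal_le_iff_le_toReal (volume_ne_top_of_subset_openTri (hKU.trans hUT))).1 hlt.le
  obtain ⟨G, hG1, hG2, hG3, hG4⟩ := exists_continuousMap_one_of_isCompact_subset_isOpen hK hU hKU
  have hI : volume.real K ≤ ∫ p, G p := by
    rw [← integral_indicator_one hK.measurableSet]
    refine integral_mono ((integrable_indicator_iff hK.measurableSet).2
      (integrableOn_const hK.measure_lt_top.ne)) (G.continuous.integrable_of_hasCompactSupport hG2)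
      fun p => ?_
    by_cases hp : p ∈ K
    · simp [hp, hG1 hp]
    · simpa [hp] using (hG4 p).1
  have h1 := L.tendsto_sum_next_div G.continuous hG2 (hG3.trans hUT)
  have h2 : coprimeDensity * volume.real U - ε < coprimeDensity * ∫ p, G p := by
    have : coprimeDensity * (volume.real U - δ) ≤ coprimeDensity * ∫ p, G p := by
      gcongr
      linarith
    rw [mul_sub, show coprimeDensity * δ = ε / 2 by rw [hδ]; field_simp] at this
    linarith
  filter_upwards [h1.eventually (lt_mem_nhds h2), eventually_ge_atTop 0] with S hS hS0
  refine hS.le.trans ?_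
  gcongr
  rw [pairFinset, Finset.card_filter, Nat.cast_sum]
  refine Finset.sum_le_sum fun w _ => ?_
  split_ifs with h
  · simpa using (hG4 _).2
  · have : G (L.u w, L.u (L.next w)) = 0 := by
      by_contra h'
      exact h (hG3 (subset_tsupport _ h'))
    simp [this]

lemma card_filter_u_lt_le {η S : ℝ} (hη : 0 < η) (hS : 0 ≤ S) :
    (({w ∈ L.stripFinset S | L.u w < η} : Finset (ℤ × ℤ)).card : ℝ) ≤ η ^ 2 * S + 1 := by
  refine L.card_le_of_slope_mem (p := 0) _ hη hS fun w hw => ?_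
  rw [Finset.mem_filter, mem_stripFinset] at hw
  obtain ⟨⟨h1, h2, h3, h4, h5⟩, h6⟩ := hw
  exact ⟨h1, h2, h6.le, h4.le, by linarith⟩

lemma card_filter_le_norm_slopeSum {f : ℝ → ℝ} {η C : ℝ} (hη : 0 < η) (hC : 0 < C)
    (hfs : ∀ x, f x ≠ 0 → η ≤ x ∧ x ≤ C) (hf0 : ∀ x, 0 ≤ f x) {κ : ℝ}
    (hf1 : ∀ x, κ ≤ x → x ≤ 1 → f x = 1) {S : ℝ} (hS : 0 ≤ S) :
    (({w ∈ L.stripFinset S | ¬ L.u w < κ} : Finset (ℤ × ℤ)).card : ℝ) ≤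
      ‖L.slopeSum (fun x => (f x : ℂ)) 0 S‖ := by
  classical
  obtain ⟨s, hs, -⟩ := L.exists_window_finset hC hS 0
  have hph : ∀ w : ℤ × ℤ, IsCoprime w.1 w.2 → L.u w ≠ 0 → L.latPhase 0 w = 1 := fun w hw hu => by
    rw [L.latPhase_eq 0 (exists_idet_eq_one hw).choose_spec hu]
    simp
  have h1 : L.slopeSum (fun x => (f x : ℂ)) 0 S =
      ((∑ w ∈ s, if 0 < L.slope w ∧ L.slope w ≤ S then f (L.u w) else 0 : ℝ) : ℂ) := by
    rw [slopeSum]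
    refine (tsum_eq_sum (s := s) fun w hw => ?_).trans ?_
    · rw [ite_eq_right_iff]
      intro h
      by_contra h0
      have h2 := hfs (L.u w) (by simpa using left_ne_zero_of_mul h0)
      refine hw ((hs w).2 ⟨?_, hη.trans_le h2.1, h2.2, h.1.le, by linarith [h.2]⟩)
      by_contra h3
      exact h0 (by rw [L.latPhase_of_not_isCoprime h3, mul_zero])
    · push_cast
      refine Finset.sum_congr rfl fun w hw => ?_
      obtain ⟨h2, h3, -⟩ := (hs w).1 hw
      rw [hph w h2 h3.ne', mul_one]
      split_ifs <;> simp
  rw [h1, Complex.norm_real]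
  refine le_trans ?_ (le_abs_self _)
  have h2 : ∑ w ∈ L.stripFinset S with ¬ L.u w < κ, (1 : ℝ) ≤
      ∑ w ∈ s, if 0 < L.slope w ∧ L.slope w ≤ S then f (L.u w) else 0 := by
    by_cases hC1 : 1 ≤ C
    · calc _ ≤ ∑ w ∈ L.stripFinset S with ¬ L.u w < κ,
          (if 0 < L.slope w ∧ L.slope w ≤ S then f (L.u w) else 0) := by
            refine Finset.sum_le_sum fun w hw => ?_
            rw [Finset.mem_filter, mem_stripFinset] at hw
            rw [if_pos hw.1.2.2.2, hf1 _ (not_lt.1 hw.2) hw.1.2.2.1]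
        _ ≤ _ := by
          refine Finset.sum_le_sum_of_subset_of_nonneg (fun w hw => ?_) fun w _ _ => ?_
          · rw [Finset.mem_filter, mem_stripFinset] at hw
            obtain ⟨⟨h1, h2, h3, h4, h5⟩, -⟩ := hw
            exact (hs w).2 ⟨h1, h2, h3.trans hC1, h4.le, by linarith⟩
          · split_ifs
            exacts [hf0 _, le_rfl]
    · have : ∀ w ∈ L.stripFinset S, L.u w < κ := fun w hw => by
        by_contra h
        have h2 := (mem_stripFinset.1 hw).2.2.1
        have h3 := hf1 1 ((not_lt.1 h).trans h2) le_rfl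
        exact hC1 (hfs 1 (by simp [h3])).2
      rw [Finset.filter_false_of_mem fun w hw => not_not.2 (this w hw), Finset.sum_empty]
      refine Finset.sum_nonneg fun w _ => ?_
      split_ifs
      exacts [hf0 _, le_rfl]
  simpa using h2

lemma eventually_card_stripFinset_le {ε : ℝ} (hε : 0 < ε) : ∀ᶠ S : ℝ in atTop,
    ((L.stripFinset S).card : ℝ) / S ≤ coprimeDensity / 2 + ε := by
  classical
  have hc := coprimeDensity_pos
  obtain ⟨η, hη0, hη1, hη⟩ : ∃ η : ℝ, 0 < η ∧ η ≤ 1 ∧ (2 * coprimeDensity + 1) * η ≤ ε / 4 := by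
    refine ⟨min 1 (ε / 4 / (2 * coprimeDensity + 1)), by positivity, min_le_left _ _, ?_⟩
    rw [mul_comm, ← le_div_iff₀ (by positivity)]
    exact min_le_right _ _
  obtain ⟨f, hf1, hf2, hf3, hf4⟩ := exists_continuousMap_one_of_isCompact_subset_isOpen
    (isCompact_Icc (a := η) (b := 1)) (isOpen_Ioo (a := η / 2) (b := 1 + η))
    (fun x hx => ⟨by linarith [hx.1], by linarith [hx.2]⟩)
  have hfs : ∀ x, f x ≠ 0 → η / 2 < x ∧ x < 1 + η := fun x hx => hf3 (subset_tsupport _ hx)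
  have hfs' : ∀ x, (f x : ℂ) ≠ 0 → η / 2 ≤ x ∧ x ≤ 1 + η := fun x hx =>
    (hfs x (by simpa using hx)).imp le_of_lt le_of_lt
  have h1 := (L.tendsto_slopeSum_div (f := fun x => (f x : ℂ)) (by fun_prop)
    (by positivity : 0 < η / 2) (by positivity : 0 < 1 + η) hfs' 0).norm
  have hI : ∫ x, f x * x ≤ (1 + η) ^ 2 / 2 := by
    have hz : ∀ x, x ∉ Set.Ioc 0 (1 + η) → f x * x = 0 := fun x hx => by
      by_contra h
      have := hfs x (left_ne_zero_of_mul h)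
      exact hx ⟨by linarith, this.2.le⟩
    rw [← setIntegral_eq_integral_of_forall_compl_eq_zero hz,
      ← intervalIntegral.integral_of_le (by positivity)]
    refine (intervalIntegral.integral_mono_on (g := fun x => x) (by positivity)
      (Continuous.intervalIntegrable (by fun_prop) _ _)
      (Continuous.intervalIntegrable (by fun_prop) _ _) fun x hx => ?_).trans ?_
    · exact mul_le_of_le_one_left hx.1 (hf4 x).2
    · simp
  have hI0 : 0 ≤ ∫ x, f x * x := integral_nonneg fun x => by
    by_cases h : f x = 0
    · simp [h]
    · exact mul_nonneg (hf4 x).1 (by linarith [(hfs x h).1])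
  have hlim : ‖(phaseDensity 0 : ℂ) * ∫ x, (f x : ℂ) * x‖ < coprimeDensity / 2 + ε / 2 := by
    have : ∫ x, (f x : ℂ) * x = ((∫ x, f x * x : ℝ) : ℂ) := by
      rw [← integral_complex_ofReal]
      push_cast
      rfl
    rw [this, norm_mul, Complex.norm_real, Complex.norm_real, Real.norm_of_nonneg hI0,
      phaseDensity, if_pos rfl, Real.norm_of_nonneg hc.le]
    have h2 : coprimeDensity * ∫ x, f x * x ≤ coprimeDensity * ((1 + η) ^ 2 / 2) := by gcongr
    nlinarith [mul_pos hc hη0]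
  filter_upwards [h1.eventually (gt_mem_nhds hlim), eventually_ge_atTop 1,
    eventually_ge_atTop (8 / ε)] with S hS hS1 hSε
  have hS0 : 0 < S := by linarith
  rw [norm_div, Complex.norm_real, Real.norm_of_nonneg hS0.le, div_lt_iff₀ hS0] at hS
  rw [div_le_iff₀ hS0]
  rw [div_le_iff₀ hε] at hSε
  have h2 := L.card_filter_le_norm_slopeSum (by positivity : 0 < η / 2) (by positivity : 0 < 1 + η)
    (fun x hx => (hfs x hx).imp le_of_lt le_of_lt) (fun x => (hf4 x).1) (κ := η)
    (fun x h h' => hf1 ⟨h, h'⟩) hS0.le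
  have h3 := L.card_filter_u_lt_le hη0 hS0.le
  have h4 : ((L.stripFinset S).card : ℝ) =
      ({w ∈ L.stripFinset S | L.u w < η} : Finset (ℤ × ℤ)).card +
      ({w ∈ L.stripFinset S | ¬ L.u w < η} : Finset (ℤ × ℤ)).card := by
    exact_mod_cast (Finset.card_filter_add_card_filter_not _).symm
  have h5 : η ^ 2 * S ≤ ε / 4 * S := by
    gcongr
    nlinarith [mul_pos hc hη0]
  rw [h4]
  linarith

end NonVertLattice

lemma volume_hyperbola (c : ℝ) : volume {p : ℝ × ℝ | c * (p.1 * p.2) = 1} = 0 := by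
  rw [Measure.volume_eq_prod]
  have hm : MeasurableSet {p : ℝ × ℝ | c * (p.1 * p.2) = 1} :=
    (isClosed_eq (by fun_prop) continuous_const).measurableSet
  refine Measure.measure_prod_null_of_ae_null hm (ae_of_all _ fun x => ?_)
  refine Set.Subsingleton.measure_zero (fun y hy z hz => ?_) _
  simp only [Set.mem_preimage, Set.mem_ofPred_eq] at hy hz
  have hcx : c * x ≠ 0 := by
    intro h
    rw [← mul_assoc, h, zero_mul] at hy
    exact zero_ne_one hy
  refine mul_left_cancel₀ hcx ?_
  linarith

/-- The part of the open triangle where the gap lies in `(a, b)`. -/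
def gapRegion (a b : ℝ) : Set (ℝ × ℝ) :=
  openTri ∩ {p | 1 < b * (p.1 * p.2) ∧ a * (p.1 * p.2) < 1}

/-- The part of the open triangle where the gap lies outside `[a, b]`. -/
def gapCoregion (a b : ℝ) : Set (ℝ × ℝ) :=
  openTri ∩ {p | b * (p.1 * p.2) < 1 ∨ 1 < a * (p.1 * p.2)}

lemma isOpen_gapRegion (a b : ℝ) : IsOpen (gapRegion a b) := by
  have h (c : ℝ) : Continuous fun p : ℝ × ℝ => c * (p.1 * p.2) := by fun_prop
  exact isOpen_openTri.inter
    ((isOpen_lt continuous_const (h b)).inter (isOpen_lt (h a) continuous_const))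

lemma isOpen_gapCoregion (a b : ℝ) : IsOpen (gapCoregion a b) := by
  have h (c : ℝ) : Continuous fun p : ℝ × ℝ => c * (p.1 * p.2) := by fun_prop
  exact isOpen_openTri.inter
    ((isOpen_lt (h b) continuous_const).union (isOpen_lt continuous_const (h a)))

lemma gapRegion_subset_Aset (a b : ℝ) : gapRegion a b ⊆ Aset a b := by
  rintro p ⟨⟨h1, h2, h3⟩, h4⟩
  exact ⟨⟨⟨by linarith, h1.le⟩, ⟨by linarith, h2.le⟩, h3⟩, h4⟩

lemma disjoint_Aset_gapCoregion (a b : ℝ) : Disjoint (Aset a b) (gapCoregion a b) := by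
  rw [Set.disjoint_left]
  rintro p ⟨-, h1, h2⟩ ⟨-, h3 | h3⟩ <;> linarith

lemma volume_Aset (a b : ℝ) : volume (Aset a b) = volume (gapRegion a b) := by
  refine le_antisymm ?_ (measure_mono (gapRegion_subset_Aset a b))
  have h1 : volume (Prod.fst ⁻¹' {1} : Set (ℝ × ℝ)) = 0 :=
    Measure.quasiMeasurePreserving_fst.preimage_null (measure_singleton 1)
  have h2 : volume (Prod.snd ⁻¹' {1} : Set (ℝ × ℝ)) = 0 :=
    Measure.quasiMeasurePreserving_snd.preimage_null (measure_singleton 1)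
  have h3 : Aset a b ⊆ gapRegion a b ∪ (Prod.fst ⁻¹' {1} ∪ Prod.snd ⁻¹' {1}) := by
    rintro p ⟨⟨h4, h5, h6⟩, h7⟩
    by_cases h8 : p.1 = 1
    · exact Or.inr (Or.inl h8)
    by_cases h9 : p.2 = 1
    · exact Or.inr (Or.inr h9)
    exact Or.inl ⟨⟨lt_of_le_of_ne h4.2 h8, lt_of_le_of_ne h5.2 h9, h6⟩, h7⟩
  refine (measure_mono h3).trans ((measure_union_le _ _).trans ?_)
  rw [measure_union_null h1 h2, add_zero]

lemma half_le_measureReal_add (a b : ℝ) :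
    1 / 2 ≤ volume.real (gapRegion a b) + volume.real (gapCoregion a b) := by
  have h1 : openTri ⊆ gapRegion a b ∪ gapCoregion a b ∪
      ({p | b * (p.1 * p.2) = 1} ∪ {p | a * (p.1 * p.2) = 1}) := by
    intro p hp
    rcases lt_trichotomy (b * (p.1 * p.2)) 1 with h | h | h
    · exact Or.inl (Or.inr ⟨hp, Or.inl h⟩)
    · exact Or.inr (Or.inl h)
    · rcases lt_trichotomy (a * (p.1 * p.2)) 1 with h' | h' | h'
      · exact Or.inl (Or.inl ⟨hp, h, h'⟩)
      · exact Or.inr (Or.inr h')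
      · exact Or.inl (Or.inr ⟨hp, Or.inr h'⟩)
  have h2 : volume openTri ≤ volume (gapRegion a b) + volume (gapCoregion a b) := by
    refine (measure_mono h1).trans ((measure_union_le _ _).trans ?_)
    rw [measure_union_null (volume_hyperbola b) (volume_hyperbola a), add_zero]
    exact measure_union_le _ _
  have h3 := volume_ne_top_of_subset_openTri (U := gapRegion a b) Set.inter_subset_left
  have h4 := volume_ne_top_of_subset_openTri (U := gapCoregion a b) Set.inter_subset_left
  have h5 := ENNReal.toReal_mono (ENNReal.add_ne_top.2 ⟨h3, h4⟩) h2
  rwa [ENNReal.toReal_add h3 h4, volume_openTri, ENNReal.toReal_ofReal (by norm_num)] at h5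

namespace NonVertLattice

variable (L : NonVertLattice)

lemma pairFinset_subset (A : Set (ℝ × ℝ)) (S : ℝ) : L.pairFinset A S ⊆ L.stripFinset S :=
  fun _ h => (mem_pairFinset.1 h).1

lemma card_pairFinset_add_le {A B : Set (ℝ × ℝ)} (h : Disjoint A B) (S : ℝ) :
    (L.pairFinset A S).card + (L.pairFinset B S).card ≤ (L.stripFinset S).card := by
  classical
  rw [← Finset.card_union_of_disjoint]
  · exact Finset.card_le_card
      (Finset.union_subset (L.pairFinset_subset A S) (L.pairFinset_subset B S))
  · exact Finset.disjoint_left.2 fun w h1 h2 =>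
      Set.disjoint_left.1 h (mem_pairFinset.1 h1).2 (mem_pairFinset.1 h2).2

lemma pairFinset_mono {A B : Set (ℝ × ℝ)} (h : A ⊆ B) (S : ℝ) :
    L.pairFinset A S ⊆ L.pairFinset B S :=
  fun _ hw => mem_pairFinset.2 ⟨(mem_pairFinset.1 hw).1, h (mem_pairFinset.1 hw).2⟩

lemma tendsto_card_stripFinset_div :
    Tendsto (fun S : ℝ => ((L.stripFinset S).card : ℝ) / S) atTop (𝓝 (coprimeDensity / 2)) := by
  have hvol : volume.real openTri = 1 / 2 := by
    rw [measureReal_def, volume_openTri, ENNReal.toReal_ofReal (by norm_num)]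
  rw [Metric.tendsto_nhds]
  intro ε hε
  filter_upwards [L.eventually_card_stripFinset_le (half_pos hε),
    L.eventually_le_card_pairFinset isOpen_openTri subset_rfl (half_pos hε),
    eventually_ge_atTop 0] with S h1 h2 hS
  rw [hvol] at h2
  have h3 : ((L.pairFinset openTri S).card : ℝ) / S ≤ (L.stripFinset S).card / S := by
    gcongr
    exact L.pairFinset_subset _ _
  rw [Real.dist_eq, abs_lt]
  constructor <;> linarith

lemma tendsto_card_pairFinset_Aset_div (a b : ℝ) :
    Tendsto (fun S : ℝ => ((L.pairFinset (Aset a b) S).card : ℝ) / S) atTop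
      (𝓝 (coprimeDensity * volume.real (Aset a b))) := by
  have hc := coprimeDensity_pos
  have hvol : volume.real (Aset a b) = volume.real (gapRegion a b) := by
    rw [measureReal_def, volume_Aset, measureReal_def]
  rw [Metric.tendsto_nhds, hvol]
  intro ε hε
  have hε4 : 0 < ε / 4 := by positivity
  filter_upwards [L.eventually_card_stripFinset_le hε4,
    L.eventually_le_card_pairFinset (isOpen_gapRegion a b) Set.inter_subset_left hε4,
    L.eventually_le_card_pairFinset (isOpen_gapCoregion a b) Set.inter_subset_left hε4,
    eventually_ge_atTop 0] with S h1 h2 h3 hS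
  have h4 : ((L.pairFinset (gapRegion a b) S).card : ℝ) / S ≤
      (L.pairFinset (Aset a b) S).card / S := by
    gcongr
    exact L.pairFinset_mono (gapRegion_subset_Aset a b) S
  have h5 : ((L.pairFinset (Aset a b) S).card : ℝ) / S +
      (L.pairFinset (gapCoregion a b) S).card / S ≤ (L.stripFinset S).card / S := by
    rw [← add_div]
    gcongr
    exact_mod_cast L.card_pairFinset_add_le (disjoint_Aset_gapCoregion a b) S
  have h6 := mul_le_mul_of_nonneg_left (half_le_measureReal_add a b) hc.le
  rw [Real.dist_eq, abs_lt]
  constructor <;> linarith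

/-- The proportion of the primitive vectors of the strip with `(u, u')` in `Aset a b`. -/
theorem tendsto_card_pairFinset_div_card (a b : ℝ) :
    Tendsto (fun S : ℝ => ((L.pairFinset (Aset a b) S).card : ℝ) / (L.stripFinset S).card) atTop
      (𝓝 (2 * volume.real (Aset a b))) := by
  have hc := coprimeDensity_pos
  have h := (L.tendsto_card_pairFinset_Aset_div a b).div L.tendsto_card_stripFinset_div
    (by positivity)
  rw [show coprimeDensity * volume.real (Aset a b) / (coprimeDensity / 2) =
    2 * volume.real (Aset a b) by field_simp] at h
  refine h.congr' ?_
  filter_upwards [eventually_gt_atTop 0] with S hS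
  exact div_div_div_cancel_right₀ hS.ne' _ _

/-- The slopes of the primitive vectors of the strip. -/
def slopes : Set ℝ := {t | ∃ w : ℤ × ℤ, IsCoprime w.1 w.2 ∧ 0 < L.u w ∧ L.u w ≤ 1 ∧
  0 < L.slope w ∧ t = L.slope w}

lemma not_bddAbove_slopes : ¬ BddAbove L.slopes := by
  rintro ⟨B, hB⟩
  obtain ⟨w, h1, h2, h3, h4⟩ := L.exists_slope_ge one_pos (|B| + 1)
  have h5 := hB ⟨w, h1, h2, h3, by have := abs_nonneg B; linarith, rfl⟩
  linarith [le_abs_self B]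

lemma not_accPt_slopes (t : ℝ) : ¬ AccPt t (𝓟 L.slopes) := by
  intro h
  have h1 := (accPt_iff_frequently.1 h)
  have hfin : (L.slopes ∩ Set.Icc (t - 1) (t + 1)).Finite := by
    refine ((L.finite_setOf_slope_mem 1 (t - 1) (t + 1)).image L.slope).subset ?_
    rintro _ ⟨⟨w, -, h2, h3, -, rfl⟩, h4, h5⟩
    exact ⟨w, ⟨h2, h3, h4, h5⟩, rfl⟩
  have h2 : ((L.slopes ∩ Set.Icc (t - 1) (t + 1)) \ {t})ᶜ ∈ 𝓝 t :=
    (hfin.subset Set.sdiff_subset).isClosed.compl_mem_nhds fun h => h.2 rfl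
  have h3 : Set.Icc (t - 1) (t + 1) ∈ 𝓝 t := Icc_mem_nhds (by linarith) (by linarith)
  obtain ⟨y, ⟨hy1, hy2⟩, hy3, hy4⟩ := (h1.and_eventually (inter_mem h2 h3)).exists
  exact hy3 ⟨⟨hy2, hy4⟩, hy1⟩

variable {L} {s : ℕ → ℝ}

lemma tendsto_atTop_of_enumeration (hs : StrictMono s) (hsurj : ∀ t ∈ L.slopes, ∃ n, s n = t) :
    Tendsto s atTop atTop := by
  refine tendsto_atTop_atTop_of_monotone hs.monotone fun B => ?_
  obtain ⟨t, ht, hBt⟩ := not_bddAbove_iff.1 L.not_bddAbove_slopes B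
  obtain ⟨n, rfl⟩ := hsurj t ht
  exact ⟨n, hBt.le⟩

lemma enumeration_succ_sub_mem_Ioo_iff (hs : StrictMono s) (hmem : ∀ n, s n ∈ L.slopes)
    (hsurj : ∀ t ∈ L.slopes, ∃ n, s n = t) {n : ℕ} {w : ℤ × ℤ} (hw : IsCoprime w.1 w.2)
    (hu : 0 < L.u w) (hu1 : L.u w ≤ 1) (hsw : s n = L.slope w) (a b : ℝ) :
    s (n + 1) - s n ∈ Set.Ioo a b ↔ (L.u w, L.u (L.next w)) ∈ Aset a b := by
  have hdet := idet_next hw hu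
  obtain ⟨hx1, hx2⟩ := u_next hw hu
  set x := L.next w
  have hx0 : 0 < L.u x := by linarith
  have hlt : L.slope w < L.slope x := (L.slope_lt_iff hu hx0).2 (by omega)
  have hpos : 0 < s n := by
    obtain ⟨y, -, -, -, h, h'⟩ := hmem n
    rwa [h']
  have hsucc : s (n + 1) = L.slope x := by
    obtain ⟨m, hm⟩ := hsurj (L.slope x) ⟨x, isCoprime_of_idet_right hdet, hx0, hx2,
      by linarith, rfl⟩
    refine le_antisymm ?_ ?_
    · rw [← hm]
      exact hs.monotone (hs.lt_iff_lt.1 (by rw [hm, hsw]; exact hlt))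
    · obtain ⟨y, -, hy1, hy2, -, hy4⟩ := hmem (n + 1)
      rw [hy4]
      refine L.slope_le_of_slope_lt hdet hu hx0 (by linarith) hy1 hy2 ?_
      rw [← hy4, ← hsw]
      exact hs n.lt_succ_self
  have hp : 0 < L.u w * L.u x := mul_pos hu hx0
  rw [hsucc, hsw, L.slope_sub hu hx0, hdet, Int.cast_one, Set.mem_Ioo, lt_div_iff₀ hp,
    div_lt_iff₀ hp]
  exact ⟨fun h => ⟨⟨⟨hu.le, hu1⟩, ⟨hx0.le, hx2⟩, by linarith⟩, h.2, h.1⟩, fun h => ⟨h.2.2, h.2.1⟩⟩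

/-- The gaps of an enumeration of the slopes have the limiting distribution
`2 * volume (Aset a b)`. -/
theorem tendsto_ncard_gaps_div (hs : StrictMono s) (hmem : ∀ n, s n ∈ L.slopes)
    (hsurj : ∀ t ∈ L.slopes, ∃ n, s n = t) (a b : ℝ) :
    Tendsto (fun N : ℕ =>
        ({n : ℕ | n < N ∧ s (n + 1) - s n ∈ Set.Ioo a b}.ncard : ℝ) / N) atTop
      (𝓝 (2 * volume.real (Aset a b))) := by
  classical
  choose w hw hu hu1 hpos hsw using hmem
  have hwinj : Function.Injective w := fun m n h => hs.injective (by rw [hsw, hsw, h])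
  have hstrip : ∀ N, L.stripFinset (s N) = (Finset.range (N + 1)).image w := by
    intro N
    ext y
    simp only [mem_stripFinset, Finset.mem_image, Finset.mem_range, Nat.lt_succ_iff]
    constructor
    · rintro ⟨h1, h2, h3, h4, h5⟩
      obtain ⟨n, hn⟩ := hsurj (L.slope y) ⟨y, h1, h2, h3, h4, rfl⟩
      refine ⟨n, hs.le_iff_le.1 (hn ▸ h5), ?_⟩
      refine L.eq_of_idet_eq_zero h1 (hw n) h2 (hu n) ?_
      have h6 := L.slope_sub h2 (hu n)
      rw [← hsw, hn, sub_self] at h6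
      have h7 := mul_pos h2 (hu n)
      have h8 := (div_eq_zero_iff.1 h6.symm).resolve_right h7.ne'
      exact_mod_cast h8
    · rintro ⟨n, hn, rfl⟩
      exact ⟨hw n, hu n, hu1 n, hpos n, by rw [← hsw]; exact hs.monotone hn⟩
  have hcard : ∀ N, (L.stripFinset (s N)).card = N + 1 := fun N => by
    rw [hstrip, Finset.card_image_of_injective _ hwinj, Finset.card_range]
  have hpair : ∀ N, {n : ℕ | n < N + 1 ∧ s (n + 1) - s n ∈ Set.Ioo a b}.ncard =
      (L.pairFinset (Aset a b) (s N)).card := by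
    intro N
    have h1 : {n : ℕ | n < N + 1 ∧ s (n + 1) - s n ∈ Set.Ioo a b} =
        ((Finset.range (N + 1)).filter fun n => s (n + 1) - s n ∈ Set.Ioo a b : Finset ℕ) := by
      ext n
      simp
    rw [h1, Set.ncard_coe_finset, ← Finset.card_image_of_injective _ hwinj]
    congr 1
    ext y
    rw [mem_pairFinset, hstrip]
    simp only [Finset.mem_image, Finset.mem_filter]
    have key := fun n => enumeration_succ_sub_mem_Ioo_iff hs
      (fun n => ⟨w n, hw n, hu n, hu1 n, hpos n, hsw n⟩) hsurj (hw n) (hu n) (hu1 n) (hsw n) a b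
    constructor
    · rintro ⟨n, ⟨h2, h3⟩, rfl⟩
      exact ⟨⟨n, h2, rfl⟩, (key n).1 h3⟩
    · rintro ⟨⟨n, h2, rfl⟩, h3⟩
      exact ⟨n, ⟨h2, (key n).2 h3⟩, rfl⟩
  rw [← tendsto_add_atTop_iff_nat 1]
  refine ((L.tendsto_card_pairFinset_div_card a b).comp
    (tendsto_atTop_of_enumeration hs hsurj)).congr fun N => ?_
  simp only [Function.comp_apply, hcard, hpair]

end NonVertLattice

/-- The coordinates of the lattice `M·ℤ²` when it has no vertical vector. -/
def nonVertLatticeOf (M : Matrix (Fin 2) (Fin 2) ℝ) (hM : M.det = 1)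
    (hvert : ¬ ∃ v : ℝ, v ≠ 0 ∧ ![0, v] ∈ lattOf M) : NonVertLattice where
  a := M 0 0
  b := M 0 1
  c := M 1 0
  d := M 1 1
  det_eq_one := by rw [← hM, Matrix.det_fin_two]
  eq_zero_of_u m n h := by
    have hdet : M 0 0 * M 1 1 - M 0 1 * M 1 0 = 1 := by rw [← hM, Matrix.det_fin_two]
    have hv : M 1 0 * m + M 1 1 * n = 0 := by
      by_contra hv
      refine hvert ⟨_, hv, m, n, ?_⟩
      funext i
      fin_cases i <;> simp [Matrix.mulVec, dotProduct, Fin.sum_univ_two, h]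
    have hm : (m : ℝ) = 0 := by linear_combination M 1 1 * h - M 0 1 * hv - m * hdet
    have hn : (n : ℝ) = 0 := by linear_combination M 0 0 * hv - M 1 0 * h - n * hdet
    exact ⟨by exact_mod_cast hm, by exact_mod_cast hn⟩

lemma slopeSet_lattOf (M : Matrix (Fin 2) (Fin 2) ℝ) (hM : M.det = 1)
    (hvert : ¬ ∃ v : ℝ, v ≠ 0 ∧ ![0, v] ∈ lattOf M) :
    slopeSet (lattOf M) = (nonVertLatticeOf M hM hvert).slopes := by
  set L := nonVertLatticeOf M hM hvert
  have h0 : ∀ m n : ℤ, (M *ᵥ ![(m : ℝ), (n : ℝ)]) 0 = L.u (m, n) := fun m n => by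
    simp [Matrix.mulVec, dotProduct, Fin.sum_univ_two, NonVertLattice.u, L, nonVertLatticeOf]
  have h1 : ∀ m n : ℤ, (M *ᵥ ![(m : ℝ), (n : ℝ)]) 1 = L.v (m, n) := fun m n => by
    simp [Matrix.mulVec, dotProduct, Fin.sum_univ_two, NonVertLattice.v, L, nonVertLatticeOf]
  ext t
  constructor
  · rintro ⟨_, ⟨m, n, rfl⟩, hu, hu1, hv, rfl⟩
    rw [h0] at hu hu1 ⊢
    rw [h1] at hv ⊢
    obtain ⟨x, hx, hx0, hx1, hx2⟩ := L.exists_coprime_of_u_pos hu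
    exact ⟨x, hx, hx0, hx1.trans hu1, hx2 ▸ div_pos hv hu, hx2.symm⟩
  · rintro ⟨w, -, hu, hu1, hs, rfl⟩
    refine ⟨_, ⟨w.1, w.2, rfl⟩, ?_⟩
    rw [h0, h1]
    exact ⟨hu, hu1, by rw [L.v_eq_slope_mul hu]; exact mul_pos hs hu, rfl⟩

/-- For a unimodular lattice `Λ = M·ℤ²` with no vertical vectors, the slopes of its
vectors in the vertical strip `{0 < u ≤ 1, v > 0}` form an infinite discrete subset of
`(0,∞)`, and the gaps `s_{n+1} - s_n` of its increasing enumeration equidistribute with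
limiting distribution `2·Leb₂(A_{a,b})` (Hall's distribution). -/
theorem lattice_slope_gap_distribution (M : Matrix (Fin 2) (Fin 2) ℝ) (hM : M.det = 1)
    (hvert : ¬ ∃ v : ℝ, v ≠ 0 ∧ ![0, v] ∈ lattOf M) :
    (slopeSet (lattOf M)).Infinite ∧ slopeSet (lattOf M) ⊆ Set.Ioi 0 ∧
      (∀ t : ℝ, ¬ AccPt t (Filter.principal (slopeSet (lattOf M)))) ∧
      ∀ s : ℕ → ℝ, StrictMono s → (∀ n, s n ∈ slopeSet (lattOf M)) →
        (∀ t ∈ slopeSet (lattOf M), ∃ n, s n = t) →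
        ∀ a b : ℝ, 0 ≤ a → a < b →
          Tendsto (fun N : ℕ =>
              ({n : ℕ | n < N ∧ s (n + 1) - s n ∈ Set.Ioo a b}.ncard : ℝ) / N)
            atTop (𝓝 (2 * (volume (Aset a b)).toReal)) := by
  have h := slopeSet_lattOf M hM hvert
  set L := nonVertLatticeOf M hM hvert
  rw [h]
  refine ⟨Set.infinite_of_not_bddAbove L.not_bddAbove_slopes, ?_, L.not_accPt_slopes, ?_⟩
  · rintro _ ⟨w, -, -, -, hw, rfl⟩
    exact hw
  · intro s hs hmem hsurj a b _ _
    exact NonVertLattice.tendsto_ncard_gaps_div hs hmem hsurj a b
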